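/- arXiv:1707.07919 — 3 statements merged into one kernel-verified Lean document; each statement's English description precedes it below -/
import Mathlib

section
/- For every nonempty finite set Z of resource levels with transition rates μ(z,y) > 0 (z ≠ y), every decision rate λ > 0, survival probability γ ∈ (0,1), agent density β > 0, and every resource-sharing function F, there exists a mean field equilibrium (ξ, κ, V_sw, π, V, V_st); moreover it can be chosen so that κ ∈ [β·λ·(1−γ), β·λ] and there exists N₀ ∈ ℕ with ξ(z,n) = 0 for all z ∈ Z and all n ≥ N₀. -/
open scoped BigOperators

variable {Z : Type}

/-- A Markovian strategy `ξ : S → [0,1]` on the state space `S = Z × ℕ`. -/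
def IsStrategy (ξ : Z → ℕ → ℝ) : Prop := ∀ z n, 0 ≤ ξ z n ∧ ξ z n ≤ 1

/-- The balance (stationarity) equations for the single-location chain `MC(ξ, κ)`. -/
def Balance [Fintype Z] [DecidableEq Z] (μ : Z → Z → ℝ) (lam γ κ : ℝ)
    (ξ : Z → ℕ → ℝ) (π : Z → ℕ → ℝ) : Prop :=
  ∀ x : Z, ∀ m : ℕ,
    π x m * ((∑ y ∈ Finset.univ.filter (fun y => y ≠ x), μ x y) + κ
        + lam * m * (1 - γ * ξ x m))
      = (∑ z ∈ Finset.univ.filter (fun z => z ≠ x), π z m * μ z x)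
        + κ * (if 1 ≤ m then π x (m - 1) else 0)
        + lam * (m + 1) * (1 - γ * ξ x (m + 1)) * π x (m + 1)

/-- A probability solution of the balance equations for `(ξ, κ)`. -/
def IsProbSolution [Fintype Z] [DecidableEq Z] (μ : Z → Z → ℝ) (lam γ κ : ℝ)
    (ξ : Z → ℕ → ℝ) (π : Z → ℕ → ℝ) : Prop :=
  (∀ z n, 0 ≤ π z n) ∧ Summable (fun p : Z × ℕ => π p.1 p.2) ∧
    (∑' p : Z × ℕ, π p.1 p.2) = 1 ∧ Balance μ lam γ κ ξ π

/-- A resource-sharing function: nonnegative, positive somewhere (with `n ≥ 1`),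
and tending to `0` as the number of agents grows. -/
def IsResourceSharing (F : Z → ℕ → ℝ) : Prop :=
  (∀ z n, 0 ≤ F z n) ∧ (∃ z₀ n₀, 1 ≤ n₀ ∧ 0 < F z₀ n₀) ∧
    ∀ z, Filter.Tendsto (fun n => F z n) Filter.atTop (nhds 0)

/-- A value-function pair `(V, V_st)` for `(ξ, κ, V_sw)`: the Bellman equations. -/
def IsValuePair [Fintype Z] [DecidableEq Z] (μ : Z → Z → ℝ) (lam γ κ V_sw : ℝ)
    (F ξ : Z → ℕ → ℝ) (V V_st : Z → ℕ → ℝ) : Prop :=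
  (∃ M, ∀ z n, |V z n| ≤ M) ∧ (∃ M, ∀ z n, |V_st z n| ≤ M) ∧
    ∀ z : Z, ∀ n : ℕ, 1 ≤ n →
      V z n = F z n + γ * max (V_st z n) V_sw ∧
      ((n : ℝ) * lam + κ + ∑ y ∈ Finset.univ.filter (fun y => y ≠ z), μ z y) * V_st z n
        = lam * V z n + κ * V_st z (n + 1)
          + (∑ w ∈ Finset.univ.filter (fun w => w ≠ z), μ z w * V_st w n)
          + ((n : ℝ) - 1) * lam * (1 - γ * ξ z n) * V_st z (n - 1)
          + ((n : ℝ) - 1) * lam * γ * ξ z n * V_st z n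

/-- A mean field equilibrium `(ξ, κ, V_sw, π, V, V_st)`. -/
def IsMFE [Fintype Z] [DecidableEq Z] (μ : Z → Z → ℝ) (lam γ β : ℝ) (F : Z → ℕ → ℝ)
    (ξ : Z → ℕ → ℝ) (κ V_sw : ℝ) (π V V_st : Z → ℕ → ℝ) : Prop :=
  IsStrategy ξ ∧ 0 < κ ∧ 0 < V_sw ∧
    IsProbSolution μ lam γ κ ξ π ∧
    IsValuePair μ lam γ κ V_sw F ξ V V_st ∧
    (∀ z : Z, ∀ n : ℕ, 1 ≤ n →
      (V_sw < V_st z n → ξ z n = 1) ∧ (V_st z n < V_sw → ξ z n = 0)) ∧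
    V_sw = (∑' p : Z × ℕ, π p.1 p.2 * V_st p.1 (p.2 + 1)) ∧
    (∑' p : Z × ℕ, (p.2 : ℝ) * π p.1 p.2) = β

/-- `Ψ = (1/λ) · max_{z ∈ Z} ∑_{y ≠ z} μ(z,y)`. -/
noncomputable def Psi [Fintype Z] [DecidableEq Z] [Nonempty Z]
    (μ : Z → Z → ℝ) (lam : ℝ) : ℝ :=
  (1 / lam) * Finset.univ.sup' Finset.univ_nonempty
    (fun z : Z => ∑ y ∈ Finset.univ.filter (fun y => y ≠ z), μ z y)


set_option linter.unusedSectionVars false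
section Scarf
variable {T I : Type} [Fintype T] [DecidableEq T] [Fintype I] [DecidableEq I]

/-- dominance -/
def SDom (r : I → T → ℕ) (σ : Finset T) : Prop := ∀ t, ∃ i, ∀ s ∈ σ, r i t ≤ r i s

def SM (r : I → T → ℕ) (τ : Finset T) (i : I) (x : T) : Prop :=
  ∀ j, j ≠ i → ∃ s ∈ τ, r j s < r j x

def SMax (r : I → T → ℕ) (τ : Finset T) (i : I) (x : T) : Prop :=
  SM r τ i x ∧ ∀ y, SM r τ i y → r i y ≤ r i x

lemma SDom.mono {r : I → T → ℕ} {σ τ : Finset T} (h : SDom r σ) (hs : τ ⊆ σ) : SDom r τ := by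
  intro t
  obtain ⟨i, hi⟩ := h t
  exact ⟨i, fun s hs' => hi s (hs hs')⟩

lemma SMax.exists {r : I → T → ℕ} {τ : Finset T} {i : I} {y : T} (h : SM r τ i y) :
    ∃ x, SMax r τ i x := by
  classical
  obtain ⟨x, hx, hm⟩ := Finset.exists_max_image (Finset.univ.filter (SM r τ i)) (r i) ⟨y, by simpa⟩
  exact ⟨x, by simpa using hx, fun y hy => hm y (by simpa using hy)⟩

lemma scarf_door (r : I → T → ℕ) (hr : ∀ i, Function.Injective (r i)) (τ : Finset T)
    (hτ : SDom r τ) (hc : τ.card + 1 = Fintype.card I) (hne : τ.Nonempty) :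
    ∃ i₁ i₂, i₁ ≠ i₂ ∧ (∃ s ∈ τ, (∀ t ∈ τ, r i₁ s ≤ r i₁ t) ∧ (∀ t ∈ τ, r i₂ s ≤ r i₂ t)) ∧
      (∀ x, (x ∉ τ ∧ SDom r (insert x τ)) ↔ (SMax r τ i₁ x ∨ SMax r τ i₂ x)) := by
  have hmin : ∀ i, ∃ s ∈ τ, ∀ t ∈ τ, r i s ≤ r i t := fun i => Finset.exists_min_image τ (r i) hne
  choose m hm hmm using hmin
  obtain ⟨i₁, -, i₂, -, hne12, heq⟩ := Finset.exists_ne_map_eq_of_card_lt_of_maps_to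
    (s := (Finset.univ : Finset I)) (t := τ) (f := m) (by rw [Finset.card_univ]; omega)
    (fun i _ => hm i)
  have key : ∀ a b, a ≠ b → m a = m b → ∀ x, SMax r τ a x → (x ∉ τ ∧ SDom r (insert x τ)) := by
    intro a b hab hmab x ⟨hx, hxm⟩
    constructor
    · intro hxτ
      obtain ⟨i, hi⟩ := hτ x
      by_cases hia : i = a
      · subst hia
        have : x = m i := hr i (le_antisymm (hi _ (hm i)) (hmm i x hxτ))
        obtain ⟨s, hs, hlt⟩ := hx b hab.symm
        have := hmm b s hs
        rw [← hmab, ← ‹x = m i›] at this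
        omega
      · obtain ⟨s, hs, hlt⟩ := hx i hia
        have := hi s hs
        omega
    · intro t
      by_cases h : SM r τ a t
      · obtain ⟨j, hj⟩ := hτ t
        by_cases hja : j = a
        · subst hja
          refine ⟨j, fun s hs => ?_⟩
          rcases Finset.mem_insert.1 hs with rfl | hs
          · exact hxm t h
          · exact hj s hs
        · obtain ⟨s, hs, hlt⟩ := h j hja
          have := hj s hs
          omega
      · unfold SM at h
        push Not at h
        obtain ⟨j, hja, hj⟩ := h
        refine ⟨j, fun s hs => ?_⟩
        rcases Finset.mem_insert.1 hs with rfl | hs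
        · obtain ⟨s', hs', hlt⟩ := hx j hja
          exact (hj s' hs').trans hlt.le
        · exact hj s hs
  refine ⟨i₁, i₂, hne12, ⟨m i₁, hm _, hmm i₁, ?_⟩, fun x => ⟨?_, ?_⟩⟩
  · rw [heq]; exact hmm i₂
  · rintro ⟨hx, hd⟩
    -- each element of insert x τ is a min for some index
    choose g hg using hd
    have hinj : Set.InjOn g (insert x τ : Finset T) := by
      intro a ha b hb hab
      apply hr (g a)
      apply le_antisymm (hg a b hb)
      rw [hab]; exact hg b a ha
    have hcard : (insert x τ).card = (Finset.univ : Finset I).card := by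
      rw [Finset.card_insert_of_notMem hx, Finset.card_univ, hc]
    have himg : (insert x τ).image g = Finset.univ := by
      apply Finset.eq_univ_of_card
      rw [Finset.card_image_of_injOn hinj, hcard, Finset.card_univ]
    have hsurj : ∀ j, j ≠ g x → ∃ s ∈ τ, g s = j := by
      intro j hj
      have : j ∈ (insert x τ).image g := by rw [himg]; simp
      obtain ⟨s, hs, rfl⟩ := Finset.mem_image.1 this
      rcases Finset.mem_insert.1 hs with rfl | hs
      · exact absurd rfl hj
      · exact ⟨s, hs, rfl⟩
    have hM : SMax r τ (g x) x := by
      constructor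
      · intro j hj
        obtain ⟨s, hs, rfl⟩ := hsurj j hj
        refine ⟨s, hs, lt_of_le_of_ne (hg s x (by simp)) fun h => hx ?_⟩
        rw [← hr _ h]; exact hs
      · intro y hy
        have h1 := hg y
        by_cases hyj : g y = g x
        · rw [← hyj]; exact h1 x (by simp)
        · obtain ⟨s, hs, hlt⟩ := hy _ hyj
          have := h1 s (by simp [hs])
          omega
    have hgm : ∀ j, j ≠ g x → g (m j) = j := by
      intro j hj
      obtain ⟨s, hs, rfl⟩ := hsurj j hj
      congr 1
      apply hr (g s)
      exact le_antisymm (hmm _ s hs) (hg s _ (by simp [hm]))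
    by_cases h1 : g x = i₁
    · left; rw [← h1]; exact hM
    · by_cases h2 : g x = i₂
      · right; rw [← h2]; exact hM
      · exact absurd (by rw [← hgm i₁ (Ne.symm h1), heq, hgm i₂ (Ne.symm h2)]) hne12
  · rintro (h | h)
    · exact key _ _ hne12 heq x h
    · exact key _ _ hne12.symm heq.symm x h

lemma SMax.unique {r : I → T → ℕ} (hr : ∀ i, Function.Injective (r i)) {τ : Finset T} {i : I}
    {x y : T} (hx : SMax r τ i x) (hy : SMax r τ i y) : x = y :=
  hr i (le_antisymm (hy.2 _ hx.1) (hx.2 _ hy.1))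

lemma SM.disj {r : I → T → ℕ} {τ : Finset T} (hτ : SDom r τ) {i j : I} (hij : i ≠ j) {x : T}
    (h1 : SM r τ i x) (h2 : SM r τ j x) : False := by
  obtain ⟨a, ha⟩ := hτ x
  by_cases h : a = i
  · subst h
    obtain ⟨s, hs, hl⟩ := h2 a hij
    have := ha s hs
    omega
  · obtain ⟨s, hs, hl⟩ := h1 a h
    have := ha s hs
    omega

end Scarf

set_option linter.unusedSectionVars false
section Scarf2
variable {T I : Type} [Fintype T] [DecidableEq T] [Fintype I] [DecidableEq I]

def SDoor (r : I → T → ℕ) (c : T → I) (i₀ : I) (τ : Finset T) : Prop :=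
  SDom r τ ∧ τ.card + 1 = Fintype.card I ∧ τ.image c = Finset.univ.erase i₀

def SRoom (r : I → T → ℕ) (σ : Finset T) : Prop :=
  SDom r σ ∧ σ.card = Fintype.card I

def SGraph (r : I → T → ℕ) (c : T → I) (i₀ : I) : SimpleGraph (Finset T) where
  Adj a b := (SDoor r c i₀ a ∧ SRoom r b ∧ a ⊆ b) ∨ (SDoor r c i₀ b ∧ SRoom r a ∧ b ⊆ a)
  symm := ⟨fun a b h => h.symm⟩
  loopless := ⟨fun a h => by
    rcases h with ⟨h1, h2, -⟩ | ⟨h1, h2, -⟩ <;> have := h1.2.1 <;> have := h2.2 <;> omega⟩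

lemma sgraph_adj_door {r : I → T → ℕ} {c : T → I} {i₀ : I} {τ : Finset T} (hτ : SDoor r c i₀ τ)
    (b : Finset T) :
    (SGraph r c i₀).Adj τ b ↔ ∃ x, (x ∉ τ ∧ SDom r (insert x τ)) ∧ b = insert x τ := by
  constructor
  · rintro (⟨-, h2, h3⟩ | ⟨-, h2, -⟩)
    · have h4 := h2.2
      have h5 := hτ.2.1
      obtain ⟨x, hx, hb⟩ := Finset.exists_eq_insert_iff.2 ⟨h3, by omega⟩
      exact ⟨x, ⟨hx, by rw [hb]; exact h2.1⟩, hb.symm⟩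
    · have := h2.2; have := hτ.2.1; omega
  · rintro ⟨x, ⟨h1, h2⟩, rfl⟩
    left
    refine ⟨hτ, ⟨h2, ?_⟩, by simp⟩
    rw [Finset.card_insert_of_notMem h1]; exact hτ.2.1

lemma sgraph_adj_room {r : I → T → ℕ} {c : T → I} {i₀ : I} {σ : Finset T} (hσ : SRoom r σ)
    (b : Finset T) :
    (SGraph r c i₀).Adj σ b ↔ ∃ x ∈ σ, (σ.erase x).image c = Finset.univ.erase i₀ ∧
      b = σ.erase x := by
  constructor
  · rintro (⟨h1, -, -⟩ | ⟨h1, -, h3⟩)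
    · have := h1.2.1; have := hσ.2; omega
    · have h4 := h1.2.1
      have h5 := hσ.2
      obtain ⟨x, hx, hb⟩ := Finset.exists_eq_insert_iff.2 ⟨h3, by omega⟩
      have hb' : b = σ.erase x := by rw [← hb, Finset.erase_insert hx]
      exact ⟨x, by rw [← hb]; simp, by rw [← hb']; exact h1.2.2, hb'⟩
  · rintro ⟨x, hx, h2, rfl⟩
    right
    refine ⟨⟨hσ.1.mono (Finset.erase_subset _ _), ?_, h2⟩, hσ, Finset.erase_subset _ _⟩
    rw [Finset.card_erase_add_one hx]; exact hσ.2

open Classical in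
lemma sgraph_door_even {r : I → T → ℕ} (hr : ∀ i, Function.Injective (r i)) {c : T → I} {i₀ : I}
    {τ : Finset T} (hτ : SDoor r c i₀ τ) (hne : τ.Nonempty) (s : I → T)
    (H3 : ∀ t, (∀ j, t ≠ s j) → ∀ i j, j ≠ i → r i t < r i (s j))
    (p : T) (hp : p ∈ τ) (hps : ∀ j, p ≠ s j) : Even ((SGraph r c i₀).degree τ) := by
  obtain ⟨i₁, i₂, h12, -, hiff⟩ := scarf_door r hr τ hτ.1 hτ.2.1 hne
  have hSM : ∀ a, SM r τ a (s a) := fun a j hj => ⟨p, hp, H3 p hps j a hj.symm⟩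
  obtain ⟨x₁, hx₁⟩ := SMax.exists (hSM i₁)
  obtain ⟨x₂, hx₂⟩ := SMax.exists (hSM i₂)
  have hx12 : x₁ ≠ x₂ := by
    rintro rfl
    exact SM.disj hτ.1 h12 hx₁.1 hx₂.1
  have h1 := (hiff x₁).2 (Or.inl hx₁)
  have h2 := (hiff x₂).2 (Or.inr hx₂)
  have hnb : (SGraph r c i₀).neighborFinset τ = {insert x₁ τ, insert x₂ τ} := by
    ext b
    rw [SimpleGraph.mem_neighborFinset, sgraph_adj_door hτ]
    simp only [Finset.mem_insert, Finset.mem_singleton]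
    constructor
    · rintro ⟨x, hx, rfl⟩
      rcases (hiff x).1 hx with h | h
      · left; rw [h.unique hr hx₁]
      · right; rw [h.unique hr hx₂]
    · rintro (rfl | rfl)
      · exact ⟨_, h1, rfl⟩
      · exact ⟨_, h2, rfl⟩
  have : insert x₁ τ ≠ insert x₂ τ := by
    intro h
    have : x₁ ∈ insert x₂ τ := by rw [← h]; simp
    rcases Finset.mem_insert.1 this with h | h
    · exact hx12 h
    · exact h1.1 h
  rw [← SimpleGraph.card_neighborFinset_eq_degree, hnb, Finset.card_pair this]
  exact even_two

open Classical in
lemma sgraph_outer {r : I → T → ℕ} (hr : ∀ i, Function.Injective (r i)) {c : T → I} {i₀ : I}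
    {τ : Finset T} (hτ : SDoor r c i₀ τ) (hne : τ.Nonempty) (s : I → T)
    (hs : Function.Injective s)
    (H2 : ∀ i t, r i (s i) ≤ r i t)
    (H3 : ∀ t, (∀ j, t ≠ s j) → ∀ i j, j ≠ i → r i t < r i (s j))
    (hτs : ∀ x, x ∈ τ ↔ ∃ j, j ≠ i₀ ∧ x = s j)
    (p : T) (hps : ∀ j, p ≠ s j) : Odd ((SGraph r c i₀).degree τ) := by
  obtain ⟨j, hj, hmin, hiff⟩ : ∃ j, j ≠ i₀ ∧ (∀ t ∈ τ, r i₀ (s j) ≤ r i₀ t) ∧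
      (∀ x, (x ∉ τ ∧ SDom r (insert x τ)) ↔ (SMax r τ i₀ x ∨ SMax r τ j x)) := by
    obtain ⟨i₁, i₂, h12, ⟨t, ht, ht1, ht2⟩, hiff⟩ := scarf_door r hr τ hτ.1 hτ.2.1 hne
    have hm : ∀ i, i ≠ i₀ → (∀ t' ∈ τ, r i t ≤ r i t') → t = s i := fun i hi h =>
      hr i (le_antisymm (h _ ((hτs _).2 ⟨i, hi, rfl⟩)) (H2 i t))
    by_cases h1 : i₁ = i₀
    · subst h1
      have := hm i₂ h12.symm ht2
      subst this
      exact ⟨i₂, h12.symm, ht1, hiff⟩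
    · by_cases h2 : i₂ = i₀
      · subst h2
        have := hm i₁ h12 ht1
        subst this
        exact ⟨i₁, h12, ht2, fun x => (hiff x).trans or_comm⟩
      · exact absurd (hs ((hm i₁ h1 ht1).symm.trans (hm i₂ h2 ht2))) h12
  have hSM : SM r τ i₀ p := fun i hi => ⟨s i, (hτs _).2 ⟨i, hi, rfl⟩,
    lt_of_le_of_ne (H2 i p) fun h => hps i (hr i h).symm⟩
  obtain ⟨x₁, hx₁⟩ := SMax.exists hSM
  have hno : ∀ x, ¬ SM r τ j x := by
    intro x hx
    obtain ⟨s', hs', hlt⟩ := hx i₀ hj.symm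
    have h1 := hmin s' hs'
    by_cases hxr : ∀ l, x ≠ s l
    · have := H3 x hxr i₀ j hj; omega
    · push Not at hxr
      obtain ⟨l, rfl⟩ := hxr
      by_cases hl : l = i₀
      · subst hl; have := H2 l s'; omega
      · by_cases hlj : l = j
        · subst hlj; omega
        · obtain ⟨s'', hs'', hlt'⟩ := hx l hlj
          have := H2 l s''; omega
  have h1 := (hiff x₁).2 (Or.inl hx₁)
  have hnb : (SGraph r c i₀).neighborFinset τ = {insert x₁ τ} := by
    ext b
    rw [SimpleGraph.mem_neighborFinset, sgraph_adj_door hτ]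
    simp only [Finset.mem_singleton]
    constructor
    · rintro ⟨x, hx, rfl⟩
      rcases (hiff x).1 hx with h | h
      · rw [h.unique hr hx₁]
      · exact absurd h.1 (hno x)
    · rintro rfl
      exact ⟨_, h1, rfl⟩
  rw [← SimpleGraph.card_neighborFinset_eq_degree, hnb, Finset.card_singleton]
  exact odd_one

open Classical in
lemma sgraph_room_even {r : I → T → ℕ} {c : T → I} {i₀ : I}
    {σ : Finset T} (hσ : SRoom r σ) (hc : σ.image c ≠ Finset.univ) :
    Even ((SGraph r c i₀).degree σ) := by
  by_cases hex : ∃ y ∈ σ, (σ.erase y).image c = Finset.univ.erase i₀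
  · obtain ⟨y, hy, hyc⟩ := hex
    have hcy : c y ≠ i₀ := by
      intro h
      apply hc
      rw [← Finset.insert_erase hy, Finset.image_insert, hyc, h, Finset.insert_erase (by simp)]
    have hinj : Set.InjOn c (σ.erase y) := by
      apply Finset.injOn_of_card_image_eq
      rw [hyc, Finset.card_erase_of_mem (by simp), Finset.card_erase_of_mem hy, hσ.2,
        Finset.card_univ]
    obtain ⟨y', hy', hcy'⟩ : ∃ y' ∈ σ.erase y, c y' = c y := by
      have : c y ∈ (σ.erase y).image c := by rw [hyc]; simp [hcy]
      exact Finset.mem_image.1 this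
    have hyy : y' ≠ y := (Finset.mem_erase.1 hy').1
    have hy's : y' ∈ σ := (Finset.mem_erase.1 hy').2
    have himg' : (σ.erase y').image c = Finset.univ.erase i₀ := by
      rw [← hyc]
      ext k
      simp only [Finset.mem_image, Finset.mem_erase]
      constructor
      · rintro ⟨a, ⟨ha1, ha2⟩, rfl⟩
        by_cases h : a = y
        · subst h; exact ⟨y', ⟨hyy, hy's⟩, hcy'⟩
        · exact ⟨a, ⟨h, ha2⟩, rfl⟩
      · rintro ⟨a, ⟨ha1, ha2⟩, rfl⟩
        by_cases h : a = y'
        · subst h; exact ⟨y, ⟨hyy.symm, hy⟩, hcy'.symm⟩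
        · exact ⟨a, ⟨h, ha2⟩, rfl⟩
    have hnb : (SGraph r c i₀).neighborFinset σ = {σ.erase y, σ.erase y'} := by
      ext b
      rw [SimpleGraph.mem_neighborFinset, sgraph_adj_room hσ]
      simp only [Finset.mem_insert, Finset.mem_singleton]
      constructor
      · rintro ⟨x, hx, hxc, rfl⟩
        by_cases hxy : x = y
        · left; rw [hxy]
        · right
          have : c x ∈ (σ.erase y).image c :=
            Finset.mem_image_of_mem _ (by simp [hxy, hx])
          rw [hyc, ← hxc] at this
          obtain ⟨z, hz, hzx⟩ := Finset.mem_image.1 this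
          have hz' := Finset.mem_erase.1 hz
          by_cases hzy : z = y
          · subst hzy
            have : x = y' := hinj (by simp [hxy, hx]) (Finset.mem_coe.2 hy') (by rw [hcy', hzx])
            rw [this]
          · exact absurd (hinj (by simp [hzy, hz'.2]) (by simp [hxy, hx]) hzx) hz'.1
      · rintro (rfl | rfl)
        · exact ⟨_, hy, hyc, rfl⟩
        · exact ⟨_, hy's, himg', rfl⟩
    have : σ.erase y ≠ σ.erase y' := by
      intro h
      have : y ∈ σ.erase y := by rw [h]; simp [hyy.symm, hy]
      simp at this
    rw [← SimpleGraph.card_neighborFinset_eq_degree, hnb, Finset.card_pair this]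
    exact even_two
  · have hnb : (SGraph r c i₀).neighborFinset σ = ∅ := by
      ext b
      rw [SimpleGraph.mem_neighborFinset, sgraph_adj_room hσ]
      simp only [Finset.notMem_empty, iff_false]
      rintro ⟨x, hx, h, -⟩
      exact hex ⟨x, hx, h⟩
    rw [← SimpleGraph.card_neighborFinset_eq_degree, hnb]
    simp

lemma scarf [Nontrivial I] (r : I → T → ℕ) (hr : ∀ i, Function.Injective (r i)) (c : T → I)
    (s : I → T) (hcs : ∀ i, c (s i) = i)
    (H2 : ∀ i t, r i (s i) ≤ r i t)
    (H3 : ∀ t, (∀ j, t ≠ s j) → ∀ i j, j ≠ i → r i t < r i (s j))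
    (p : T) (hps : ∀ j, p ≠ s j) :
    ∃ σ, SDom r σ ∧ σ.image c = Finset.univ := by
  classical
  have hs : Function.Injective s := fun a b h => by rw [← hcs a, h, hcs]
  obtain ⟨i₀, i', hi'⟩ := exists_pair_ne I
  set τ₀ : Finset T := (Finset.univ.erase i₀).image s with hτ₀
  have hmem : ∀ x, x ∈ τ₀ ↔ ∃ j, j ≠ i₀ ∧ x = s j := by
    intro x
    simp [hτ₀, eq_comm]
  have hne : τ₀.Nonempty := ⟨s i', (hmem _).2 ⟨i', hi'.symm, rfl⟩⟩
  have hdoor : SDoor r c i₀ τ₀ := by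
    refine ⟨?_, ?_, ?_⟩
    · intro t
      by_cases ht : ∀ j, t ≠ s j
      · refine ⟨i₀, fun x hx => ?_⟩
        obtain ⟨j, hj, rfl⟩ := (hmem x).1 hx
        exact (H3 t ht i₀ j hj).le
      · push Not at ht
        obtain ⟨j, rfl⟩ := ht
        exact ⟨j, fun x _ => H2 j x⟩
    · rw [hτ₀, Finset.card_image_of_injective _ hs, Finset.card_erase_add_one (by simp),
        Finset.card_univ]
    · rw [hτ₀, Finset.image_image]
      have : c ∘ s = id := funext hcs
      rw [this, Finset.image_id]
  obtain ⟨w, hw, hodd⟩ := (SGraph r c i₀).exists_ne_odd_degree_of_exists_odd_degree τ₀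
    (sgraph_outer hr hdoor hne s hs H2 H3 hmem p hps)
  have hpos : 0 < (SGraph r c i₀).degree w := hodd.pos
  obtain ⟨b, hb⟩ := (SimpleGraph.degree_pos_iff_exists_adj _ _).1 hpos
  rcases hb with ⟨h1, -, -⟩ | ⟨-, h2, -⟩
  · exfalso
    have hwne : w.Nonempty := by
      have : i' ∈ w.image c := by rw [h1.2.2]; simp [hi'.symm]
      obtain ⟨a, ha, -⟩ := Finset.mem_image.1 this
      exact ⟨a, ha⟩
    by_cases hreal : ∃ q ∈ w, ∀ j, q ≠ s j
    · obtain ⟨q, hq, hqs⟩ := hreal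
      exact (Nat.not_even_iff_odd.2 hodd) (sgraph_door_even hr h1 hwne s H3 q hq hqs)
    · push Not at hreal
      apply hw
      ext x
      rw [hmem]
      constructor
      · intro hx
        obtain ⟨j, rfl⟩ := hreal x hx
        refine ⟨j, ?_, rfl⟩
        have : c (s j) ∈ w.image c := Finset.mem_image_of_mem _ hx
        rw [h1.2.2, hcs] at this
        exact (Finset.mem_erase.1 this).1
      · rintro ⟨j, hj, rfl⟩
        have : j ∈ w.image c := by rw [h1.2.2]; simp [hj]
        obtain ⟨a, ha, hca⟩ := Finset.mem_image.1 this
        obtain ⟨l, rfl⟩ := hreal a ha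
        rw [hcs] at hca
        rw [← hca]; exact ha
  · refine ⟨w, h2.1, ?_⟩
    by_contra hc
    exact (Nat.not_even_iff_odd.2 hodd) (sgraph_room_even h2 hc)
end Scarf2

set_option linter.unusedSectionVars false
section Brouwer
variable {I : Type} [Fintype I] [DecidableEq I]

lemma brouwer_approx [Nontrivial I] (f : (I → ℝ) → (I → ℝ))
    (hf : ∀ x ∈ stdSimplex ℝ I, f x ∈ stdSimplex ℝ I) (k : ℕ) (hk : 0 < k) :
    ∃ p : I → ℕ, ∑ i, p i = k ∧ ∀ i, ∃ q : I → ℕ, ∑ i, q i = k ∧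
      (∀ l, |(q l : ℝ) - p l| ≤ Fintype.card I) ∧
      (q i : ℝ) / k ≤ f (fun l => (q l : ℝ) / k) i + (Fintype.card I : ℝ) / k := by
  classical
  have hk' : (0 : ℝ) < k := by exact_mod_cast hk
  let P := {p : I → Fin (k + 1) // ∑ i, (p i : ℕ) = k}
  let N := Fintype.card P
  let e : P ≃ Fin N := Fintype.equivFin P
  let e' : I ≃ Fin (Fintype.card I) := Fintype.equivFin I
  let r : I → P ⊕ I → ℕ := fun i t => match t with
    | Sum.inl p => 1 + ((e p : ℕ) + N * (p.1 i : ℕ))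
    | Sum.inr j => if j = i then 0 else 1 + N * (k + 1) + (e' j : ℕ)
  have hrl : ∀ i (p : P), r i (Sum.inl p) = 1 + ((e p : ℕ) + N * (p.1 i : ℕ)) := fun _ _ => rfl
  have hrr : ∀ i (j : I), r i (Sum.inr j) = if j = i then 0 else 1 + N * (k + 1) + (e' j : ℕ) :=
    fun _ _ => rfl
  have hlt : ∀ i (p : P), r i (Sum.inl p) < 1 + N * (k + 1) := by
    intro i p
    rw [hrl]
    have h1 : (e p : ℕ) < N := (e p).2
    have h2 : (p.1 i : ℕ) ≤ k := Nat.lt_succ_iff.1 (p.1 i).2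
    have h3 := Nat.mul_le_mul_left N h2
    rw [Nat.mul_add]; omega
  have hr : ∀ i, Function.Injective (r i) := by
    intro i a b hab
    rcases a with p | j <;> rcases b with q | l
    · rw [hrl, hrl] at hab
      have h1 : (e p : ℕ) < N := (e p).2
      have h2 : (e q : ℕ) < N := (e q).2
      have h3 : ((e p : ℕ) + N * (p.1 i : ℕ)) % N = ((e q : ℕ) + N * (q.1 i : ℕ)) % N := by
        congr 1; omega
      rw [Nat.add_mul_mod_self_left, Nat.add_mul_mod_self_left, Nat.mod_eq_of_lt h1,
        Nat.mod_eq_of_lt h2] at h3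
      rw [e.injective (Fin.ext h3)]
    · have := hlt i p
      rw [hab, hrr] at this
      rw [hrl, hrr] at hab
      split_ifs at this hab <;> omega
    · have := hlt i q
      rw [← hab, hrr] at this
      rw [hrl, hrr] at hab
      split_ifs at this hab <;> omega
    · rw [hrr, hrr] at hab
      split_ifs at hab with h1 h2 h2
      · rw [h1, h2]
      · omega
      · omega
      · have : (e' j : ℕ) = e' l := by omega
        rw [e'.injective (Fin.ext this)]
  have hsimp : ∀ q : I → ℕ, ∑ i, q i = k → (fun l => (q l : ℝ) / k) ∈ stdSimplex ℝ I := by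
    intro q hq
    refine ⟨fun l => by positivity, ?_⟩
    rw [← Finset.sum_div, ← Nat.cast_sum, hq, div_self hk'.ne']
  have hcol : ∀ p : P, ∃ i, ((p.1 i : ℕ) : ℝ) / k ≤ f (fun l => ((p.1 l : ℕ) : ℝ) / k) i := by
    intro p
    by_contra! hcon
    have h1 := hsimp (fun l => (p.1 l : ℕ)) p.2
    have h2 := hf _ h1
    have h3 := Finset.sum_lt_sum_of_nonempty (s := (Finset.univ : Finset I))
      Finset.univ_nonempty (fun i _ => hcon i)
    rw [h2.2, h1.2] at h3
    exact lt_irrefl _ h3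
  choose c₀ hc₀ using hcol
  let c : P ⊕ I → I := Sum.elim c₀ id
  -- a base point
  have mkP : ∀ q : I → ℕ, ∑ i, q i = k → ∃ p : P, ∀ i, (p.1 i : ℕ) = q i := by
    intro q hq
    refine ⟨⟨fun i => ⟨q i, ?_⟩, ?_⟩, fun i => rfl⟩
    · rw [Nat.lt_succ_iff, ← hq]
      exact Finset.single_le_sum (f := q) (fun _ _ => Nat.zero_le _) (Finset.mem_univ i)
    · exact hq
  obtain ⟨j₀⟩ : Nonempty I := inferInstance
  obtain ⟨p₀, -⟩ := mkP (Pi.single j₀ k) (by simp)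
  obtain ⟨σ, hσ, hσc⟩ := scarf r hr c Sum.inr (fun i => rfl)
    (by intro i t; rw [hrr]; simp)
    (by
      intro t ht i j hj
      rcases t with p | l
      · rw [hrr, if_neg hj]
        exact lt_of_lt_of_le (hlt i p) (by omega)
      · exact absurd rfl (ht l))
    (Sum.inl p₀) (by simp)
  have hmemc : ∀ i, Sum.inr i ∉ σ → ∃ q : P, Sum.inl q ∈ σ ∧ c₀ q = i := by
    intro i hi
    have : i ∈ σ.image c := by rw [hσc]; simp
    obtain ⟨a, ha, hca⟩ := Finset.mem_image.1 this
    rcases a with q | l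
    · exact ⟨q, ha, hca⟩
    · have : l = i := hca
      subst this
      exact absurd ha hi
  have hreal : ∃ p : P, Sum.inl p ∈ σ := by
    obtain ⟨i, hi⟩ := hσ (Sum.inl p₀)
    by_cases h : Sum.inr i ∈ σ
    · have := hi _ h
      rw [hrr, hrl] at this
      simp at this
    · obtain ⟨q, hq, -⟩ := hmemc i h
      exact ⟨q, hq⟩
  obtain ⟨ps, hps⟩ := hreal
  let R : Finset P := Finset.univ.filter fun p => Sum.inl p ∈ σ
  have hR : ∀ p, p ∈ R ↔ Sum.inl p ∈ σ := fun p => by simp [R]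
  have hmin : ∀ i, ∃ p ∈ R, ∀ q ∈ R, (p.1 i : ℕ) ≤ q.1 i := fun i =>
    Finset.exists_min_image R (fun p => (p.1 i : ℕ)) ⟨ps, (hR _).2 hps⟩
  choose a ha ham using hmin
  let m : I → ℕ := fun i => ((a i).1 i : ℕ)
  let C : Finset I := Finset.univ.filter fun i => Sum.inr i ∉ σ
  have hCmem : ∀ i, i ∈ C ↔ Sum.inr i ∉ σ := fun i => by simp [C]
  have hC : k < ∑ i ∈ C, (m i + 1) := by
    by_contra! hle
    obtain ⟨t, ht⟩ := mkP (fun i => (if i ∈ C then m i + 1 else 0) +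
      (if i = j₀ then k - ∑ i ∈ C, (m i + 1) else 0)) (by
        rw [Finset.sum_add_distrib]
        simp only [Finset.sum_ite_mem, Finset.univ_inter, Finset.sum_ite_eq', Finset.mem_univ,
          if_true]
        omega)
    obtain ⟨i, hi⟩ := hσ (Sum.inl t)
    by_cases h : Sum.inr i ∈ σ
    · have := hi _ h
      rw [hrr, hrl] at this
      simp at this
    · have h1 := hi _ ((hR _).1 (ha i))
      rw [hrl, hrl] at h1
      have h2 := ht i
      rw [if_pos ((hCmem i).2 h)] at h2
      have h3 : m i + 1 ≤ (t.1 i : ℕ) := by omega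
      have h4 : N * (m i + 1) ≤ N * (t.1 i : ℕ) := Nat.mul_le_mul_left N h3
      have h5 : (e (a i) : ℕ) < N := (e (a i)).2
      have h6 : N * (m i + 1) = N * ((a i).1 i : ℕ) + N := by simp only [m]; ring
      omega
  have hCn : C.card ≤ Fintype.card I := Finset.card_le_univ C
  rw [Finset.sum_add_distrib, Finset.sum_const, smul_eq_mul, mul_one] at hC
  have hb1 : ∀ q ∈ R, ∀ i ∈ C, (q.1 i : ℕ) ≤ m i + Fintype.card I := by
    intro q hq i hi
    have h1 : ∑ l ∈ C, (q.1 l : ℕ) ≤ k := by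
      exact le_trans (Finset.sum_le_sum_of_subset (Finset.subset_univ _)) q.2.le
    rw [← Finset.add_sum_erase _ _ hi] at h1
    rw [← Finset.add_sum_erase _ m hi] at hC
    have h2 : ∑ l ∈ C.erase i, m l ≤ ∑ l ∈ C.erase i, (q.1 l : ℕ) :=
      Finset.sum_le_sum fun l _ => ham l q hq
    omega
  have hb2 : ∀ q ∈ R, ∀ i, i ∉ C → (q.1 i : ℕ) ≤ Fintype.card I := by
    intro q hq i hi
    have h1 : ∑ l ∈ insert i C, (q.1 l : ℕ) ≤ k := by
      exact le_trans (Finset.sum_le_sum_of_subset (Finset.subset_univ _)) q.2.le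
    rw [Finset.sum_insert hi] at h1
    have h2 : ∑ l ∈ C, m l ≤ ∑ l ∈ C, (q.1 l : ℕ) :=
      Finset.sum_le_sum fun l _ => ham l q hq
    omega
  have hclose : ∀ q ∈ R, ∀ p ∈ R, ∀ l, (q.1 l : ℝ) - (p.1 l : ℕ) ≤ Fintype.card I := by
    intro q hq p hp l
    have : (q.1 l : ℕ) ≤ (p.1 l : ℕ) + Fintype.card I := by
      by_cases hl : l ∈ C
      · have := hb1 q hq l hl
        have h2 : m l ≤ (p.1 l : ℕ) := ham l p hp
        omega
      · have := hb2 q hq l hl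
        omega
    have h2 : ((q.1 l : ℕ) : ℝ) ≤ (p.1 l : ℕ) + (Fintype.card I : ℕ) := by exact_mod_cast this
    linarith
  have hpsR := (hR _).2 hps
  refine ⟨fun i => (ps.1 i : ℕ), ps.2, fun i => ?_⟩
  by_cases hi : i ∈ C
  · obtain ⟨q, hq, hqc⟩ := hmemc i ((hCmem i).1 hi)
    have hqR := (hR _).2 hq
    refine ⟨fun i => (q.1 i : ℕ), q.2, fun l => ?_, ?_⟩
    · rw [abs_le]
      constructor
      · have := hclose ps hpsR q hqR l
        linarith
      · exact hclose q hqR ps hpsR l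
    · have := hc₀ q
      rw [hqc] at this
      have h2 : 0 ≤ (Fintype.card I : ℝ) / k := by positivity
      linarith
  · refine ⟨fun i => (ps.1 i : ℕ), ps.2, fun l => by simp, ?_⟩
    have h1 := (hf _ (hsimp (fun l => (ps.1 l : ℕ)) ps.2)).1 i
    have h2 : ((ps.1 i : ℕ) : ℝ) / k ≤ (Fintype.card I : ℝ) / k := by
      have := hb2 ps hpsR i hi
      have : ((ps.1 i : ℕ) : ℝ) ≤ (Fintype.card I : ℕ) := by exact_mod_cast this
      gcongr
    linarith

open Filter Topology in
lemma brouwer_simplex [Nontrivial I] (f : (I → ℝ) → (I → ℝ))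
    (hf : ∀ x ∈ stdSimplex ℝ I, f x ∈ stdSimplex ℝ I) (hc : ContinuousOn f (stdSimplex ℝ I)) :
    ∃ x ∈ stdSimplex ℝ I, f x = x := by
  have h := fun k : ℕ => brouwer_approx f hf (k + 1) (Nat.succ_pos k)
  choose p hp q hq hqp hqf using h
  have hs : ∀ (k : ℕ) (q : I → ℕ), ∑ i, q i = k + 1 →
      (fun l => (q l : ℝ) / ((k + 1 : ℕ) : ℝ)) ∈ stdSimplex ℝ I := by
    intro k q hq
    refine ⟨fun l => by positivity, ?_⟩
    rw [← Finset.sum_div, ← Nat.cast_sum, hq, div_self (by positivity)]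
  obtain ⟨x, hx, φ, hφ, hlim⟩ := (isCompact_stdSimplex ℝ I).tendsto_subseq (fun k => hs k (p k) (hp k))
  have hzero : Tendsto (fun k : ℕ => (Fintype.card I : ℝ) / ((φ k + 1 : ℕ) : ℝ)) atTop (𝓝 0) := by
    have := (tendsto_const_div_atTop_nhds_zero_nat (Fintype.card I : ℝ)).comp
      ((tendsto_add_atTop_nat 1).comp hφ.tendsto_atTop)
    exact this
  have hqlim : ∀ i, Tendsto (fun k => (fun l => (q (φ k) i l : ℝ) / ((φ k + 1 : ℕ) : ℝ)))
      atTop (𝓝 x) := by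
    intro i
    rw [tendsto_pi_nhds] at hlim ⊢
    intro l
    have h1 : Tendsto (fun k => (p (φ k) l : ℝ) / ((φ k + 1 : ℕ) : ℝ)) atTop (𝓝 (x l)) := hlim l
    have h2 : Tendsto (fun k => (q (φ k) i l : ℝ) / ((φ k + 1 : ℕ) : ℝ) -
        (p (φ k) l : ℝ) / ((φ k + 1 : ℕ) : ℝ)) atTop (𝓝 0) := by
      apply squeeze_zero_norm _ hzero
      intro k
      rw [← sub_div, norm_div, Real.norm_eq_abs, Real.norm_eq_abs, Nat.abs_cast]
      gcongr
      exact hqp (φ k) i l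
    have := h2.add h1
    simpa using this
  have hle : ∀ i, x i ≤ f x i := by
    intro i
    have hqx : Tendsto (fun k => (fun l => (q (φ k) i l : ℝ) / ((φ k + 1 : ℕ) : ℝ)))
      atTop (𝓝[stdSimplex ℝ I] x) := by
      rw [tendsto_nhdsWithin_iff]
      exact ⟨hqlim i, Eventually.of_forall fun k => hs _ _ (hq (φ k) i)⟩
    have h1 := ((hc x hx).tendsto.comp hqx)
    have h2 := ((tendsto_pi_nhds.1 h1) i).add hzero
    rw [add_zero] at h2
    exact le_of_tendsto_of_tendsto' ((tendsto_pi_nhds.1 (hqlim i)) i) h2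
      (fun k => hqf (φ k) i)
  refine ⟨x, hx, ?_⟩
  have hsum : ∑ i, x i = ∑ i, f x i := by rw [hx.2, (hf x hx).2]
  have := (Finset.sum_eq_sum_iff_of_le (fun i _ => hle i)).1 hsum
  funext i
  exact (this i (Finset.mem_univ i)).symm
end Brouwer

set_option linter.unusedSectionVars false

lemma brouwer_cube_fin {J : Type} [Fintype J] (f : (J → ℝ) → (J → ℝ))
    (hf : ∀ x ∈ Set.pi Set.univ (fun _ : J => Set.Icc (0 : ℝ) 1),
      f x ∈ Set.pi Set.univ (fun _ : J => Set.Icc (0 : ℝ) 1))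
    (hc : ContinuousOn f (Set.pi Set.univ (fun _ : J => Set.Icc (0 : ℝ) 1))) :
    ∃ x ∈ Set.pi Set.univ (fun _ : J => Set.Icc (0 : ℝ) 1), f x = x := by
  classical
  rcases isEmpty_or_nonempty J with hJ | hJ
  · exact ⟨fun j => 0, fun j => hJ.elim j, funext fun j => hJ.elim j⟩
  set Q := Set.pi Set.univ (fun _ : J => Set.Icc (0 : ℝ) 1)
  have hn : (0 : ℝ) < Fintype.card J := by exact_mod_cast Fintype.card_pos
  set n : ℝ := (Fintype.card J : ℝ)
  let X : (Option J → ℝ) → (J → ℝ) := fun y j => min 1 (n * y (some j))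
  let G : (Option J → ℝ) → (Option J → ℝ) := fun y o =>
    o.elim (1 - ∑ j, f (X y) j / n) (fun j => f (X y) j / n)
  have hX : ∀ y ∈ stdSimplex ℝ (Option J), X y ∈ Q := by
    intro y hy j _
    have := hy.1 (some j)
    exact ⟨le_min zero_le_one (by positivity), min_le_left _ _⟩
  have hsum : ∀ x ∈ Q, ∑ j, x j / n ≤ 1 := by
    intro x hx
    rw [← Finset.sum_div, div_le_one hn]
    calc ∑ j, x j ≤ ∑ j : J, (1 : ℝ) := Finset.sum_le_sum fun j _ => (hx j trivial).2
      _ = n := by simp [n]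
  have hXc : Continuous X := by fun_prop
  have hGc : ContinuousOn G (stdSimplex ℝ (Option J)) := by
    have h1 : ContinuousOn (fun y => f (X y)) (stdSimplex ℝ (Option J)) :=
      hc.comp hXc.continuousOn hX
    rw [continuousOn_pi] at h1 ⊢
    intro o
    rcases o with _ | j
    · exact continuousOn_const.sub (continuousOn_finsetSum _ fun j _ => (h1 j).div_const n)
    · exact (h1 j).div_const n
  obtain ⟨y, hy, hfix⟩ := brouwer_simplex G (by
    intro y hy
    have h1 := hf _ (hX y hy)
    refine ⟨fun o => ?_, ?_⟩
    · rcases o with _ | j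
      · exact sub_nonneg.2 (hsum _ h1)
      · exact div_nonneg (h1 j trivial).1 hn.le
    · rw [Fintype.sum_option]
      simp [G]) hGc
  refine ⟨X y, hX y hy, ?_⟩
  funext j
  have h1 := congrFun hfix (some j)
  have h2 := (hf _ (hX y hy)) j trivial
  have h3 : f (X y) j / n = y (some j) := h1
  rw [div_eq_iff hn.ne'] at h3
  have h4 : X y j = min 1 (n * y (some j)) := rfl
  rw [h4, mul_comm, ← h3, min_eq_right h2.2]

lemma brouwer_cube {ι : Type} (f : (ι → ℝ) → (ι → ℝ))
    (hf : ∀ x ∈ Set.pi Set.univ (fun _ : ι => Set.Icc (0 : ℝ) 1),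
      f x ∈ Set.pi Set.univ (fun _ : ι => Set.Icc (0 : ℝ) 1))
    (hc : ContinuousOn f (Set.pi Set.univ (fun _ : ι => Set.Icc (0 : ℝ) 1))) :
    ∃ x ∈ Set.pi Set.univ (fun _ : ι => Set.Icc (0 : ℝ) 1), f x = x := by
  classical
  set Q := Set.pi Set.univ (fun _ : ι => Set.Icc (0 : ℝ) 1) with hQdef
  have hQ : IsCompact Q := isCompact_univ_pi fun _ => isCompact_Icc
  let C : ι → Set (ι → ℝ) := fun j => Q ∩ (fun x => f x j - x j) ⁻¹' {0}
  have hC : ∀ j, IsClosed (C j) := by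
    intro j
    apply ContinuousOn.preimage_isClosed_of_isClosed _ hQ.isClosed isClosed_singleton
    exact ((continuousOn_pi.1 hc) j).sub (continuous_apply j).continuousOn
  obtain ⟨x, hx, hx2⟩ := hQ.inter_iInter_nonempty C hC (by
    intro u
    let E : ({j // j ∈ u} → ℝ) → (ι → ℝ) := fun x i => if h : i ∈ u then x ⟨i, h⟩ else 0
    have hEQ : ∀ x ∈ Set.pi Set.univ (fun _ : {j // j ∈ u} => Set.Icc (0 : ℝ) 1), E x ∈ Q := by
      intro x hx i _
      by_cases h : i ∈ u
      · simp only [E, dif_pos h]; exact hx _ trivial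
      · simp only [E, dif_neg h]; simp
    have hEc : Continuous E := by
      apply continuous_pi
      intro i
      by_cases h : i ∈ u
      · simp only [E, dif_pos h]; fun_prop
      · simp only [E, dif_neg h]; fun_prop
    obtain ⟨x, hx, hfx⟩ := brouwer_cube_fin (fun x (j : {j // j ∈ u}) => f (E x) j)
      (fun x hx j _ => hf _ (hEQ x hx) j trivial)
      (by
        have := hc.comp hEc.continuousOn hEQ
        rw [continuousOn_pi] at this ⊢
        exact fun j => this j)
    refine ⟨E x, hEQ x hx, ?_⟩
    simp only [Set.mem_iInter]
    intro i hi
    refine ⟨hEQ x hx, ?_⟩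
    have := congrFun hfx ⟨i, hi⟩
    simp only at this
    simp [E, hi] at this ⊢
    rw [← this]; simp [E])
  refine ⟨x, hx, ?_⟩
  funext j
  have := (Set.mem_iInter.1 hx2 j).2
  simpa [sub_eq_zero] using this

/-- Brouwer on an arbitrary product of compact intervals. -/
lemma brouwer_box {ι : Type} (a b : ι → ℝ) (hab : ∀ i, a i ≤ b i) (f : (ι → ℝ) → (ι → ℝ))
    (hf : ∀ x ∈ Set.pi Set.univ (fun i => Set.Icc (a i) (b i)),
      f x ∈ Set.pi Set.univ (fun i => Set.Icc (a i) (b i)))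
    (hc : ContinuousOn f (Set.pi Set.univ (fun i => Set.Icc (a i) (b i)))) :
    ∃ x ∈ Set.pi Set.univ (fun i => Set.Icc (a i) (b i)), f x = x := by
  let Y : (ι → ℝ) → (ι → ℝ) := fun x i => a i + x i * (b i - a i)
  have hY : ∀ x ∈ Set.pi Set.univ (fun _ : ι => Set.Icc (0 : ℝ) 1),
      Y x ∈ Set.pi Set.univ (fun i => Set.Icc (a i) (b i)) := by
    intro x hx i _
    have h1 := hx i trivial
    have h2 := sub_nonneg.2 (hab i)
    constructor
    · have := mul_nonneg h1.1 h2
      simp only [Y]; linarith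
    · have := mul_le_mul_of_nonneg_right h1.2 h2
      simp only [Y]; linarith
  have hYc : Continuous Y := by fun_prop
  obtain ⟨x, hx, hfx⟩ := brouwer_cube (fun x i => (f (Y x) i - a i) / (b i - a i))
    (by
      intro x hx i _
      have h1 := hf _ (hY x hx) i trivial
      have h2 := sub_nonneg.2 (hab i)
      exact ⟨div_nonneg (sub_nonneg.2 h1.1) h2, div_le_one_of_le₀ (by linarith [h1.2]) h2⟩)
    (by
      have := hc.comp hYc.continuousOn hY
      rw [continuousOn_pi] at this ⊢
      intro i
      exact ((this i).sub continuousOn_const).div_const _)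
  refine ⟨Y x, hY x hx, ?_⟩
  funext i
  have h1 := congrFun hfx i
  have h2 := hf _ (hY x hx) i trivial
  by_cases h : b i - a i = 0
  · have h3 := hY x hx i trivial
    linarith [h2.1, h2.2, h3.1, h3.2]
  · rw [div_eq_iff h] at h1
    simp only [Y] at h1 ⊢
    linarith


lemma seq_lemma (U a : ℕ → ℝ) (κ lam δ W M : ℝ) (hκ : 0 < κ) (hlam : 0 < lam) (hδ : 0 < δ)
    (hU0 : ∀ n, 0 ≤ U n) (hUM : ∀ n, U n ≤ M) (N : ℕ) (hN : 1 ≤ N) (ha0 : ∀ n, 1 ≤ n → 0 ≤ a n)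
    (haM : ∀ n, 1 ≤ n → a n ≤ n * lam)
    (h : ∀ n, N ≤ n → W ≤ U n → κ * (U n - U (n + 1)) + a n * (U n - U (n - 1)) ≤ -(lam * δ)) :
    ∃ N₀, ∀ n, N₀ ≤ n → U n < W := by
  have step1 : ∀ n, N ≤ n → W ≤ U n → U (n + 1) ≤ U n := by
    intro n hn hW
    by_contra! hlt
    have key : ∀ k : ℕ, U (n + k) < U (n + k + 1) ∧ W + k * (lam * δ / κ) ≤ U (n + k + 1) := by
      intro k
      induction k with
      | zero => exact ⟨hlt, by simp; linarith⟩
      | succ k ih =>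
        obtain ⟨ih1, ih2⟩ := ih
        have hp : 0 ≤ (k : ℝ) * (lam * δ / κ) := by positivity
        have h1 := h (n + k + 1) (by omega) (by linarith)
        rw [Nat.add_sub_cancel] at h1
        have h2 := mul_nonneg (ha0 (n + k + 1) (by omega)) (sub_nonneg.2 ih1.le)
        have h3 : lam * δ / κ ≤ U (n + k + 1 + 1) - U (n + k + 1) := by
          rw [div_le_iff₀ hκ]; nlinarith
        have h4 : 0 < lam * δ / κ := by positivity
        refine ⟨by rw [← add_assoc]; linarith, ?_⟩
        rw [← add_assoc]; push_cast; linarith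
    obtain ⟨k, hk⟩ := exists_nat_gt ((M - W) / (lam * δ / κ))
    rw [div_lt_iff₀ (by positivity)] at hk
    linarith [(key k).2, hUM (n + k + 1)]
  have step2 : ∀ n, N ≤ n → W ≤ U n → U n ≤ U (n - 1) - δ / n := by
    intro n hn hW
    have h1 := h n hn hW
    have h2 := step1 n hn hW
    have hn0 : (0 : ℝ) < n := by exact_mod_cast (by omega : 0 < n)
    have h3 : lam * δ ≤ a n * (U (n - 1) - U n) := by nlinarith
    have h5 : 0 < U (n - 1) - U n := by
      by_contra! hcon
      have := mul_nonneg (ha0 n (by omega)) (neg_nonneg.2 hcon)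
      have : 0 < lam * δ := by positivity
      linarith
    have h6 := mul_le_mul_of_nonneg_right (haM n (by omega)) h5.le
    have h7 : lam * δ ≤ lam * (n * (U (n - 1) - U n)) := by linarith
    have h8 := le_of_mul_le_mul_left h7 hlam
    have : δ / n ≤ U (n - 1) - U n := by rw [div_le_iff₀ hn0]; linarith
    linarith
  by_contra! hcon
  have hall : ∀ n, N ≤ n → W ≤ U n := by
    intro n hn
    obtain ⟨n', hn', hW⟩ := hcon n
    obtain ⟨k, rfl⟩ := Nat.exists_eq_add_of_le hn'
    clear hn'
    induction k with
    | zero => exact hW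
    | succ k ih =>
      apply ih
      have h1 := step2 _ (by omega) hW
      have h2 : (0 : ℝ) ≤ δ / ((n + (k + 1) : ℕ) : ℝ) := by positivity
      rw [← add_assoc, Nat.add_sub_cancel] at h1
      rw [← add_assoc] at hW h2
      linarith
  have hdec : ∀ n, N ≤ n → U n + δ * ∑ i ∈ Finset.range n, (1 / ((i : ℝ) + 1)) ≤
      U N + δ * ∑ i ∈ Finset.range N, (1 / ((i : ℝ) + 1)) := by
    intro n hn
    induction n, hn using Nat.le_induction with
    | base => exact le_rfl
    | succ n hn ih =>
      rw [Finset.sum_range_succ]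
      have h1 := step2 (n + 1) (by omega) (hall _ (by omega))
      rw [Nat.add_sub_cancel] at h1
      push_cast at h1
      have h2 : δ * (1 / ((n : ℝ) + 1)) = δ / (n + 1) := by ring
      rw [mul_add, h2]
      linarith
  have hdiv := Real.tendsto_sum_range_one_div_nat_succ_atTop
  obtain ⟨n, hn1, hn2⟩ := ((hdiv.eventually_gt_atTop
    ((U N + δ * ∑ i ∈ Finset.range N, (1 / ((i : ℝ) + 1))) / δ)).and
    (Filter.eventually_ge_atTop N)).exists
  rw [div_lt_iff₀ hδ] at hn1
  linarith [hdec n hn2, hU0 n]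

lemma value_small [Fintype Z] [DecidableEq Z] [Nonempty Z] (μ : Z → Z → ℝ)
    (hμ : ∀ z y : Z, z ≠ y → 0 < μ z y)
    (lam γ κ W M : ℝ) (hlam : 0 < lam) (hγ0 : 0 < γ) (hγ1 : γ < 1) (hκ : 0 < κ) (hW : 0 < W)
    (F ξ v : Z → ℕ → ℝ) (hFlim : ∀ z, Filter.Tendsto (fun n => F z n) Filter.atTop (nhds 0))
    (hξ : ∀ z n, 0 ≤ ξ z n ∧ ξ z n ≤ 1) (hv0 : ∀ z n, 0 ≤ v z n) (hvM : ∀ z n, v z n ≤ M)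
    (hB : ∀ z, ∀ n : ℕ, 1 ≤ n →
      ((n : ℝ) * lam + κ + ∑ y ∈ Finset.univ.filter (fun y => y ≠ z), μ z y) * v z n
        = lam * (F z n + γ * max (v z n) W) + κ * v z (n + 1)
          + (∑ w ∈ Finset.univ.filter (fun w => w ≠ z), μ z w * v w n)
          + ((n : ℝ) - 1) * lam * (1 - γ * ξ z n) * v z (n - 1)
          + ((n : ℝ) - 1) * lam * γ * ξ z n * v z n) :
    ∃ N₀ : ℕ, ∀ n, N₀ ≤ n → ∀ z, v z n < W := by
  have hmax : ∀ n, ∃ z, ∀ w, v w n ≤ v z n := fun n => by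
    obtain ⟨z, -, hz⟩ := Finset.exists_max_image Finset.univ (fun z => v z n) Finset.univ_nonempty
    exact ⟨z, fun w => hz w (Finset.mem_univ w)⟩
  choose zz hzz using hmax
  set δ := (1 - γ) * W / 2 with hδ
  have hδ0 : 0 < δ := by have : 0 < 1 - γ := by linarith
                         positivity
  have hFe : ∀ᶠ n in Filter.atTop, ∀ z, F z n < δ := by
    rw [Filter.eventually_all]
    intro z
    exact (hFlim z).eventually (gt_mem_nhds hδ0)
  obtain ⟨N, hN⟩ := Filter.eventually_atTop.1 hFe
  have hγξ : ∀ z n, 0 ≤ 1 - γ * ξ z n ∧ 1 - γ * ξ z n ≤ 1 := fun z n => by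
    have h1 := hξ z n
    constructor
    · nlinarith
    · nlinarith [mul_nonneg hγ0.le h1.1]
  obtain ⟨N₀, hN₀⟩ := seq_lemma (fun n => v (zz n) n)
    (fun n => ((n : ℝ) - 1) * lam * (1 - γ * ξ (zz n) n)) κ lam δ W M hκ hlam hδ0
    (fun n => hv0 _ _) (fun n => hvM _ _) (max N 1) (le_max_right _ _)
    (by
      intro n hn
      have : (1 : ℝ) ≤ n := by exact_mod_cast hn
      have := (hγξ (zz n) n).1
      have h3 : (0 : ℝ) ≤ (n : ℝ) - 1 := by linarith
      positivity)
    (by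
      intro n hn
      have : (1 : ℝ) ≤ n := by exact_mod_cast hn
      have h1 := (hγξ (zz n) n)
      have h3 : (0 : ℝ) ≤ ((n : ℝ) - 1) * lam := mul_nonneg (by linarith) hlam.le
      nlinarith)
    (by
      intro n hn hWn
      have hn1 : 1 ≤ n := le_trans (le_max_right _ _) hn
      have hnr : (1 : ℝ) ≤ n := by exact_mod_cast hn1
      have hF := hN n (le_trans (le_max_left _ _) hn) (zz n)
      have h := hB (zz n) n hn1
      rw [max_eq_left hWn] at h
      set z := zz n
      have e1 : κ * v z (n + 1) ≤ κ * v (zz (n + 1)) (n + 1) :=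
        mul_le_mul_of_nonneg_left (hzz (n + 1) z) hκ.le
      have e2 : (∑ w ∈ Finset.univ.filter (fun w => w ≠ z), μ z w * v w n) ≤
          (∑ y ∈ Finset.univ.filter (fun y => y ≠ z), μ z y) * v z n := by
        rw [Finset.sum_mul]
        apply Finset.sum_le_sum
        intro w hw
        exact mul_le_mul_of_nonneg_left (hzz n w)
          (hμ z w (Ne.symm (Finset.mem_filter.1 hw).2)).le
      have hg := (hγξ z n).1
      have e3 : ((n : ℝ) - 1) * lam * (1 - γ * ξ z n) * v z (n - 1) ≤
          ((n : ℝ) - 1) * lam * (1 - γ * ξ z n) * v (zz (n - 1)) (n - 1) :=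
        mul_le_mul_of_nonneg_left (hzz (n - 1) z)
          (mul_nonneg (mul_nonneg (by linarith) hlam.le) hg)
      have e4 : lam * F z n ≤ lam * δ := mul_le_mul_of_nonneg_left hF.le hlam.le
      have e5 : lam * ((1 - γ) * W) ≤ lam * ((1 - γ) * v z n) :=
        mul_le_mul_of_nonneg_left (mul_le_mul_of_nonneg_left hWn (by linarith)) hlam.le
      have e6 : lam * ((1 - γ) * W) = 2 * (lam * δ) := by rw [hδ]; ring
      linarith)
  exact ⟨N₀, fun n hn z => lt_of_le_of_lt (hzz n z) (hN₀ n hn)⟩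


lemma prod_sum [Fintype Z] (g : Z → ℕ → ℝ) (h0 : ∀ z n, 0 ≤ g z n)
    (hs : Summable fun n => ∑ z, g z n) :
    Summable (fun q : Z × ℕ => g q.1 q.2) ∧ ∑' q : Z × ℕ, g q.1 q.2 = ∑' n, ∑ z, g z n := by
  have h1 : Summable (fun q : ℕ × Z => g q.2 q.1) := by
    rw [summable_prod_of_nonneg (fun q => h0 _ _)]
    refine ⟨fun n => (hasSum_fintype _).summable, ?_⟩
    simpa [tsum_fintype] using hs
  have h2 : Summable (fun q : Z × ℕ => g q.1 q.2) := by
    rw [← (Equiv.prodComm ℕ Z).summable_iff]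
    exact h1
  refine ⟨h2, ?_⟩
  rw [← (Equiv.prodComm ℕ Z).tsum_eq]
  have := h1.tsum_prod
  simp only [tsum_fintype] at this
  exact this

/-- average departure factor -/
noncomputable def DD [Fintype Z] (γ : ℝ) (ξ p : Z → ℕ → ℝ) (n : ℕ) : ℝ :=
  1 - γ * ∑ z, p z n * ξ z n

/-- unnormalised marginal weights -/
noncomputable def mm [Fintype Z] (lam γ κ : ℝ) (ξ p : Z → ℕ → ℝ) : ℕ → ℝ
  | 0 => 1
  | n + 1 => mm lam γ κ ξ p n * (κ / (lam * ((n : ℝ) + 1) * DD γ ξ p (n + 1)))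

lemma DD_bounds [Fintype Z] {γ : ℝ} (hγ0 : 0 < γ) {ξ p : Z → ℕ → ℝ}
    (hξ : ∀ z n, 0 ≤ ξ z n ∧ ξ z n ≤ 1) (hp0 : ∀ z n, 0 ≤ p z n) (hp1 : ∀ n, ∑ z, p z n = 1)
    (n : ℕ) : 1 - γ ≤ DD γ ξ p n ∧ DD γ ξ p n ≤ 1 := by
  have h1 : 0 ≤ ∑ z, p z n * ξ z n :=
    Finset.sum_nonneg fun z _ => mul_nonneg (hp0 z n) (hξ z n).1
  have h2 : ∑ z, p z n * ξ z n ≤ 1 := by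
    rw [← hp1 n]
    exact Finset.sum_le_sum fun z _ => mul_le_of_le_one_right (hp0 z n) (hξ z n).2
  unfold DD
  constructor
  · nlinarith
  · nlinarith [mul_nonneg hγ0.le h1]

lemma mm_pos [Fintype Z] {lam γ κ : ℝ} (hlam : 0 < lam) (hκ : 0 < κ) {ξ p : Z → ℕ → ℝ}
    (hD : ∀ n, 0 < DD γ ξ p n) (n : ℕ) : 0 < mm lam γ κ ξ p n := by
  induction n with
  | zero => exact one_pos
  | succ n ih =>
    have := hD (n + 1)
    unfold mm; positivity

lemma mm_le [Fintype Z] {lam γ κ K : ℝ} (hlam : 0 < lam) (hκ : 0 < κ) (hK : κ ≤ K)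
    (hγ1 : γ < 1) {ξ p : Z → ℕ → ℝ}
    (hD : ∀ n, 1 - γ ≤ DD γ ξ p n) (n : ℕ) :
    mm lam γ κ ξ p n ≤ (K / (lam * (1 - γ))) ^ n / (n.factorial : ℝ) := by
  have hg : 0 < 1 - γ := by linarith
  induction n with
  | zero => simp [mm]
  | succ n ih =>
    have hDn := hD (n + 1)
    have hpos := mm_pos hlam hκ (fun n => lt_of_lt_of_le hg (hD n)) n
    have hK0 : 0 < K := lt_of_lt_of_le hκ hK
    have : κ / (lam * ((n : ℝ) + 1) * DD γ ξ p (n + 1)) ≤ K / (lam * ((n : ℝ) + 1) * (1 - γ)) := by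
      gcongr
    have h2 : mm lam γ κ ξ p (n + 1) =
      mm lam γ κ ξ p n * (κ / (lam * ((n : ℝ) + 1) * DD γ ξ p (n + 1))) := rfl
    rw [h2]
    have hD0 : 0 < DD γ ξ p (n + 1) := lt_of_lt_of_le hg hDn
    calc _ ≤ ((K / (lam * (1 - γ))) ^ n / (n.factorial : ℝ)) * (K / (lam * ((n : ℝ) + 1) * (1 - γ))) := by
          gcongr
      _ = _ := by
          rw [Nat.factorial_succ, pow_succ]
          push_cast
          field_simp

lemma bound_summable (A : ℝ) : Summable (fun n : ℕ => A ^ n / (n.factorial : ℝ)) ∧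
    Summable (fun n : ℕ => (n : ℝ) * (A ^ n / (n.factorial : ℝ))) := by
  have h1 := Real.summable_pow_div_factorial A
  refine ⟨h1, ?_⟩
  rw [← summable_nat_add_iff 1]
  refine (h1.mul_left A).congr fun n => ?_
  rw [Nat.factorial_succ, pow_succ]
  push_cast
  have : (n.factorial : ℝ) ≠ 0 := by positivity
  field_simp

lemma mm_summable [Fintype Z] {lam γ κ : ℝ} (hlam : 0 < lam) (hκ : 0 < κ)
    (hγ1 : γ < 1) {ξ p : Z → ℕ → ℝ} (hD : ∀ n, 1 - γ ≤ DD γ ξ p n) :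
    Summable (mm lam γ κ ξ p) ∧ Summable (fun n : ℕ => (n : ℝ) * mm lam γ κ ξ p n) := by
  have hg : 0 < 1 - γ := by linarith
  have hpos := mm_pos hlam hκ (fun n => lt_of_lt_of_le hg (hD n))
  have hle := mm_le hlam hκ le_rfl hγ1 hD
  have hb := bound_summable (κ / (lam * (1 - γ)))
  refine ⟨Summable.of_nonneg_of_le (fun n => (hpos n).le) hle hb.1,
    Summable.of_nonneg_of_le (fun n => mul_nonneg (Nat.cast_nonneg n) (hpos n).le)
      (fun n => mul_le_mul_of_nonneg_left (hle n) (Nat.cast_nonneg n)) hb.2⟩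

lemma mm_succ [Fintype Z] {lam γ κ : ℝ} (hlam : 0 < lam) {ξ p : Z → ℕ → ℝ}
    (hD : ∀ n, 0 < DD γ ξ p n) (n : ℕ) :
    lam * ((n : ℝ) + 1) * DD γ ξ p (n + 1) * mm lam γ κ ξ p (n + 1) = κ * mm lam γ κ ξ p n := by
  have := hD (n + 1)
  have h2 : mm lam γ κ ξ p (n + 1) =
      mm lam γ κ ξ p n * (κ / (lam * ((n : ℝ) + 1) * DD γ ξ p (n + 1))) := rfl
  rw [h2]; field_simp

lemma mm_flow [Fintype Z] {lam γ κ : ℝ} (hlam : 0 < lam) (hκ : 0 < κ)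
    (hγ1 : γ < 1) {ξ p : Z → ℕ → ℝ} (hD : ∀ n, 1 - γ ≤ DD γ ξ p n) (hD1 : ∀ n, DD γ ξ p n ≤ 1) :
    lam * (1 - γ) * ∑' n : ℕ, (n : ℝ) * mm lam γ κ ξ p n ≤ κ * ∑' n, mm lam γ κ ξ p n ∧
    κ * ∑' n, mm lam γ κ ξ p n ≤ lam * ∑' n : ℕ, (n : ℝ) * mm lam γ κ ξ p n := by
  have hg : 0 < 1 - γ := by linarith
  have hD0 : ∀ n, 0 < DD γ ξ p n := fun n => lt_of_lt_of_le hg (hD n)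
  have hpos := mm_pos hlam hκ hD0
  obtain ⟨hs1, hs2⟩ := mm_summable hlam hκ hγ1 hD
  have hshift : ∑' n : ℕ, (n : ℝ) * mm lam γ κ ξ p n =
      ∑' n : ℕ, ((n : ℝ) + 1) * mm lam γ κ ξ p (n + 1) := by
    rw [hs2.tsum_eq_zero_add]; simp
  have hs3 : Summable (fun n : ℕ => ((n : ℝ) + 1) * mm lam γ κ ξ p (n + 1)) := by
    have := (summable_nat_add_iff 1).2 hs2
    simpa using this
  rw [hshift, ← tsum_mul_left, ← tsum_mul_left, ← tsum_mul_left]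
  constructor
  · apply Summable.tsum_le_tsum _ (hs3.mul_left _) (hs1.mul_left _)
    intro n
    rw [← mm_succ hlam hD0 n]
    have h1 := hD (n + 1)
    have h2 : 0 ≤ lam * (((n : ℝ) + 1) * mm lam γ κ ξ p (n + 1)) := by
      have := hpos (n + 1); positivity
    nlinarith
  · apply Summable.tsum_le_tsum _ (hs1.mul_left _) (hs3.mul_left _)
    intro n
    rw [← mm_succ hlam hD0 n]
    have h1 := hD1 (n + 1)
    have h2 : 0 ≤ lam * (((n : ℝ) + 1) * mm lam γ κ ξ p (n + 1)) := by
      have := hpos (n + 1); positivity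
    nlinarith

lemma stationary [Fintype Z] [DecidableEq Z] (μ : Z → Z → ℝ)
    {lam γ κ : ℝ} (hlam : 0 < lam) (hκ : 0 < κ)
    (hγ0 : 0 < γ) (hγ1 : γ < 1) {ξ p : Z → ℕ → ℝ}
    (hξ : ∀ z n, 0 ≤ ξ z n ∧ ξ z n ≤ 1) (hp0 : ∀ z n, 0 ≤ p z n) (hp1 : ∀ n, ∑ z, p z n = 1)
    (hpe : ∀ z, ∀ n : ℕ, p z n * ((∑ y ∈ Finset.univ.filter (fun y => y ≠ z), μ z y) + κ
        + lam * n * (1 - γ * ξ z n)) =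
      (∑ w ∈ Finset.univ.filter (fun w => w ≠ z), p w n * μ w z)
        + lam * n * DD γ ξ p n * p z (n - 1)
        + κ / DD γ ξ p (n + 1) * (1 - γ * ξ z (n + 1)) * p z (n + 1)) :
    IsProbSolution μ lam γ κ ξ
      (fun z n => mm lam γ κ ξ p n / (∑' k, mm lam γ κ ξ p k) * p z n) ∧
    (∑' q : Z × ℕ, (q.2 : ℝ) * (mm lam γ κ ξ p q.2 / (∑' k, mm lam γ κ ξ p k) * p q.1 q.2)) =
      (∑' n : ℕ, (n : ℝ) * mm lam γ κ ξ p n) / (∑' k, mm lam γ κ ξ p k) := by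
  have hg : 0 < 1 - γ := by linarith
  have hDb := DD_bounds hγ0 hξ hp0 hp1
  have hD0 : ∀ n, 0 < DD γ ξ p n := fun n => lt_of_lt_of_le hg (hDb n).1
  have hpos := mm_pos (κ := κ) hlam hκ hD0
  obtain ⟨hs1, hs2⟩ := mm_summable hlam hκ hγ1 (fun n => (hDb n).1)
  have hS : 0 < ∑' k, mm lam γ κ ξ p k := hs1.tsum_pos (fun n => (hpos n).le) 0 (hpos 0)
  have hsucc := mm_succ (κ := κ) hlam hD0
  set S := ∑' k, mm lam γ κ ξ p k with hSdef
  set m := mm lam γ κ ξ p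
  have hπ0 : ∀ z n, 0 ≤ m n / S * p z n := fun z n =>
    mul_nonneg (div_nonneg (hpos n).le hS.le) (hp0 z n)
  have hsumz : ∀ n, ∑ z, m n / S * p z n = m n / S := fun n => by
    rw [← Finset.mul_sum, hp1, mul_one]
  have hp := prod_sum (fun z n => m n / S * p z n) hπ0 (by
    simp only [hsumz]; exact hs1.div_const S)
  refine ⟨⟨hπ0, hp.1, ?_, ?_⟩, ?_⟩
  · refine hp.2.trans ?_
    simp only [hsumz]
    rw [tsum_div_const, ← hSdef, div_self hS.ne']
  · intro x n
    have h1 := hpe x n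
    have hA : (∑ z ∈ Finset.univ.filter (fun z => z ≠ x), m n / S * p z n * μ z x) =
        m n / S * (∑ z ∈ Finset.univ.filter (fun z => z ≠ x), p z n * μ z x) := by
      rw [Finset.mul_sum]
      exact Finset.sum_congr rfl fun _ _ => by ring
    have hBB : κ * (if 1 ≤ n then m (n - 1) / S * p x (n - 1) else 0) =
        m n / S * (lam * n * DD γ ξ p n * p x (n - 1)) := by
      rcases n with _ | n
      · simp
      · rw [if_pos (by omega), Nat.add_sub_cancel]
        have := hsucc n
        push_cast
        calc κ * (m n / S * p x n) = (κ * m n) * (p x n / S) := by ring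
          _ = _ := by rw [← this]; ring
    have hCC : lam * ((n : ℝ) + 1) * (1 - γ * ξ x (n + 1)) * (m (n + 1) / S * p x (n + 1)) =
        m n / S * (κ / DD γ ξ p (n + 1) * (1 - γ * ξ x (n + 1)) * p x (n + 1)) := by
      have := hsucc n
      have hD := hD0 (n + 1)
      have h3 : lam * ((n : ℝ) + 1) * m (n + 1) = κ * m n / DD γ ξ p (n + 1) := by
        rw [eq_div_iff hD.ne', ← this]; ring
      calc _ = (lam * ((n : ℝ) + 1) * m (n + 1)) * ((1 - γ * ξ x (n + 1)) * p x (n + 1) / S) := by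
            ring
        _ = _ := by rw [h3]; ring
    simp only
    rw [hA, hBB, hCC, mul_assoc, h1]; ring
  · have h3 : ∀ n : ℕ, ∑ z, (n : ℝ) * (m n / S * p z n) = (n : ℝ) * m n / S := fun n => by
      rw [← Finset.mul_sum, hsumz]; ring
    have := prod_sum (fun z n => (n : ℝ) * (m n / S * p z n))
      (fun z n => mul_nonneg (Nat.cast_nonneg n) (hπ0 z n)) (by
        simp only [h3]; exact hs2.div_const S)
    refine this.2.trans ?_
    simp only [h3]
    rw [tsum_div_const]


/-- index type of all unknowns -/
inductive Idx (Z : Type) : Type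
  | xi (z : Z) (n : ℕ) : Idx Z
  | q (z : Z) (n : ℕ) : Idx Z
  | v (z : Z) (n : ℕ) : Idx Z
  | kap : Idx Z
  | sw : Idx Z

/-- retraction of the cube onto the product of simplices -/
noncomputable def nrm [Fintype Z] (q : Z → ℕ → ℝ) (z : Z) (n : ℕ) : ℝ :=
  (q z n + max 0 (1 - ∑ w, q w n) / (Fintype.card Z : ℝ)) / max 1 (∑ w, q w n)

lemma nrm_nonneg [Fintype Z] {q : Z → ℕ → ℝ} (hq : ∀ z n, 0 ≤ q z n) (z : Z) (n : ℕ) :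
    0 ≤ nrm q z n := by
  have := hq z n
  unfold nrm
  positivity

lemma nrm_sum [Fintype Z] [Nonempty Z] (q : Z → ℕ → ℝ) (n : ℕ) : ∑ z, nrm q z n = 1 := by
  unfold nrm
  have hc : (Fintype.card Z : ℝ) ≠ 0 := by exact_mod_cast Fintype.card_ne_zero
  rw [← Finset.sum_div, Finset.sum_add_distrib, Finset.sum_const, Finset.card_univ, nsmul_eq_mul,
    mul_div_cancel₀ _ hc]
  rcases le_total (∑ w, q w n) 1 with h | h
  · rw [max_eq_left h, max_eq_right (by linarith)]; ring
  · rw [max_eq_right h, max_eq_left (by linarith), add_zero, div_self (by linarith)]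

lemma nrm_eq [Fintype Z] {q : Z → ℕ → ℝ} (h : ∀ n, ∑ w, q w n = 1) : nrm q = q := by
  funext z n
  unfold nrm
  rw [h]; simp

/-- inflow minus outflow for the conditional distributions -/
noncomputable def bal [Fintype Z] [DecidableEq Z] (μ : Z → Z → ℝ) (lam γ κ : ℝ)
    (ξ p : Z → ℕ → ℝ) (z : Z) (n : ℕ) : ℝ :=
  ((∑ w ∈ Finset.univ.filter (fun w => w ≠ z), p w n * μ w z)
        + lam * n * DD γ ξ p n * p z (n - 1)
        + κ / DD γ ξ p (n + 1) * (1 - γ * ξ z (n + 1)) * p z (n + 1)) -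
  p z n * ((∑ y ∈ Finset.univ.filter (fun y => y ≠ z), μ z y) + κ
        + lam * n * (1 - γ * ξ z n))

/-- right-hand side of the Bellman equation -/
noncomputable def bell [Fintype Z] [DecidableEq Z] (μ : Z → Z → ℝ) (lam γ κ W : ℝ)
    (F ξ v : Z → ℕ → ℝ) (z : Z) (n : ℕ) : ℝ :=
  lam * (F z n + γ * max (v z n) W) + κ * v z (n + 1)
          + (∑ w ∈ Finset.univ.filter (fun w => w ≠ z), μ z w * v w n)
          + ((n : ℝ) - 1) * lam * (1 - γ * ξ z n) * v z (n - 1)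
          + ((n : ℝ) - 1) * lam * γ * ξ z n * v z n

lemma bal_sum [Fintype Z] [DecidableEq Z] (μ : Z → Z → ℝ) (lam γ κ : ℝ)
    {ξ p : Z → ℕ → ℝ} (hp1 : ∀ n, ∑ z, p z n = 1) (hD : ∀ n, DD γ ξ p n ≠ 0) (n : ℕ) :
    ∑ z, bal μ lam γ κ ξ p z n = 0 := by
  have hDs : ∀ n, ∑ z, (1 - γ * ξ z n) * p z n = DD γ ξ p n := by
    intro n
    unfold DD
    have h : ∀ z, (1 - γ * ξ z n) * p z n = p z n - γ * (p z n * ξ z n) := fun z => by ring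
    simp only [h]
    rw [Finset.sum_sub_distrib, hp1, ← Finset.mul_sum]
  have h1 : ∑ z, (∑ w ∈ Finset.univ.filter (fun w => w ≠ z), p w n * μ w z) =
      ∑ z, p z n * (∑ y ∈ Finset.univ.filter (fun y => y ≠ z), μ z y) := by
    simp only [Finset.sum_filter, Finset.mul_sum]
    rw [Finset.sum_comm]
    refine Finset.sum_congr rfl fun z _ => Finset.sum_congr rfl fun w _ => ?_
    by_cases h : z = w
    · simp [h]
    · rw [if_pos h, if_pos (Ne.symm h)]
  have h2 : ∑ z, lam * n * DD γ ξ p n * p z (n - 1) = lam * n * DD γ ξ p n := by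
    rw [← Finset.mul_sum, hp1, mul_one]
  have h3 : ∑ z, κ / DD γ ξ p (n + 1) * (1 - γ * ξ z (n + 1)) * p z (n + 1) = κ := by
    simp only [mul_assoc]
    rw [← Finset.mul_sum, hDs, div_mul_cancel₀ _ (hD _)]
  have h4 : ∑ z, p z n * ((∑ y ∈ Finset.univ.filter (fun y => y ≠ z), μ z y) + κ
        + lam * n * (1 - γ * ξ z n)) =
      ∑ z, p z n * (∑ y ∈ Finset.univ.filter (fun y => y ≠ z), μ z y) + κ
        + lam * n * DD γ ξ p n := by
    have hk : κ = ∑ z, κ * p z n := by rw [← Finset.mul_sum, hp1, mul_one]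
    have h : ∀ z, p z n * ((∑ y ∈ Finset.univ.filter (fun y => y ≠ z), μ z y) + κ
        + lam * n * (1 - γ * ξ z n)) =
        p z n * (∑ y ∈ Finset.univ.filter (fun y => y ≠ z), μ z y) + κ * p z n
        + lam * n * ((1 - γ * ξ z n) * p z n) := fun z => by ring
    simp only [h]
    rw [Finset.sum_add_distrib, Finset.sum_add_distrib, ← hk, ← Finset.mul_sum, hDs n]
  unfold bal
  rw [Finset.sum_sub_distrib, Finset.sum_add_distrib, Finset.sum_add_distrib, h1, h2, h3, h4]
  ring

set_option maxHeartbeats 2000000 in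
lemma fixed_point [Fintype Z] [DecidableEq Z] [Nonempty Z]
    (μ : Z → Z → ℝ) (hμ : ∀ z y : Z, z ≠ y → 0 < μ z y)
    (lam γ β M : ℝ) (hlam : 0 < lam) (hγ0 : 0 < γ) (hγ1 : γ < 1) (hβ : 0 < β)
    (F : Z → ℕ → ℝ) (hF0 : ∀ z n, 0 ≤ F z n) (hM : 0 ≤ M) (hFM : ∀ z n, F z n + γ * M ≤ M) :
    ∃ (ξ p v : Z → ℕ → ℝ) (κ W : ℝ),
      (∀ z n, 0 ≤ ξ z n ∧ ξ z n ≤ 1) ∧ (∀ z n, 0 ≤ p z n) ∧ (∀ n, ∑ z, p z n = 1) ∧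
      (∀ z n, 0 ≤ v z n ∧ v z n ≤ M) ∧
      (β * lam * (1 - γ) ≤ κ ∧ κ ≤ β * lam) ∧ 0 ≤ W ∧
      (∀ z n, ξ z n = max 0 (min 1 (ξ z n + (v z n - W)))) ∧
      (∀ z n, bal μ lam γ κ ξ p z n = 0) ∧
      (∀ z, ∀ n : ℕ, 1 ≤ n →
        ((n : ℝ) * lam + κ + ∑ y ∈ Finset.univ.filter (fun y => y ≠ z), μ z y) * v z n =
          bell μ lam γ κ W F ξ v z n) ∧
      κ = max (β * lam * (1 - γ)) (min (β * lam) (κ + (β -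
        (∑' n : ℕ, (n : ℝ) * mm lam γ κ ξ p n) / (∑' k, mm lam γ κ ξ p k)))) ∧
      W = ∑' n, ∑ z, mm lam γ κ ξ p n / (∑' k, mm lam γ κ ξ p k) * p z n * v z (n + 1) := by
  have hg : 0 < 1 - γ := by linarith
  set lo := β * lam * (1 - γ) with hlo
  set hi := β * lam with hhi
  have hlo0 : 0 < lo := by positivity
  have hlohi : lo ≤ hi := by rw [hlo, hhi]; nlinarith [mul_pos hβ hlam]
  let out : Z → ℝ := fun z => ∑ y ∈ Finset.univ.filter (fun y => y ≠ z), μ z y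
  have hout : ∀ z, 0 ≤ out z := fun z => Finset.sum_nonneg fun y hy =>
    (hμ z y (Ne.symm (Finset.mem_filter.1 hy).2)).le
  let ε : ℕ → ℝ := fun n => 1 / ((∑ z, out z) + hi + lam * n)
  have hεd : ∀ n : ℕ, 0 < (∑ z, out z) + hi + lam * n := fun n => by
    have := Finset.sum_nonneg fun z (_ : z ∈ Finset.univ) => hout z
    have : 0 < hi := lt_of_lt_of_le hlo0 hlohi
    positivity
  have hε : ∀ n, 0 < ε n := fun n => one_div_pos.2 (hεd n)
  -- coordinates
  let X : (Idx Z → ℝ) → Z → ℕ → ℝ := fun x z n => x (Idx.xi z n)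
  let P : (Idx Z → ℝ) → Z → ℕ → ℝ := fun x => nrm (fun z n => x (Idx.q z n))
  let Y : (Idx Z → ℝ) → Z → ℕ → ℝ := fun x z n => x (Idx.v z n)
  let m : (Idx Z → ℝ) → ℕ → ℝ := fun x => mm lam γ (x Idx.kap) (X x) (P x)
  let f : (Idx Z → ℝ) → (Idx Z → ℝ) := fun x i => match i with
    | Idx.xi z n => max 0 (min 1 (X x z n + (Y x z n - x Idx.sw)))
    | Idx.q z n => P x z n + ε n * bal μ lam γ (x Idx.kap) (X x) (P x) z n
    | Idx.v z n => if n = 0 then 0 else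
        bell μ lam γ (x Idx.kap) (x Idx.sw) F (X x) (Y x) z n / ((n : ℝ) * lam + x Idx.kap + out z)
    | Idx.kap => max lo (min hi (x Idx.kap + (β - (∑' n : ℕ, (n : ℝ) * m x n) / (∑' k, m x k))))
    | Idx.sw => ∑' n, ∑ z, m x n / (∑' k, m x k) * P x z n * Y x z (n + 1)
  let a : Idx Z → ℝ := fun i => match i with
    | Idx.kap => lo
    | _ => 0
  let b : Idx Z → ℝ := fun i => match i with
    | Idx.kap => hi
    | Idx.xi _ _ => 1
    | Idx.q _ _ => 1
    | Idx.v _ _ => M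
    | Idx.sw => M
  set Q := Set.pi Set.univ (fun i => Set.Icc (a i) (b i)) with hQ
  -- facts on Q
  have hX : ∀ x ∈ Q, ∀ z n, 0 ≤ X x z n ∧ X x z n ≤ 1 := fun x hx z n => hx (Idx.xi z n) trivial
  have hY : ∀ x ∈ Q, ∀ z n, 0 ≤ Y x z n ∧ Y x z n ≤ M := fun x hx z n => hx (Idx.v z n) trivial
  have hK : ∀ x ∈ Q, lo ≤ x Idx.kap ∧ x Idx.kap ≤ hi := fun x hx => hx Idx.kap trivial
  have hW : ∀ x ∈ Q, 0 ≤ x Idx.sw ∧ x Idx.sw ≤ M := fun x hx => hx Idx.sw trivial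
  have hP0 : ∀ x ∈ Q, ∀ z n, 0 ≤ P x z n := fun x hx z n =>
    nrm_nonneg (fun z n => (hx (Idx.q z n) trivial).1) z n
  have hP1 : ∀ x n, ∑ z, P x z n = 1 := fun x n => nrm_sum _ n
  have hDD : ∀ x ∈ Q, ∀ n, 1 - γ ≤ DD γ (X x) (P x) n ∧ DD γ (X x) (P x) n ≤ 1 := fun x hx =>
    DD_bounds hγ0 (hX x hx) (hP0 x hx) (hP1 x)
  have hDD0 : ∀ x ∈ Q, ∀ n, 0 < DD γ (X x) (P x) n := fun x hx n =>
    lt_of_lt_of_le hg (hDD x hx n).1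
  have hK0 : ∀ x ∈ Q, 0 < x Idx.kap := fun x hx => lt_of_lt_of_le hlo0 (hK x hx).1
  have hm0 : ∀ x ∈ Q, ∀ n, 0 < m x n := fun x hx n => mm_pos hlam (hK0 x hx) (hDD0 x hx) n
  have hms : ∀ x ∈ Q, Summable (m x) ∧ Summable (fun n : ℕ => (n : ℝ) * m x n) := fun x hx =>
    mm_summable hlam (hK0 x hx) hγ1 (fun n => (hDD x hx n).1)
  have hmb : ∀ x ∈ Q, ∀ n, m x n ≤ (hi / (lam * (1 - γ))) ^ n / (n.factorial : ℝ) := fun x hx n =>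
    mm_le hlam (hK0 x hx) (hK x hx).2 hγ1 (fun n => (hDD x hx n).1) n
  have hS0 : ∀ x ∈ Q, 0 < ∑' k, m x k := fun x hx =>
    (hms x hx).1.tsum_pos (fun n => (hm0 x hx n).le) 0 (hm0 x hx 0)
  have hγX : ∀ x ∈ Q, ∀ z n, 0 ≤ 1 - γ * X x z n ∧ 1 - γ * X x z n ≤ 1 := fun x hx z n => by
    have h1 := hX x hx z n
    constructor
    · nlinarith
    · nlinarith [mul_nonneg hγ0.le h1.1]
  have hbalsum : ∀ x ∈ Q, ∀ n, ∑ z, f x (Idx.q z n) = 1 := by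
    intro x hx n
    change ∑ z, (P x z n + ε n * bal μ lam γ (x Idx.kap) (X x) (P x) z n) = 1
    rw [Finset.sum_add_distrib, ← Finset.mul_sum,
      bal_sum μ lam γ _ (hP1 x) (fun n => (hDD0 x hx n).ne'), hP1]
    ring
  have hq0 : ∀ x ∈ Q, ∀ z n, 0 ≤ f x (Idx.q z n) := by
    intro x hx z n
    change 0 ≤ P x z n + ε n * bal μ lam γ (x Idx.kap) (X x) (P x) z n
    have hA : 0 ≤ (∑ w ∈ Finset.univ.filter (fun w => w ≠ z), P x w n * μ w z) :=
      Finset.sum_nonneg fun w hw => mul_nonneg (hP0 x hx w n)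
        (hμ w z (Finset.mem_filter.1 hw).2).le
    have hB : 0 ≤ lam * n * DD γ (X x) (P x) n * P x z (n - 1) :=
      mul_nonneg (mul_nonneg (by positivity) (hDD0 x hx n).le) (hP0 x hx _ _)
    have hC : 0 ≤ x Idx.kap / DD γ (X x) (P x) (n + 1) * (1 - γ * X x z (n + 1)) * P x z (n + 1) :=
      mul_nonneg (mul_nonneg (div_nonneg (hK0 x hx).le (hDD0 x hx _).le) (hγX x hx _ _).1)
        (hP0 x hx _ _)
    have hL : out z + x Idx.kap + lam * n * (1 - γ * X x z n) ≤ (∑ z, out z) + hi + lam * n := by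
      have h1 : out z ≤ ∑ z, out z :=
        Finset.single_le_sum (fun z _ => hout z) (Finset.mem_univ z)
      have h2 := (hK x hx).2
      have h3 : lam * n * (1 - γ * X x z n) ≤ lam * n :=
        mul_le_of_le_one_right (by positivity) (hγX x hx z n).2
      linarith
    have hL2 : ε n * (out z + x Idx.kap + lam * n * (1 - γ * X x z n)) ≤ 1 := by
      change 1 / _ * _ ≤ 1
      rw [one_div, inv_mul_le_iff₀ (hεd n), mul_one]
      exact hL
    have h5 := mul_le_mul_of_nonneg_left hL2 (hP0 x hx z n)
    have h6 := mul_nonneg (hε n).le (add_nonneg (add_nonneg hA hB) hC)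
    unfold bal
    change _ ≤ P x z n + ε n * (_ - P x z n * (out z + _ + _))
    nlinarith
  have hWs : ∀ x ∈ Q, (∀ n, 0 ≤ ∑ z, m x n / (∑' k, m x k) * P x z n * Y x z (n + 1)) ∧
      (∀ n, ∑ z, m x n / (∑' k, m x k) * P x z n * Y x z (n + 1) ≤ m x n / (∑' k, m x k) * M) := by
    intro x hx
    have h1 : ∀ n, 0 ≤ m x n / (∑' k, m x k) := fun n => div_nonneg (hm0 x hx n).le (hS0 x hx).le
    refine ⟨fun n => Finset.sum_nonneg fun z _ =>
      mul_nonneg (mul_nonneg (h1 n) (hP0 x hx z n)) (hY x hx _ _).1, fun n => ?_⟩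
    calc _ ≤ ∑ z, m x n / (∑' k, m x k) * P x z n * M := Finset.sum_le_sum fun z _ =>
          mul_le_mul_of_nonneg_left (hY x hx _ _).2 (mul_nonneg (h1 n) (hP0 x hx z n))
      _ = _ := by rw [← Finset.sum_mul, ← Finset.mul_sum, hP1, mul_one]
  have hmaps : ∀ x ∈ Q, f x ∈ Q := by
    intro x hx i _
    rcases i with ⟨z, n⟩ | ⟨z, n⟩ | ⟨z, n⟩ | _ | _
    · exact ⟨le_max_left _ _, max_le zero_le_one (min_le_left _ _)⟩
    · refine ⟨hq0 x hx z n, ?_⟩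
      change f x (Idx.q z n) ≤ 1
      rw [← hbalsum x hx n]
      exact Finset.single_le_sum (f := fun z => f x (Idx.q z n)) (fun z _ => hq0 x hx z n)
        (Finset.mem_univ z)
    · change (if n = 0 then 0 else _ : ℝ) ∈ Set.Icc 0 M
      split_ifs with hn
      · exact ⟨le_rfl, hM⟩
      · have hn1 : (1 : ℝ) ≤ n := by exact_mod_cast Nat.one_le_iff_ne_zero.2 hn
        have hn2 : (0 : ℝ) ≤ (n : ℝ) - 1 := by linarith
        have hk := hK0 x hx
        have ho := hout z
        have hden : 0 < (n : ℝ) * lam + x Idx.kap + out z := by positivity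
        have hg1 := (hγX x hx z n).1
        have hX1 := (hX x hx z n).1
        have hmx0 : 0 ≤ max (Y x z n) (x Idx.sw) := le_max_of_le_left (hY x hx z n).1
        have hmx1 : max (Y x z n) (x Idx.sw) ≤ M := max_le (hY x hx z n).2 (hW x hx).2
        have hc1 : 0 ≤ ((n : ℝ) - 1) * lam * (1 - γ * X x z n) := by positivity
        have hc2 : 0 ≤ ((n : ℝ) - 1) * lam * γ * X x z n := by positivity
        constructor
        · apply div_nonneg _ hden.le
          unfold bell
          have h1 := hF0 z n
          have h2 := (hY x hx z (n + 1)).1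
          have h3 := (hY x hx z (n - 1)).1
          have h4 := (hY x hx z n).1
          have h5 : 0 ≤ (∑ w ∈ Finset.univ.filter (fun w => w ≠ z), μ z w * Y x w n) :=
            Finset.sum_nonneg fun w hw => mul_nonneg
              (hμ z w (Ne.symm (Finset.mem_filter.1 hw).2)).le (hY x hx w n).1
          have h6 := mul_nonneg hc1 h3
          have h7 := mul_nonneg hc2 h4
          have h8 : 0 ≤ lam * (F z n + γ * max (Y x z n) (x Idx.sw)) := by positivity
          have h9 := mul_nonneg hk.le h2
          linarith
        · rw [div_le_iff₀ hden]
          unfold bell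
          have h1 : lam * (F z n + γ * max (Y x z n) (x Idx.sw)) ≤ lam * M := by
            apply mul_le_mul_of_nonneg_left _ hlam.le
            have := mul_le_mul_of_nonneg_left hmx1 hγ0.le
            linarith [hFM z n]
          have h2 := mul_le_mul_of_nonneg_left (hY x hx z (n + 1)).2 hk.le
          have h3 := mul_le_mul_of_nonneg_left (hY x hx z (n - 1)).2 hc1
          have h4 := mul_le_mul_of_nonneg_left (hY x hx z n).2 hc2
          have h5 : (∑ w ∈ Finset.univ.filter (fun w => w ≠ z), μ z w * Y x w n) ≤ out z * M := by
            change _ ≤ (∑ y ∈ Finset.univ.filter (fun y => y ≠ z), μ z y) * M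
            rw [Finset.sum_mul]
            exact Finset.sum_le_sum fun w hw => mul_le_mul_of_nonneg_left (hY x hx w n).2
              (hμ z w (Ne.symm (Finset.mem_filter.1 hw).2)).le
          linarith
    · exact ⟨le_max_left _ _, max_le hlohi (min_le_left _ _)⟩
    · change (∑' n, ∑ z, m x n / (∑' k, m x k) * P x z n * Y x z (n + 1)) ∈ Set.Icc 0 M
      obtain ⟨h1, h2⟩ := hWs x hx
      have hs : Summable (fun n => m x n / (∑' k, m x k) * M) :=
        ((hms x hx).1.div_const _).mul_right M
      refine ⟨tsum_nonneg h1, ?_⟩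
      calc _ ≤ ∑' n, m x n / (∑' k, m x k) * M :=
            Summable.tsum_le_tsum h2 (Summable.of_nonneg_of_le h1 h2 hs) hs
        _ = M := by
            rw [tsum_mul_right, tsum_div_const, div_self (hS0 x hx).ne', one_mul]
  -- continuity
  have cP : ∀ z n, Continuous (fun x => P x z n) := by
    intro z n
    change Continuous fun x : Idx Z → ℝ => nrm (fun z n => x (Idx.q z n)) z n
    unfold nrm
    apply Continuous.div (by fun_prop) (by fun_prop)
    intro x
    exact (lt_of_lt_of_le one_pos (le_max_left _ _)).ne'
  have cX : ∀ z n, Continuous (fun x => X x z n) := fun z n => continuous_apply _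
  have cY : ∀ z n, Continuous (fun x => Y x z n) := fun z n => continuous_apply _
  have cK : Continuous (fun x : Idx Z → ℝ => x Idx.kap) := continuous_apply _
  have cW : Continuous (fun x : Idx Z → ℝ => x Idx.sw) := continuous_apply _
  have cD : ∀ n, Continuous (fun x => DD γ (X x) (P x) n) := by
    intro n
    unfold DD
    exact continuous_const.sub (continuous_const.mul
      (continuous_finsetSum _ fun z _ => (cP z n).mul (cX z n)))
  have cm : ∀ n, ContinuousOn (fun x => m x n) Q := by
    intro n
    induction n with
    | zero => exact continuousOn_const
    | succ n ih =>
      change ContinuousOn (fun x => m x n *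
        (x Idx.kap / (lam * ((n : ℝ) + 1) * DD γ (X x) (P x) (n + 1)))) Q
      refine ih.mul (cK.continuousOn.div (continuous_const.mul (cD (n + 1))).continuousOn ?_)
      intro x hx
      have := hDD0 x hx (n + 1)
      positivity
  have cS : ContinuousOn (fun x => ∑' k, m x k) Q := by
    apply continuousOn_tsum cm (bound_summable (hi / (lam * (1 - γ)))).1
    intro n x hx
    rw [Real.norm_eq_abs, abs_of_pos (hm0 x hx n)]
    exact hmb x hx n
  have cS2 : ContinuousOn (fun x => ∑' n : ℕ, (n : ℝ) * m x n) Q := by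
    have h0 : ∀ n : ℕ, ContinuousOn (fun x => (n : ℝ) * m x n) Q :=
      fun n => continuousOn_const.mul (cm n)
    apply continuousOn_tsum h0 (bound_summable (hi / (lam * (1 - γ)))).2
    intro n x hx
    rw [Real.norm_eq_abs, abs_of_nonneg (mul_nonneg (Nat.cast_nonneg n) (hm0 x hx n).le)]
    exact mul_le_mul_of_nonneg_left (hmb x hx n) (Nat.cast_nonneg n)
  have hS1 : ∀ x ∈ Q, 1 ≤ ∑' k, m x k := by
    intro x hx
    exact (hms x hx).1.le_tsum 0 (fun n _ => (hm0 x hx n).le)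
  have hcont : ContinuousOn f Q := by
    rw [continuousOn_pi]
    intro i
    rcases i with ⟨z, n⟩ | ⟨z, n⟩ | ⟨z, n⟩ | _ | _
    · change ContinuousOn (fun x => max 0 (min 1 (X x z n + (Y x z n - x Idx.sw)))) Q
      exact (continuous_const.max (continuous_const.min
        ((cX z n).add ((cY z n).sub cW)))).continuousOn
    · change ContinuousOn (fun x => P x z n + ε n * bal μ lam γ (x Idx.kap) (X x) (P x) z n) Q
      refine (cP z n).continuousOn.add (continuousOn_const.mul ?_)
      unfold bal
      refine ContinuousOn.sub (ContinuousOn.add (Continuous.continuousOn ?_) ?_)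
        (Continuous.continuousOn ?_)
      · exact (continuous_finsetSum _ fun w _ => (cP w n).mul continuous_const).add
          ((continuous_const.mul (cD n)).mul (cP z (n - 1)))
      · refine ((cK.continuousOn.div (cD (n + 1)).continuousOn
          (fun x hx => (hDD0 x hx _).ne')).mul ?_).mul (cP z (n + 1)).continuousOn
        exact (continuous_const.sub (continuous_const.mul (cX z (n + 1)))).continuousOn
      · exact (cP z n).mul ((continuous_const.add cK).add
          (continuous_const.mul (continuous_const.sub (continuous_const.mul (cX z n)))))
    · change ContinuousOn (fun x => if n = 0 then (0 : ℝ) else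
        bell μ lam γ (x Idx.kap) (x Idx.sw) F (X x) (Y x) z n /
          ((n : ℝ) * lam + x Idx.kap + out z)) Q
      split_ifs with hn
      · exact continuousOn_const
      · refine ContinuousOn.div (Continuous.continuousOn ?_) (Continuous.continuousOn ?_) ?_
        · unfold bell
          refine Continuous.add (Continuous.add (Continuous.add (Continuous.add ?_ ?_) ?_) ?_) ?_
          · exact continuous_const.mul (continuous_const.add
              (continuous_const.mul ((cY z n).max cW)))
          · exact cK.mul (cY z (n + 1))
          · exact continuous_finsetSum _ fun w _ => continuous_const.mul (cY w n)
          · exact (continuous_const.mul (continuous_const.sub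
              (continuous_const.mul (cX z n)))).mul (cY z (n - 1))
          · exact (continuous_const.mul (cX z n)).mul (cY z n)
        · exact (continuous_const.add cK).add continuous_const
        · intro x hx
          have := hK0 x hx
          have := hout z
          positivity
    · change ContinuousOn (fun x => max lo (min hi (x Idx.kap +
        (β - (∑' n : ℕ, (n : ℝ) * m x n) / (∑' k, m x k))))) Q
      have h1 : ContinuousOn (fun x => x Idx.kap +
        (β - (∑' n : ℕ, (n : ℝ) * m x n) / (∑' k, m x k))) Q :=
        cK.continuousOn.add (continuousOn_const.sub
          (cS2.div cS fun x hx => (hS0 x hx).ne'))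
      exact ContinuousOn.sup continuousOn_const (ContinuousOn.inf continuousOn_const h1)
    · change ContinuousOn (fun x => ∑' n, ∑ z, m x n / (∑' k, m x k) * P x z n * Y x z (n + 1)) Q
      have h0 : ∀ n : ℕ, ContinuousOn
          (fun x => ∑ z, m x n / (∑' k, m x k) * P x z n * Y x z (n + 1)) Q := by
        intro n
        refine continuousOn_finsetSum _ fun z _ => ?_
        exact (((cm n).div cS fun x hx => (hS0 x hx).ne').mul (cP z n).continuousOn).mul
          (cY z (n + 1)).continuousOn
      apply continuousOn_tsum h0 ((bound_summable (hi / (lam * (1 - γ)))).1.mul_right M)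
      intro n x hx
      obtain ⟨h1, h2⟩ := hWs x hx
      rw [Real.norm_eq_abs, abs_of_nonneg (h1 n)]
      refine (h2 n).trans (mul_le_mul_of_nonneg_right ?_ hM)
      exact (div_le_self (hm0 x hx n).le (hS1 x hx)).trans (hmb x hx n)
  obtain ⟨x, hx, hfx⟩ := brouwer_box a b (by
    intro i
    rcases i with ⟨z, n⟩ | ⟨z, n⟩ | ⟨z, n⟩ | _ | _
    · exact zero_le_one
    · exact zero_le_one
    · exact hM
    · exact hlohi
    · exact hM) f hmaps hcont
  have hqs : ∀ n, ∑ z, x (Idx.q z n) = 1 := by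
    intro n
    rw [← hbalsum x hx n, hfx]
  have hPx : P x = fun z n => x (Idx.q z n) := nrm_eq hqs
  refine ⟨X x, P x, Y x, x Idx.kap, x Idx.sw, hX x hx, hP0 x hx, hP1 x, hY x hx, hK x hx,
    (hW x hx).1, ?_, ?_, ?_, ?_, ?_⟩
  · intro z n
    exact (congrFun hfx (Idx.xi z n)).symm
  · intro z n
    have h1 : P x z n + ε n * bal μ lam γ (x Idx.kap) (X x) (P x) z n = x (Idx.q z n) :=
      congrFun hfx (Idx.q z n)
    have h2 : P x z n = x (Idx.q z n) := by rw [hPx]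
    have h3 : ε n * bal μ lam γ (x Idx.kap) (X x) (P x) z n = 0 := by linarith
    exact (mul_eq_zero.1 h3).resolve_left (hε n).ne'
  · intro z n hn
    have h1 : (if n = 0 then (0 : ℝ) else
        bell μ lam γ (x Idx.kap) (x Idx.sw) F (X x) (Y x) z n /
          ((n : ℝ) * lam + x Idx.kap + out z)) = Y x z n := congrFun hfx (Idx.v z n)
    rw [if_neg (by omega), div_eq_iff] at h1
    · rw [h1]; ring
    · have := hK0 x hx
      have := hout z
      positivity
  · exact (congrFun hfx Idx.kap).symm
  · exact (congrFun hfx Idx.sw).symm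


lemma clip_mean {β lam γ κ m : ℝ} (hlam : 0 < lam) (hγ1 : γ < 1)
    (hκ : β * lam * (1 - γ) ≤ κ ∧ κ ≤ β * lam) (h1 : lam * (1 - γ) * m ≤ κ) (h2 : κ ≤ lam * m)
    (h : κ = max (β * lam * (1 - γ)) (min (β * lam) (κ + (β - m)))) : m = β := by
  have hg : 0 < 1 - γ := by linarith
  rcases lt_trichotomy m β with hm | hm | hm
  · exfalso
    have h3 : κ = β * lam := by
      by_contra hne
      have h4 : κ < β * lam := lt_of_le_of_ne hκ.2 hne
      have h5 : κ < min (β * lam) (κ + (β - m)) := lt_min h4 (by linarith)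
      have h6 := le_max_right (β * lam * (1 - γ)) (min (β * lam) (κ + (β - m)))
      linarith
    nlinarith
  · exact hm
  · exfalso
    have h3 : κ = β * lam * (1 - γ) := by
      by_contra hne
      have h4 : β * lam * (1 - γ) < κ := lt_of_le_of_ne hκ.1 (Ne.symm hne)
      have h5 : max (β * lam * (1 - γ)) (min (β * lam) (κ + (β - m))) < κ :=
        max_lt h4 (lt_of_le_of_lt (min_le_right _ _) (by linarith))
      linarith
    nlinarith [mul_pos (mul_pos hlam hg) (sub_pos.2 hm)]

/-- **Existence of a mean field equilibrium** (Theorem 1 of the paper): for any finite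
nonempty resource-level set with positive transition rates, decision rate `λ > 0`,
survival probability `γ ∈ (0,1)`, agent density `β > 0`, and resource-sharing
function `F`, a mean field equilibrium exists; it can be chosen with
`κ ∈ [βλ(1-γ), βλ]` and with `ξ(z,n) = 0` for all large `n`. -/
theorem mfe_existence (Z : Type) [Fintype Z] [DecidableEq Z] [Nonempty Z]
    (μ : Z → Z → ℝ) (hμ : ∀ z y : Z, z ≠ y → 0 < μ z y)
    (lam γ β : ℝ) (hlam : 0 < lam) (hγ : γ ∈ Set.Ioo (0 : ℝ) 1) (hβ : 0 < β)
    (F : Z → ℕ → ℝ) (hF : IsResourceSharing F) :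
    ∃ (ξ : Z → ℕ → ℝ) (κ V_sw : ℝ) (π V V_st : Z → ℕ → ℝ),
      IsMFE μ lam γ β F ξ κ V_sw π V V_st ∧
        κ ∈ Set.Icc (β * lam * (1 - γ)) (β * lam) ∧
        ∃ N₀ : ℕ, ∀ z : Z, ∀ n : ℕ, N₀ ≤ n → ξ z n = 0 := by
  obtain ⟨hγ0, hγ1⟩ := hγ
  obtain ⟨hF0, ⟨z₀, n₀, hn₀, hFpos⟩, hFlim⟩ := hF
  have hg : 0 < 1 - γ := by linarith
  have hb : ∀ z, ∃ C, ∀ n, F z n ≤ C := fun z => by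
    obtain ⟨C, hC⟩ := (hFlim z).bddAbove_range
    exact ⟨C, fun n => hC ⟨n, rfl⟩⟩
  choose C hC using hb
  have hC0 : ∀ z, 0 ≤ C z := fun z => (hF0 z 0).trans (hC z 0)
  set B := ∑ z, C z with hBdef
  have hB0 : 0 ≤ B := Finset.sum_nonneg fun z _ => hC0 z
  have hFB : ∀ z n, F z n ≤ B := fun z n => (hC z n).trans
    (Finset.single_le_sum (fun z _ => hC0 z) (Finset.mem_univ z))
  set M := B / (1 - γ) with hMdef
  have hM : 0 ≤ M := div_nonneg hB0 hg.le
  have hMB : M * (1 - γ) = B := div_mul_cancel₀ _ hg.ne'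
  have hFM : ∀ z n, F z n + γ * M ≤ M := fun z n => by
    have := hFB z n
    nlinarith
  obtain ⟨ξ, p, v, κ, W, hξ, hp0, hp1, hv, hκ, hW0, hclip, hbal, hbell, hkap, hsw⟩ :=
    fixed_point μ hμ lam γ β M hlam hγ0 hγ1 hβ F hF0 hM hFM
  have hκ0 : 0 < κ := lt_of_lt_of_le (by positivity) hκ.1
  have hDb := DD_bounds hγ0 hξ hp0 hp1
  have hD0 : ∀ n, 0 < DD γ ξ p n := fun n => lt_of_lt_of_le hg (hDb n).1
  have hpos := mm_pos (κ := κ) hlam hκ0 hD0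
  obtain ⟨hs1, hs2⟩ := mm_summable hlam hκ0 hγ1 (fun n => (hDb n).1)
  have hS : 0 < ∑' k, mm lam γ κ ξ p k := hs1.tsum_pos (fun n => (hpos n).le) 0 (hpos 0)
  have hflow := mm_flow hlam hκ0 hγ1 (fun n => (hDb n).1) (fun n => (hDb n).2)
  have hpe : ∀ z, ∀ n : ℕ, p z n * ((∑ y ∈ Finset.univ.filter (fun y => y ≠ z), μ z y) + κ
        + lam * n * (1 - γ * ξ z n)) =
      (∑ w ∈ Finset.univ.filter (fun w => w ≠ z), p w n * μ w z)
        + lam * n * DD γ ξ p n * p z (n - 1)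
        + κ / DD γ ξ p (n + 1) * (1 - γ * ξ z (n + 1)) * p z (n + 1) := fun z n =>
    (sub_eq_zero.1 (hbal z n)).symm
  obtain ⟨hprob, hdens⟩ := stationary μ hlam hκ0 hγ0 hγ1 hξ hp0 hp1 hpe
  set S := ∑' k, mm lam γ κ ξ p k with hSdef
  have hmean : (∑' n : ℕ, (n : ℝ) * mm lam γ κ ξ p n) / S = β := by
    refine clip_mean hlam hγ1 hκ ?_ ?_ hkap
    · rw [← mul_div_assoc, div_le_iff₀ hS]; exact hflow.1
    · rw [← mul_div_assoc, le_div_iff₀ hS]; exact hflow.2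
  -- strict positivity of the conditional distributions
  have hppos : ∀ z n, 0 < p z n := by
    intro z n
    refine lt_of_le_of_ne (hp0 z n) fun h => ?_
    have h1 := hpe z n
    rw [← h, zero_mul] at h1
    have hterm : ∀ w ∈ Finset.univ.filter (fun w => w ≠ z), 0 ≤ p w n * μ w z := fun w hw =>
      mul_nonneg (hp0 w n) (hμ w z (Finset.mem_filter.1 hw).2).le
    have hA := Finset.sum_nonneg hterm
    have hB2 : 0 ≤ lam * n * DD γ ξ p n * p z (n - 1) :=
      mul_nonneg (mul_nonneg (by positivity) (hD0 n).le) (hp0 _ _)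
    have hx : 0 ≤ 1 - γ * ξ z (n + 1) := by
      have := hξ z (n + 1)
      nlinarith
    have hC2 : 0 ≤ κ / DD γ ξ p (n + 1) * (1 - γ * ξ z (n + 1)) * p z (n + 1) :=
      mul_nonneg (mul_nonneg (div_nonneg hκ0.le (hD0 _).le) hx) (hp0 _ _)
    have hA0 : ∑ w ∈ Finset.univ.filter (fun w => w ≠ z), p w n * μ w z = 0 := by linarith
    have hall : ∀ w, p w n = 0 := by
      intro w
      by_cases hw : w = z
      · rw [hw, ← h]
      · have hw2 : w ∈ Finset.univ.filter (fun w => w ≠ z) :=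
          Finset.mem_filter.2 ⟨Finset.mem_univ w, hw⟩
        have h3 := (Finset.sum_eq_zero_iff_of_nonneg hterm).1 hA0 w hw2
        exact (mul_eq_zero.1 h3).resolve_right (hμ w z hw).ne'
    have h4 := hp1 n
    simp [hall] at h4
  have hm0 : ∀ n, 0 < mm lam γ κ ξ p n / S := fun n => div_pos (hpos n) hS
  have hg0 : ∀ z n, 0 ≤ mm lam γ κ ξ p n / S * p z n * v z (n + 1) := fun z n =>
    mul_nonneg (mul_nonneg (hm0 n).le (hp0 z n)) (hv z (n + 1)).1
  have hs0 : ∀ n, 0 ≤ ∑ z, mm lam γ κ ξ p n / S * p z n * v z (n + 1) := fun n =>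
    Finset.sum_nonneg fun z _ => hg0 z n
  have hsum : Summable fun n => ∑ z, mm lam γ κ ξ p n / S * p z n * v z (n + 1) := by
    refine Summable.of_nonneg_of_le hs0 (fun n => ?_) ((hs1.div_const S).mul_right M)
    calc _ ≤ ∑ z, mm lam γ κ ξ p n / S * p z n * M := Finset.sum_le_sum fun z _ =>
          mul_le_mul_of_nonneg_left (hv _ _).2 (mul_nonneg (hm0 n).le (hp0 z n))
      _ = _ := by rw [← Finset.sum_mul, ← Finset.mul_sum, hp1, mul_one]
  have hWpos : 0 < W := by
    refine lt_of_le_of_ne hW0 fun h => ?_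
    have hz : ∀ n, ∑ z, mm lam γ κ ξ p n / S * p z n * v z (n + 1) = 0 := by
      have h1 : ∑' n, ∑ z, mm lam γ κ ξ p n / S * p z n * v z (n + 1) = 0 := by rw [← hsw, ← h]
      have h2 := (hsum.hasSum_iff.2 h1)
      rw [hasSum_zero_iff_of_nonneg hs0] at h2
      exact fun n => congrFun h2 n
    have hv0 : ∀ z n, v z (n + 1) = 0 := by
      intro z n
      have h1 := (Finset.sum_eq_zero_iff_of_nonneg (fun z _ => hg0 z n)).1 (hz n) z
        (Finset.mem_univ z)
      exact (mul_eq_zero.1 h1).resolve_left (mul_pos (hm0 n) (hppos z n)).ne'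
    obtain ⟨k, rfl⟩ : ∃ k, n₀ = k + 1 := ⟨n₀ - 1, by omega⟩
    have hB := hbell z₀ (k + 1) hn₀
    have hlast : ((k : ℝ) + 1 - 1) * lam * (1 - γ * ξ z₀ (k + 1)) * v z₀ k = 0 := by
      rcases k with _ | k
      · simp
      · have : v z₀ (k + 1) = 0 := hv0 z₀ k
        rw [this, mul_zero]
    unfold bell at hB
    push_cast at hB
    rw [hlast] at hB
    simp only [hv0, ← h, mul_zero, max_self, add_zero, Finset.sum_const_zero] at hB
    have := mul_pos hlam hFpos
    linarith
  have hopt : ∀ z n, (W < v z n → ξ z n = 1) ∧ (v z n < W → ξ z n = 0) := by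
    intro z n
    have h1 := hclip z n
    have h2 := hξ z n
    constructor
    · intro h
      by_contra hne
      have h4 : ξ z n < 1 := lt_of_le_of_ne h2.2 hne
      have h5 : ξ z n < min 1 (ξ z n + (v z n - W)) := lt_min h4 (by linarith)
      have h6 := le_max_right 0 (min 1 (ξ z n + (v z n - W)))
      linarith
    · intro h
      by_contra hne
      have h4 : 0 < ξ z n := lt_of_le_of_ne h2.1 (Ne.symm hne)
      have h5 : max 0 (min 1 (ξ z n + (v z n - W))) < ξ z n :=
        max_lt h4 (lt_of_le_of_lt (min_le_right _ _) (by linarith))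
      linarith
  have hprod := prod_sum (fun z n => mm lam γ κ ξ p n / S * p z n * v z (n + 1)) hg0 hsum
  obtain ⟨N₀, hN₀⟩ := value_small μ hμ lam γ κ W M hlam hγ0 hγ1 hκ0 hWpos F ξ v hFlim hξ
    (fun z n => (hv z n).1) (fun z n => (hv z n).2) hbell
  refine ⟨ξ, κ, W, fun z n => mm lam γ κ ξ p n / S * p z n,
    fun z n => F z n + γ * max (v z n) W, v, ⟨hξ, hκ0, hWpos, hprob, ⟨?_, ?_, ?_⟩, ?_, ?_, ?_⟩,
    hκ, N₀, fun z n hn => (hopt z n).2 (hN₀ n hn z)⟩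
  · refine ⟨B + γ * max M W, fun z n => ?_⟩
    have h1 : 0 ≤ max (v z n) W := le_max_of_le_right hW0
    have h2 : max (v z n) W ≤ max M W := max_le_max_right W (hv z n).2
    have h3 := hF0 z n
    rw [abs_of_nonneg (by positivity)]
    exact add_le_add (hFB z n) (mul_le_mul_of_nonneg_left h2 hγ0.le)
  · exact ⟨M, fun z n => by rw [abs_of_nonneg (hv z n).1]; exact (hv z n).2⟩
  · exact fun z n hn => ⟨rfl, hbell z n hn⟩
  · exact fun z n _ => hopt z n
  · exact hsw.trans hprod.2.symm
  · exact hdens.trans hmean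
end

section
/- For every nonempty finite set Z of resource levels with transition rates μ(z,y) > 0 (z ≠ y), every λ > 0, γ ∈ (0,1), β > 0, and every resource-sharing function F that is decreasing (F(z,n+1) ≤ F(z,n) for every z ∈ Z and n ≥ 1), there exists a mean field equilibrium (ξ, κ, V_sw, π, V, V_st) in which ξ is a threshold strategy, i.e. ξ = ξ^x for some x : Z → [0,∞). -/
open scoped BigOperators

variable {Z : Type}

/-- The threshold strategy `ξ^x` determined by thresholds `x : Z → [0,∞)`:
stay if `n < ⌊x z⌋`, stay with probability `x z - ⌊x z⌋` if `n = ⌊x z⌋`,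
and switch if `n > ⌊x z⌋`. -/
noncomputable def thresholdStrategy (x : Z → ℝ) (z : Z) (n : ℕ) : ℝ :=
  if (n : ℤ) < ⌊x z⌋ then 1
  else if (n : ℤ) = ⌊x z⌋ then x z - ⌊x z⌋
  else 0

section
open Set Filter Topology MeasureTheory


lemma brw_det_interp {E : Type*} [NormedAddCommGroup E] [InnerProductSpace ℝ E]
    [FiniteDimensional ℝ E] (t0 : ℝ) (ht0 : 0 < t0) :
    ∃ (s : Finset ℝ) (c : ℝ → ℝ), (∀ t ∈ s, 0 < t ∧ t < t0) ∧
      ∀ A : E →L[ℝ] E, (1 + A).det = ∑ t ∈ s, c t * (1 + t • A).det := by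
  classical
  obtain ⟨s, hs, hcard⟩ := (Set.Ioo_infinite ht0).exists_subset_card_eq
    (Module.finrank ℝ E + 1)
  refine ⟨s, fun t => (Lagrange.basis s id t).eval 1, fun t ht => hs ht, fun A => ?_⟩
  let b := Module.finBasis ℝ E
  let M := LinearMap.toMatrix b b (A : E →ₗ[ℝ] E)
  let p : Polynomial ℝ := Matrix.det ((Polynomial.X : Polynomial ℝ) • M.map Polynomial.C
    + (1 : Matrix _ _ ℝ).map Polynomial.C)
  have hev : ∀ t : ℝ, p.eval t = (1 + t • A).det := by
    intro t
    have h1 : (1 + t • A).det = Matrix.det (1 + t • M) := by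
      rw [ContinuousLinearMap.det, ← LinearMap.det_toMatrix b]
      congr 1
      simp [M, ContinuousLinearMap.toLinearMap_add, ContinuousLinearMap.toLinearMap_one, LinearMap.toMatrix_one]
    rw [h1]
    change Polynomial.eval t (Matrix.det _) = _
    rw [← Polynomial.coe_evalRingHom, RingHom.map_det]
    congr 1
    ext i j
    simp [Matrix.add_apply, Matrix.one_apply, apply_ite (Polynomial.eval t)]
    ring
  have hdeg : p.degree < s.card := by
    have := Polynomial.natDegree_det_X_add_C_le M 1
    rw [hcard]
    refine lt_of_le_of_lt Polynomial.degree_le_natDegree ?_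
    have h2 : p.natDegree ≤ Module.finrank ℝ E := by simpa only [Fintype.card_fin] using this
    exact_mod_cast Nat.lt_succ_of_le h2
  have h3 := Lagrange.eq_interpolate (v := id) (s := s) (f := p) (Function.injective_id.injOn) hdeg
  have h4 := hev 1
  rw [one_smul] at h4
  rw [← h4, h3, Lagrange.interpolate_apply, Polynomial.eval_finsetSum]
  refine Finset.sum_congr rfl fun t _ => ?_
  rw [Polynomial.eval_mul, Polynomial.eval_C, id, hev, mul_comm]

lemma brw_no_retract {E : Type*} [NormedAddCommGroup E] [InnerProductSpace ℝ E]
    [FiniteDimensional ℝ E] (R : ℝ) (hR : 0 < R) (r : E → E)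
    (hr : ContDiff ℝ 1 r) (hn : ∀ x, ‖r x‖ = R) (hid : ∀ x, ‖x‖ = R → r x = x) : False := by
  classical
  let _ : MeasurableSpace E := borel E
  have : BorelSpace E := ⟨rfl⟩
  let h : E → E := fun x => r x - x
  have hh : ContDiff ℝ 1 h := hr.sub contDiff_id
  have hfd : Continuous (fderiv ℝ h) := hh.continuous_fderiv (by simp)
  let B : Set E := Metric.closedBall 0 R
  have hB : IsCompact B := isCompact_closedBall 0 R
  obtain ⟨C, hC⟩ := hB.exists_bound_of_continuousOn hfd.continuousOn
  have hC0 : 0 ≤ C := (norm_nonneg _).trans (hC 0 (by simp [B, hR.le]))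
  have hd : Differentiable ℝ h := hh.differentiable (by simp)
  have hlip : ∀ x ∈ B, ∀ y ∈ B, ‖h y - h x‖ ≤ C * ‖y - x‖ := fun x hx y hy =>
    (convex_closedBall (0 : E) R).norm_image_sub_le_of_norm_fderiv_le (fun x _ => hd x) hC hx hy
  -- extension
  let k : E → E := fun x => if x ∈ B then h x else 0
  have hk0 : ∀ x, ‖x‖ = R → h x = 0 := fun x hx => by simp [h, hid x hx]
  have hmix : ∀ x ∈ B, ∀ y, y ∉ B → ‖h x‖ ≤ C * ‖y - x‖ := by
    intro x hx y hy
    have hx' : ‖x‖ ≤ R := by simpa [B] using hx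
    have hy' : R < ‖y‖ := by simpa [B] using hy
    have hcont : ContinuousOn (fun t : ℝ => ‖x + t • (y - x)‖) (Icc 0 1) := by fun_prop
    have := intermediate_value_Icc (zero_le_one' ℝ) hcont
    have hm : R ∈ Icc (‖x + (0:ℝ) • (y - x)‖) (‖x + (1:ℝ) • (y - x)‖) := by
      simp [hx', hy'.le]
    obtain ⟨t, ht, hte⟩ := this hm
    have hw : x + t • (y - x) ∈ B := by
      simp only [B, mem_closedBall_zero_iff]; exact hte.le
    have h1 := hlip x hx _ hw
    rw [hk0 _ hte] at h1
    simp only [zero_sub, norm_neg, add_sub_cancel_left, norm_smul, Real.norm_eq_abs] at h1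
    refine h1.trans (mul_le_mul_of_nonneg_left ?_ hC0)
    rw [abs_of_nonneg ht.1]
    exact mul_le_of_le_one_left (norm_nonneg _) ht.2
  have hklip : ∀ x y, ‖k y - k x‖ ≤ C * ‖y - x‖ := by
    intro x y
    by_cases hx : x ∈ B <;> by_cases hy : y ∈ B
    · simpa [k, hx, hy] using hlip x hx y hy
    · simpa [k, hx, hy] using hmix x hx y hy
    · simpa [k, hx, hy, norm_sub_rev] using hmix y hy x hx
    · simp only [k, hx, hy, if_false, sub_self, norm_zero]; positivity
  -- determinant near 1 is positive
  have hdet1 : (1 : E →L[ℝ] E).det = 1 := by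
    change LinearMap.det (LinearMap.id : E →ₗ[ℝ] E) = 1
    exact LinearMap.det_id
  have hdet : ∀ᶠ A : E →L[ℝ] E in 𝓝 1, 0 < A.det := by
    have : ContinuousAt (fun f : E →L[ℝ] E => f.det) 1 :=
      ContinuousLinearMap.continuous_det.continuousAt
    refine this.eventually (lt_mem_nhds ?_)
    simp [hdet1]
  obtain ⟨η, hη, hdet⟩ := Metric.eventually_nhds_iff.1 hdet
  let t0 := min (1 / (C + 1)) (η / (C + 1))
  have ht0 : 0 < t0 := lt_min (by positivity) (by positivity)
  have hvol : ∀ t, 0 < t → t < t0 →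
      ∫ x in B, (1 + t • fderiv ℝ h x).det = (volume B).toReal := by
    intro t ht htt
    have ht1 : t * (C + 1) < 1 := by
      have := lt_of_lt_of_le htt (min_le_left _ _); rwa [lt_div_iff₀ (by positivity)] at this
    have ht2 : t * (C + 1) < η := by
      have := lt_of_lt_of_le htt (min_le_right _ _); rwa [lt_div_iff₀ (by positivity)] at this
    have htC : t * C < 1 := by nlinarith
    let g : E → E := fun x => x + t • h x
    have hgd : ∀ x ∈ B, HasFDerivWithinAt g (1 + t • fderiv ℝ h x) B x := by
      intro x _
      exact ((hasFDerivAt_id x).add ((hd x).hasFDerivAt.const_smul t)).hasFDerivWithinAt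
    have hinj : InjOn g B := by
      intro x hx y hy hxy
      have h1 := hlip x hx y hy
      have h2 : y - x = - (t • (h y - h x)) := by
        have : x + t • h x = y + t • h y := hxy
        rw [smul_sub, neg_sub, sub_eq_sub_iff_add_eq_add, ← this, add_comm]
      have h3 : ‖y - x‖ ≤ (t * C) * ‖y - x‖ := by
        calc ‖y - x‖ = t * ‖h y - h x‖ := by
              conv_lhs => rw [h2]
              rw [norm_neg, norm_smul, Real.norm_eq_abs, abs_of_pos ht]
          _ ≤ t * (C * ‖y - x‖) := mul_le_mul_of_nonneg_left h1 ht.le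
          _ = _ := by ring
      have h4 : ‖y - x‖ = 0 := by nlinarith [norm_nonneg (y - x)]
      exact (sub_eq_zero.1 (norm_eq_zero.1 h4)).symm
    have himg : g '' B = B := by
      apply Subset.antisymm
      · rintro _ ⟨x, hx, rfl⟩
        have hx' : ‖x‖ ≤ R := by simpa [B] using hx
        have ht3 : t < 1 := by nlinarith
        have : g x = (1 - t) • x + t • r x := by
          simp only [g, h]; module
        simp only [B, mem_closedBall_zero_iff, this]
        calc _ ≤ ‖(1 - t) • x‖ + ‖t • r x‖ := norm_add_le _ _
          _ = (1 - t) * ‖x‖ + t * R := by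
            rw [norm_smul, norm_smul, hn, Real.norm_eq_abs, Real.norm_eq_abs, abs_of_pos ht,
              abs_of_pos (by linarith)]
          _ ≤ R := by nlinarith
      · intro y hy
        have hcon : ContractingWith ⟨t * C, by positivity⟩ (fun x => y - t • k x) := by
          refine ⟨by exact_mod_cast htC, LipschitzWith.of_dist_le_mul fun a b => ?_⟩
          rw [dist_eq_norm, dist_eq_norm]
          have h1 := hklip a b
          have : (y - t • k a) - (y - t • k b) = t • (k b - k a) := by module
          rw [this, norm_smul, Real.norm_eq_abs, abs_of_pos ht, norm_sub_rev a b]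
          calc _ ≤ t * (C * ‖b - a‖) := mul_le_mul_of_nonneg_left h1 ht.le
            _ = _ := by rw [← mul_assoc]; rfl
        have hfix := hcon.fixedPoint_isFixedPt
        set x := ContractingWith.fixedPoint _ hcon with hxdef
        have hfix' : y - t • k x = x := hfix
        by_cases hx : x ∈ B
        · refine ⟨x, hx, ?_⟩
          simp only [k, hx, if_true] at hfix'
          simp only [g]
          exact (sub_eq_iff_eq_add.1 hfix').symm
        · simp only [k, hx, if_false, smul_zero, sub_zero] at hfix'
          exact absurd (hfix' ▸ hy) hx
    have h5 := integral_image_eq_integral_abs_det_fderiv_smul volume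
      (measurableSet_closedBall (x := (0:E)) (ε := R)) hgd hinj (fun _ => (1 : ℝ))
    change ∫ x in g '' B, (1 : ℝ) = ∫ x in B, _ at h5
    rw [himg] at h5
    rw [setIntegral_const] at h5
    simp only [smul_eq_mul, mul_one] at h5
    rw [← Measure.real, h5]
    refine setIntegral_congr_fun measurableSet_closedBall fun x hx => ?_
    have : 0 < (1 + t • fderiv ℝ h x).det := by
      apply hdet
      rw [dist_eq_norm, add_sub_cancel_left, norm_smul, Real.norm_eq_abs, abs_of_pos ht]
      have := hC x hx
      nlinarith [norm_nonneg (fderiv ℝ h x)]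
    exact (abs_of_pos this).symm
  obtain ⟨s, c, hs, hsum⟩ := brw_det_interp (E := E) t0 ht0
  have hint : ∀ t : ℝ, IntegrableOn (fun x => (1 + t • fderiv ℝ h x).det) B := by
    intro t
    refine ContinuousOn.integrableOn_compact hB ?_
    exact (ContinuousLinearMap.continuous_det.comp
      (continuous_const.add (hfd.const_smul t))).continuousOn
  have hc1 : ∑ t ∈ s, c t = 1 := by
    have := hsum 0
    simpa [hdet1] using this.symm
  have hP1 : ∫ x in B, (1 + fderiv ℝ h x).det = (volume B).toReal := by
    rw [integral_congr_ae (Filter.Eventually.of_forall fun x => hsum (fderiv ℝ h x))]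
    rw [integral_finsetSum _ (fun t _ => (hint t).const_mul (c t))]
    have : ∀ t ∈ s, ∫ x in B, c t * (1 + t • fderiv ℝ h x).det = c t * (volume B).toReal := by
      intro t ht
      rw [integral_const_mul, hvol t (hs t ht).1 (hs t ht).2]
    rw [Finset.sum_congr rfl this, ← Finset.sum_mul, hc1, one_mul]
  have hzero : ∀ x, (1 + fderiv ℝ h x).det = 0 := by
    intro x
    have hrd : DifferentiableAt ℝ r x := hr.differentiable (by simp) x
    have h1 : 1 + fderiv ℝ h x = fderiv ℝ r x := by
      have : fderiv ℝ h x = fderiv ℝ r x - fderiv ℝ (fun x => x) x :=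
        fderiv_fun_sub hrd differentiableAt_fun_id
      rw [this, fderiv_fun_id]
      exact add_sub_cancel _ _
    rw [h1]
    by_contra hne
    have hu : IsUnit (LinearMap.det (fderiv ℝ r x : E →ₗ[ℝ] E)) := isUnit_iff_ne_zero.2 hne
    obtain ⟨v, hv⟩ := (LinearMap.equivOfIsUnitDet hu).surjective (r x)
    have hv' : fderiv ℝ r x v = r x := by simpa using hv
    have h2 : HasFDerivAt (fun y => ‖r y‖ ^ 2) _ x := hrd.hasFDerivAt.norm_sq
    have h3 : (fun y => ‖r y‖ ^ 2) = fun _ => R ^ 2 := by ext y; rw [hn]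
    rw [h3] at h2
    have h4 := h2.unique (hasFDerivAt_const (R ^ 2) x)
    have h5 := congrArg (fun L : E →L[ℝ] ℝ => L v) h4
    simp [hv', hn] at h5
    exact hR.ne' h5
  simp only [hzero, integral_zero] at hP1
  have hpos : 0 < (volume B).toReal :=
    ENNReal.toReal_pos (Metric.measure_closedBall_pos _ _ hR).ne' hB.measure_lt_top.ne
  linarith

lemma brw_zero {E : Type*} [NormedAddCommGroup E] [InnerProductSpace ℝ E]
    [FiniteDimensional ℝ E] (R : ℝ) (hR : 0 < R) (f : E → E) (hf : Continuous f)
    (hid : ∀ x, R ≤ ‖x‖ → f x = x) : ∃ x, f x = 0 := by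
  by_contra! hne
  obtain ⟨δ, hδ, hδf⟩ : ∃ δ > 0, ∀ x, δ ≤ ‖f x‖ := by
    obtain ⟨x0, _, hx0⟩ := (isCompact_closedBall (0:E) R).exists_isMinOn ⟨0, by simp [hR.le]⟩
      hf.norm.continuousOn
    refine ⟨min ‖f x0‖ R, lt_min (norm_pos_iff.2 (hne x0)) hR, fun x => ?_⟩
    by_cases hx : x ∈ Metric.closedBall (0:E) R
    · exact (min_le_left _ _).trans (hx0 hx)
    · have : R < ‖x‖ := by simpa using hx
      rw [hid x this.le]; exact (min_le_right _ _).trans this.le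
  have hS : IsClosed {x : E | R + 1 ≤ ‖x‖} := isClosed_le continuous_const continuous_norm
  have hU : IsOpen {x : E | R < ‖x‖} := isOpen_lt continuous_const continuous_norm
  obtain ⟨g, hg, hga, hge, -⟩ := hf.exists_contDiff_approx_and_eqOn 1 (ε := fun _ => δ)
    continuous_const (fun _ => hδ) hS
    (hU.mem_nhdsSet.2 (fun x (hx : R + 1 ≤ ‖x‖) => by
      change R < ‖x‖; linarith))
    (contDiff_id.contDiffOn.congr (fun x hx => hid x (le_of_lt hx)))
  have hg0 : ∀ x, g x ≠ 0 := by
    intro x hx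
    have := hga x
    rw [hx, dist_zero_left] at this
    exact absurd (hδf x) (not_le.2 this)
  refine brw_no_retract (R + 1) (by linarith) (fun x => ((R + 1) * ‖g x‖⁻¹) • g x) ?_ ?_ ?_
  · refine ContDiff.smul (contDiff_const.mul (ContDiff.inv (hg.norm ℝ hg0) ?_)) hg
    intro x; exact norm_ne_zero_iff.2 (hg0 x)
  · intro x
    have := norm_pos_iff.2 (hg0 x)
    rw [norm_smul, norm_mul, norm_inv, norm_norm, Real.norm_eq_abs, abs_of_pos (by linarith)]
    field_simp
  · intro x hx
    have : g x = x := by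
      rw [hge (show R + 1 ≤ ‖x‖ from hx.ge), hid x (by linarith)]
    simp only [this, hx]
    rw [mul_inv_cancel₀ (by linarith), one_smul]

theorem brw_box {ι : Type*} [Fintype ι] (a b : ι → ℝ) (hab : ∀ i, a i ≤ b i)
    (G : (ι → ℝ) → ι → ℝ) (hG : Continuous G) :
    ∃ u : ι → ℝ, (∀ i, a i ≤ u i ∧ u i ≤ b i) ∧
      ∀ i, (u i < b i → G u i ≤ 0) ∧ (a i < u i → 0 ≤ G u i) := by
  let cl : (ι → ℝ) → ι → ℝ := fun u i => max (a i) (min (b i) (u i))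
  have hcl : Continuous cl := by fun_prop
  have hclm : ∀ u i, a i ≤ cl u i ∧ cl u i ≤ b i := fun u i =>
    ⟨le_max_left _ _, max_le (hab i) (min_le_left _ _)⟩
  let E := EuclideanSpace ℝ ι
  let c : E → E := fun x => WithLp.toLp 2 (cl (cl x.ofLp + G (cl x.ofLp)))
  have hc : Continuous c := by
    apply (PiLp.continuous_toLp 2 _).comp
    apply hcl.comp
    have : Continuous fun x : E => cl x.ofLp := hcl.comp (PiLp.continuous_ofLp 2 _)
    exact this.add (hG.comp this)
  let K : Set E := (WithLp.toLp 2) '' (Icc a b)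
  have hK : IsCompact K := isCompact_Icc.image (PiLp.continuous_toLp 2 _)
  obtain ⟨R, hR⟩ := hK.isBounded.exists_norm_le
  have hcR : ∀ x, ‖c x‖ ≤ R := fun x => hR _ ⟨_, ⟨fun i => (hclm _ i).1, fun i => (hclm _ i).2⟩, rfl⟩
  have hR0 : 0 ≤ R := (norm_nonneg _).trans (hcR 0)
  let τ : E → ℝ := fun x => max 0 (min 1 (R + 1 - ‖x‖))
  obtain ⟨x, hx⟩ := brw_zero (R + 1) (by linarith) (fun x => x - τ x • c x) (by fun_prop) (by
    intro x hx
    have : τ x = 0 := by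
      simp only [τ]
      exact max_eq_left ((min_le_right _ _).trans (by linarith))
    simp [this])
  have hτ : 0 ≤ τ x ∧ τ x ≤ 1 := ⟨le_max_left _ _, max_le zero_le_one (min_le_left _ _)⟩
  have hxe : x = τ x • c x := sub_eq_zero.1 hx
  have hxn : ‖x‖ ≤ R := by
    rw [hxe, norm_smul, Real.norm_eq_abs, abs_of_nonneg hτ.1]
    nlinarith [hcR x, norm_nonneg (c x)]
  have hτ1 : τ x = 1 := by
    simp only [τ]
    rw [min_eq_left (by linarith)]; simp
  rw [hτ1, one_smul] at hxe
  have hxi : x.ofLp = cl (cl x.ofLp + G (cl x.ofLp)) := congrArg WithLp.ofLp hxe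
  have hm : ∀ i, a i ≤ x.ofLp i ∧ x.ofLp i ≤ b i := by
    intro i; rw [hxi]; exact hclm _ i
  have hclx : cl x.ofLp = x.ofLp := by
    ext i; simp only [cl]; rw [min_eq_right (hm i).2, max_eq_right (hm i).1]
  rw [hclx] at hxi
  refine ⟨x.ofLp, hm, fun i => ?_⟩
  have hi : x.ofLp i = max (a i) (min (b i) (x.ofLp i + G x.ofLp i)) := congrFun hxi i
  constructor
  · intro h
    by_contra! hp
    have : x.ofLp i < min (b i) (x.ofLp i + G x.ofLp i) := lt_min h (by linarith)
    have := lt_of_lt_of_le this (le_max_right (a i) _)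
    linarith
  · intro h
    by_contra! hp
    have : max (a i) (min (b i) (x.ofLp i + G x.ofLp i)) < x.ofLp i :=
      max_lt h (lt_of_le_of_lt (min_le_right _ _) (by linarith))
    linarith

end

section
open Set Filter Topology

/-! ### The truncated model -/

noncomputable def tClamp (t : ℝ) : ℝ := max 0 (min 1 t)

lemma tClamp_nonneg (t : ℝ) : 0 ≤ tClamp t := le_max_left _ _
lemma tClamp_le_one (t : ℝ) : tClamp t ≤ 1 := max_le zero_le_one (min_le_left _ _)
lemma tClamp_eq_one {t : ℝ} (h : 1 ≤ t) : tClamp t = 1 := by simp [tClamp, h]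
lemma tClamp_eq_zero {t : ℝ} (h : t ≤ 0) : tClamp t = 0 := by
  simp only [tClamp]; exact max_eq_left ((min_le_right _ _).trans h)
lemma tClamp_mono {s t : ℝ} (h : s ≤ t) : tClamp s ≤ tClamp t :=
  max_le_max le_rfl (min_le_min le_rfl h)
lemma tClamp_cont : Continuous tClamp := by unfold tClamp; fun_prop

/-- strategy parametrised by `y` in the truncated model -/
noncomputable def tXi (y : Z → ℝ) (z : Z) (n : ℕ) : ℝ := tClamp (2 * (y z - n))

/-- transposed generator of the truncated chain applied to `p` -/
noncomputable def tQ [Fintype Z] [DecidableEq Z] (μ : Z → Z → ℝ) (lam γ : ℝ) (N : ℕ)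
    (κ : ℝ) (ξ p : Z → ℕ → ℝ) (x : Z) (m : ℕ) : ℝ :=
  ((∑ z ∈ Finset.univ.filter (fun z => z ≠ x), p z m * μ z x)
    - p x m * (∑ y ∈ Finset.univ.filter (fun y => y ≠ x), μ x y))
  + κ * ((if 1 ≤ m then p x (m - 1) else 0) - (if m < N then p x m else 0))
  + lam * (m + 1) * (1 - γ * ξ x (m + 1)) * p x (m + 1)
  - lam * m * (1 - γ * ξ x m) * p x m

/-- Bellman residual -/
noncomputable def tH [Fintype Z] [DecidableEq Z] (μ : Z → Z → ℝ) (lam γ : ℝ) (F : Z → ℕ → ℝ)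
    (κ W : ℝ) (ξ V : Z → ℕ → ℝ) (z : Z) (n : ℕ) : ℝ :=
  lam * (F z n + γ * max (V z n) W - V z n) + κ * (V z (n + 1) - V z n)
  + (∑ w ∈ Finset.univ.filter (fun w => w ≠ z), μ z w * (V w n - V z n))
  + ((n : ℝ) - 1) * lam * (1 - γ * ξ z n) * (V z (n - 1) - V z n)

/-- threshold excess -/
noncomputable def tE (N : ℕ) (W : ℝ) (V : Z → ℕ → ℝ) (y : Z → ℝ) (z : Z) : ℝ :=
  V z 1 - W - ∑ k ∈ Finset.range N,
    tClamp (2 * (y z - ((k : ℝ) + 2)) + 1) * (V z (k + 1) - V z (k + 2))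

noncomputable def tTot [Fintype Z] (N : ℕ) (p : Z → ℕ → ℝ) : ℝ :=
  ∑ m ∈ Finset.range (N + 1), ∑ z : Z, p z m

/-- Solution of the variational inequality of the truncated model. -/
lemma t_core [Fintype Z] [DecidableEq Z] (μ : Z → Z → ℝ) (lam γ β : ℝ) (F : Z → ℕ → ℝ)
    (N : ℕ) (M κ0 κ1 : ℝ) (hM : 0 ≤ M) (hκ : κ0 ≤ κ1) :
    ∃ (p V : Z → ℕ → ℝ) (y : Z → ℝ) (κ W : ℝ),
      (∀ z n, 0 ≤ p z n ∧ p z n ≤ 1) ∧ (∀ z n, N < n → p z n = 0) ∧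
      (∀ z n, 0 ≤ V z n ∧ V z n ≤ M) ∧ (∀ z, V z (N + 1) = V z N) ∧
      (∀ z n, N ≤ n → V z (n + 1) = V z n) ∧
      (∀ z, 1 ≤ y z ∧ y z ≤ N + 1) ∧ (κ0 ≤ κ ∧ κ ≤ κ1) ∧ (0 ≤ W ∧ W ≤ M) ∧
      (∀ z n, n ≤ N →
        (p z n < 1 → tQ μ lam γ N κ (tXi y) p z n + (max (1 - tTot N p) 0
          + min (1 - tTot N p) 0 * p z n) ≤ 0) ∧
        (0 < p z n → 0 ≤ tQ μ lam γ N κ (tXi y) p z n + (max (1 - tTot N p) 0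
          + min (1 - tTot N p) 0 * p z n))) ∧
      (∀ z n, n ≤ N →
        (V z n < M → tH μ lam γ F κ W (tXi y) V z n ≤ 0) ∧
        (0 < V z n → 0 ≤ tH μ lam γ F κ W (tXi y) V z n)) ∧
      (∀ z, (y z < N + 1 → tE N W V y z ≤ 0) ∧ (1 < y z → 0 ≤ tE N W V y z)) ∧
      ((κ < κ1 → β - ∑ m ∈ Finset.range (N + 1), ∑ z : Z, (m : ℝ) * p z m ≤ 0) ∧
       (κ0 < κ → 0 ≤ β - ∑ m ∈ Finset.range (N + 1), ∑ z : Z, (m : ℝ) * p z m)) ∧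
      ((W < M → (∑ m ∈ Finset.range (N + 1), ∑ z : Z, p z m * V z (m + 1)) - W ≤ 0) ∧
       (0 < W → 0 ≤ (∑ m ∈ Finset.range (N + 1), ∑ z : Z, p z m * V z (m + 1)) - W)) := by
  let I := (Z × Fin (N + 1)) ⊕ ((Z × Fin (N + 1)) ⊕ (Z ⊕ Bool))
  let p : (I → ℝ) → Z → ℕ → ℝ := fun u z n =>
    if h : n < N + 1 then u (Sum.inl (z, ⟨n, h⟩)) else 0
  let V : (I → ℝ) → Z → ℕ → ℝ := fun u z n =>
    u (Sum.inr (Sum.inl (z, ⟨min n N, Nat.lt_succ_of_le (min_le_right _ _)⟩)))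
  let y : (I → ℝ) → Z → ℝ := fun u z => u (Sum.inr (Sum.inr (Sum.inl z)))
  let κ : (I → ℝ) → ℝ := fun u => u (Sum.inr (Sum.inr (Sum.inr true)))
  let W : (I → ℝ) → ℝ := fun u => u (Sum.inr (Sum.inr (Sum.inr false)))
  have hp : ∀ z n, Continuous fun u => p u z n := by
    intro z n
    simp only [p]
    by_cases h : n < N + 1
    · simp only [h, dite_true]; fun_prop
    · simp only [h, dite_false]; fun_prop
  have hV : ∀ z n, Continuous fun u => V u z n := fun z n => by simp only [V]; fun_prop
  have hy : ∀ z, Continuous fun u => y u z := fun z => by simp only [y]; fun_prop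
  have hκc : Continuous κ := by simp only [κ]; fun_prop
  have hWc : Continuous W := by simp only [W]; fun_prop
  have hξ : ∀ z n, Continuous fun u => tXi (y u) z n := fun z n => by
    simp only [tXi]; exact tClamp_cont.comp (by fun_prop)
  have hTot : Continuous fun u => tTot N (p u) := by simp only [tTot]; fun_prop
  let G : (I → ℝ) → I → ℝ := fun u i => match i with
    | Sum.inl (z, n) => tQ μ lam γ N (κ u) (tXi (y u)) (p u) z n + (max (1 - tTot N (p u)) 0
          + min (1 - tTot N (p u)) 0 * p u z n)
    | Sum.inr (Sum.inl (z, n)) => tH μ lam γ F (κ u) (W u) (tXi (y u)) (V u) z n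
    | Sum.inr (Sum.inr (Sum.inl z)) => tE N (W u) (V u) (y u) z
    | Sum.inr (Sum.inr (Sum.inr true)) =>
        β - ∑ m ∈ Finset.range (N + 1), ∑ z : Z, (m : ℝ) * p u z m
    | Sum.inr (Sum.inr (Sum.inr false)) =>
        (∑ m ∈ Finset.range (N + 1), ∑ z : Z, p u z m * V u z (m + 1)) - W u
  have hG : Continuous G := by
    refine continuous_pi fun i => ?_
    rcases i with ⟨z, n⟩ | ⟨z, n⟩ | z | (_ | _)
    · simp only [G]
      refine Continuous.add ?_ (by fun_prop)
      simp only [tQ]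
      have h1 : Continuous fun u => if 1 ≤ (n : ℕ) then p u z (n - 1) else 0 := by
        split_ifs <;> fun_prop
      have h2 : Continuous fun u => if (n : ℕ) < N then p u z n else 0 := by
        split_ifs <;> fun_prop
      fun_prop
    · simp only [G, tH]
      fun_prop
    · simp only [G, tE]
      have h1 : ∀ k : ℕ, Continuous fun u => tClamp (2 * (y u z - ((k : ℝ) + 2)) + 1) :=
        fun k => tClamp_cont.comp (by fun_prop)
      fun_prop
    · simp only [G]; fun_prop
    · simp only [G]; fun_prop
  let a : I → ℝ := fun i => match i with
    | Sum.inl _ => 0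
    | Sum.inr (Sum.inl _) => 0
    | Sum.inr (Sum.inr (Sum.inl _)) => 1
    | Sum.inr (Sum.inr (Sum.inr true)) => κ0
    | Sum.inr (Sum.inr (Sum.inr false)) => 0
  let b : I → ℝ := fun i => match i with
    | Sum.inl _ => 1
    | Sum.inr (Sum.inl _) => M
    | Sum.inr (Sum.inr (Sum.inl _)) => N + 1
    | Sum.inr (Sum.inr (Sum.inr true)) => κ1
    | Sum.inr (Sum.inr (Sum.inr false)) => M
  obtain ⟨u, hu, hvi⟩ := brw_box a b (by
    rintro (_ | _ | _ | (_ | _)) <;> simp [a, b, hM, hκ]) G hG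
  refine ⟨p u, V u, y u, κ u, W u, ?_, ?_, ?_, ?_, ?_, ?_, ?_, ?_, ?_, ?_, ?_, ?_, ?_⟩
  · intro z n
    simp only [p]
    split_ifs with h
    · exact hu (Sum.inl (z, ⟨n, h⟩))
    · simp
  · intro z n hn
    simp only [p]; rw [dif_neg (by omega)]
  · intro z n
    exact hu (Sum.inr (Sum.inl _))
  · intro z
    simp [V]
  · intro z n hn
    simp only [V]
    congr 5
    omega
  · intro z; exact hu (Sum.inr (Sum.inr (Sum.inl z)))
  · exact hu (Sum.inr (Sum.inr (Sum.inr true)))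
  · exact hu (Sum.inr (Sum.inr (Sum.inr false)))
  · intro z n hn
    have := hvi (Sum.inl (z, ⟨n, Nat.lt_succ_of_le hn⟩))
    have h2 : p u z n = u (Sum.inl (z, ⟨n, Nat.lt_succ_of_le hn⟩)) := by
      simp only [p]; rw [dif_pos]
    rw [← h2] at this
    exact this
  · intro z n hn
    have := hvi (Sum.inr (Sum.inl (z, ⟨n, Nat.lt_succ_of_le hn⟩)))
    have h2 : V u z n = u (Sum.inr (Sum.inl (z, ⟨n, Nat.lt_succ_of_le hn⟩))) := by
      simp only [V, min_eq_left hn]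
    rw [← h2] at this
    exact this
  · intro z; exact hvi (Sum.inr (Sum.inr (Sum.inl z)))
  · exact hvi (Sum.inr (Sum.inr (Sum.inr true)))
  · exact hvi (Sum.inr (Sum.inr (Sum.inr false)))


lemma tH_eq_zero [Fintype Z] [DecidableEq Z] (μ : Z → Z → ℝ)
    (hμ : ∀ z y : Z, z ≠ y → 0 < μ z y) (lam γ : ℝ) (hlam : 0 < lam)
    (hγ0 : 0 < γ) (hγ1 : γ < 1) (F : Z → ℕ → ℝ) (M κ W : ℝ) (hκ : 0 ≤ κ) (hW : 0 ≤ W ∧ W ≤ M)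
    (hF0 : ∀ z n, 0 ≤ F z n) (ξ V : Z → ℕ → ℝ) (hξ : ∀ z n, 0 ≤ ξ z n ∧ ξ z n ≤ 1)
    (hV : ∀ z n, 0 ≤ V z n ∧ V z n ≤ M) (z : Z) (n : ℕ) (hn : 1 ≤ n)
    (hFM : F z n ≤ (1 - γ) * M)
    (h1 : V z n < M → tH μ lam γ F κ W ξ V z n ≤ 0)
    (h2 : 0 < V z n → 0 ≤ tH μ lam γ F κ W ξ V z n) :
    tH μ lam γ F κ W ξ V z n = 0 := by
  have hn' : (1 : ℝ) ≤ n := by exact_mod_cast hn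
  have ha : 0 ≤ ((n : ℝ) - 1) * lam * (1 - γ * ξ z n) := by
    have : γ * ξ z n ≤ 1 := by nlinarith [hξ z n]
    exact mul_nonneg (mul_nonneg (by linarith) hlam.le) (by linarith)
  apply le_antisymm
  · rcases (hV z n).2.lt_or_eq with h | h
    · exact h1 h
    · unfold tH
      have e1 : max (V z n) W = M := by rw [h]; exact max_eq_left hW.2
      rw [e1, h]
      have t1 : lam * (F z n + γ * M - M) ≤ 0 :=
        mul_nonpos_of_nonneg_of_nonpos hlam.le (by linarith)
      have t2 : κ * (V z (n + 1) - M) ≤ 0 :=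
        mul_nonpos_of_nonneg_of_nonpos hκ (by linarith [(hV z (n+1)).2])
      have t3 : ∑ w ∈ Finset.univ.filter (fun w => w ≠ z), μ z w * (V w n - M) ≤ 0 := by
        refine Finset.sum_nonpos fun w hw => ?_
        have : w ≠ z := by simpa using hw
        exact mul_nonpos_of_nonneg_of_nonpos (hμ z w this.symm).le (by linarith [(hV w n).2])
      have t4 := mul_nonpos_of_nonneg_of_nonpos ha (b := V z (n - 1) - M)
        (by linarith [(hV z (n-1)).2])
      linarith
  · rcases (hV z n).1.lt_or_eq with h | h
    · exact h2 h
    · unfold tH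
      rw [← h]
      have e1 : 0 ≤ γ * max 0 W := by positivity
      have t1 : 0 ≤ lam * (F z n + γ * max 0 W - 0) :=
        mul_nonneg hlam.le (by linarith [hF0 z n])
      have t2 : 0 ≤ κ * (V z (n + 1) - 0) := mul_nonneg hκ (by linarith [(hV z (n+1)).1])
      have t3 : 0 ≤ ∑ w ∈ Finset.univ.filter (fun w => w ≠ z), μ z w * (V w n - 0) := by
        refine Finset.sum_nonneg fun w hw => ?_
        have : w ≠ z := by simpa using hw
        exact mul_nonneg (hμ z w this.symm).le (by linarith [(hV w n).1])
      have t4 := mul_nonneg ha (b := V z (n - 1) - 0) (by linarith [(hV z (n-1)).1])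
      linarith

lemma tV_antitone [Fintype Z] [DecidableEq Z] (μ : Z → Z → ℝ)
    (hμ : ∀ z y : Z, z ≠ y → 0 < μ z y) (lam γ : ℝ) (hlam : 0 < lam)
    (hγ0 : 0 < γ) (hγ1 : γ < 1) (F : Z → ℕ → ℝ) (N : ℕ) (κ W : ℝ) (hκ : 0 ≤ κ)
    (hdec : ∀ z : Z, ∀ n : ℕ, 1 ≤ n → F z (n + 1) ≤ F z n)
    (ξ V : Z → ℕ → ℝ) (hξ : ∀ z n, 0 ≤ ξ z n ∧ ξ z n ≤ 1) (hξa : ∀ z n, ξ z (n + 1) ≤ ξ z n)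
    (hVN : ∀ z n, N ≤ n → V z (n + 1) = V z n)
    (hH : ∀ z n, 1 ≤ n → n ≤ N → tH μ lam γ F κ W ξ V z n = 0) (z : Z) (n : ℕ) (hn : 1 ≤ n) :
    V z (n + 1) ≤ V z n := by
  by_contra! hlt
  have hnN : n < N := by
    by_contra! h
    rw [hVN z n h] at hlt
    exact lt_irrefl _ hlt
  obtain ⟨⟨x, m⟩, hm, hmin⟩ := Finset.exists_min_image
    ((Finset.univ : Finset Z) ×ˢ Finset.Icc 1 N) (fun q => V q.1 q.2 - V q.1 (q.2 + 1))
    ⟨(z, n), by simp; omega⟩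
  simp only [Finset.mem_product, Finset.mem_univ, true_and, Finset.mem_Icc] at hm hmin
  have hneg : V x m - V x (m + 1) < 0 := by
    have := hmin (z, n) ⟨hn, hnN.le⟩
    simp only at this
    linarith
  have hmN : m < N := by
    by_contra! h
    rw [hVN x m h] at hneg
    linarith
  have e1 := hH x m hm.1 hm.2
  have e2 := hH x (m + 1) (by omega) (by omega)
  unfold tH at e1 e2
  have hm' : (1 : ℝ) ≤ m := by exact_mod_cast hm.1
  -- sums
  have hs : ∑ w ∈ Finset.univ.filter (fun w => w ≠ x), μ x w * (V w m - V x m)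
      - ∑ w ∈ Finset.univ.filter (fun w => w ≠ x), μ x w * (V w (m + 1) - V x (m + 1)) ≥ 0 := by
    rw [← Finset.sum_sub_distrib]
    refine Finset.sum_nonneg fun w hw => ?_
    have hw' : w ≠ x := by simpa using hw
    have := hmin (w, m) ⟨hm.1, hm.2⟩
    simp only at this
    have := mul_nonneg (hμ x w hw'.symm).le
      (show 0 ≤ (V w m - V w (m + 1)) - (V x m - V x (m + 1)) by linarith)
    linarith
  have hk : κ * (V x (m + 1) - V x m) - κ * (V x (m + 1 + 1) - V x (m + 1)) ≥ 0 := by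
    have := hmin (x, m + 1) ⟨by omega, by omega⟩
    simp only at this
    have := mul_nonneg hκ (show 0 ≤ (V x (m+1) - V x (m+1+1)) - (V x m - V x (m + 1)) by linarith)
    linarith
  have hmax : max (V x m) W - max (V x (m + 1)) W ≥ V x m - V x (m + 1) := by
    rcases le_total (V x m) W with h1 | h1 <;> rcases le_total (V x (m + 1)) W with h2 | h2 <;>
      simp only [max_eq_left, max_eq_right, h1, h2] <;> linarith
  have hl : lam * (F x m + γ * max (V x m) W - V x m)
      - lam * (F x (m + 1) + γ * max (V x (m + 1)) W - V x (m + 1)) > 0 := by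
    have h1 := hdec x m hm.1
    have h2 : γ * (max (V x m) W - max (V x (m + 1)) W) ≥ γ * (V x m - V x (m + 1)) :=
      mul_le_mul_of_nonneg_left hmax hγ0.le
    have h3 : 0 < (1 - γ) * -(V x m - V x (m + 1)) := mul_pos (by linarith) (by linarith)
    have := mul_pos hlam (show 0 < (F x m + γ * max (V x m) W - V x m)
      - (F x (m + 1) + γ * max (V x (m + 1)) W - V x (m + 1)) by linarith)
    linarith
  have hb : ((m : ℝ) - 1) * lam * (1 - γ * ξ x m) * (V x (m - 1) - V x m)
      - ((((m + 1 : ℕ)) : ℝ) - 1) * lam * (1 - γ * ξ x (m + 1)) * (V x (m + 1 - 1) - V x (m + 1))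
      ≥ 0 := by
    set a1 := ((m : ℝ) - 1) * lam * (1 - γ * ξ x m) with ha1
    set a2 := ((((m + 1 : ℕ)) : ℝ) - 1) * lam * (1 - γ * ξ x (m + 1)) with ha2
    have hg1 : γ * ξ x m ≤ 1 := by nlinarith [hξ x m]
    have hg2 : γ * ξ x (m + 1) ≤ γ * ξ x m := mul_le_mul_of_nonneg_left (hξa x m) hγ0.le
    have ha10 : 0 ≤ a1 := mul_nonneg (mul_nonneg (by linarith) hlam.le) (by linarith)
    have ha12 : a1 ≤ a2 := by
      rw [ha1, ha2]
      push_cast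
      apply mul_le_mul _ (by linarith) (by linarith) (mul_nonneg (by linarith) hlam.le)
      exact mul_le_mul_of_nonneg_right (by linarith) hlam.le
    rw [Nat.add_sub_cancel]
    have h3 : 0 ≤ a1 * ((V x (m - 1) - V x m) - (V x m - V x (m + 1))) := by
      rcases hm.1.eq_or_lt with h | h
      · have : a1 = 0 := by rw [ha1, ← h]; simp
        rw [this]; simp
      · have := hmin (x, m - 1) ⟨by omega, by omega⟩
        simp only [Nat.sub_add_cancel hm.1] at this
        exact mul_nonneg ha10 (by linarith)
    have h4 : 0 ≤ (a2 - a1) * -(V x m - V x (m + 1)) := mul_nonneg (by linarith) (by linarith)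
    linarith
  linarith

lemma t_sum_D (f : ℕ → ℝ) (n : ℕ) :
    ∑ k ∈ Finset.range n, (f (k + 1) - f (k + 2)) = f 1 - f (n + 1) := by
  have := Finset.sum_range_sub' (fun k => f (k + 1)) n
  simpa using this

lemma t_opt (N : ℕ) (W : ℝ) (V : Z → ℕ → ℝ) (y : Z → ℝ) (z : Z)
    (hVa : ∀ n, 1 ≤ n → V z (n + 1) ≤ V z n)
    (h1 : y z < N + 1 → tE N W V y z ≤ 0) (h2 : 1 < y z → 0 ≤ tE N W V y z)
    (n : ℕ) (hn : 1 ≤ n) (hnN : n ≤ N) :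
    (W < V z n → tXi y z n = 1) ∧ (V z n < W → tXi y z n = 0) := by
  obtain ⟨j, rfl⟩ : ∃ j, n = j + 1 := ⟨n - 1, by omega⟩
  have hsub : Finset.range j ⊆ Finset.range N := Finset.range_subset_range.2 (by omega)
  have hnN' : ((j + 1 : ℕ) : ℝ) ≤ N := by exact_mod_cast hnN
  have hn' : (1 : ℝ) ≤ ((j + 1 : ℕ) : ℝ) := by exact_mod_cast hn
  push_cast at hnN' hn'
  have hD : ∀ k : ℕ, 0 ≤ V z (k + 1) - V z (k + 2) := fun k => by
    linarith [hVa (k + 1) (by omega)]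
  constructor
  · intro hW
    by_contra hne
    have hy : y z < (j + 1 : ℝ) + 1 / 2 := by
      by_contra! h
      exact hne (tClamp_eq_one (by push_cast; linarith))
    have hE := h1 (by linarith)
    unfold tE at hE
    have : ∑ k ∈ Finset.range N,
        tClamp (2 * (y z - ((k : ℝ) + 2)) + 1) * (V z (k + 1) - V z (k + 2))
        ≤ ∑ k ∈ Finset.range j, (V z (k + 1) - V z (k + 2)) := by
      rw [← Finset.sum_subset hsub (f := fun k : ℕ =>
        tClamp (2 * (y z - ((k : ℝ) + 2)) + 1) * (V z (k + 1) - V z (k + 2)))]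
      · exact Finset.sum_le_sum fun k _ => mul_le_of_le_one_left (hD k) (tClamp_le_one _)
      · intro k _ hk
        have hk' : (j : ℝ) ≤ k := by exact_mod_cast (by simpa using hk : j ≤ k)
        rw [tClamp_eq_zero (by linarith), zero_mul]
    rw [t_sum_D (V z) j] at this
    linarith
  · intro hW
    by_contra hne
    have hy : (j + 1 : ℝ) < y z := by
      by_contra! h
      exact hne (tClamp_eq_zero (by push_cast; linarith))
    have hE := h2 (by linarith)
    unfold tE at hE
    have : ∑ k ∈ Finset.range j, (V z (k + 1) - V z (k + 2)) ≤ ∑ k ∈ Finset.range N,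
        tClamp (2 * (y z - ((k : ℝ) + 2)) + 1) * (V z (k + 1) - V z (k + 2)) := by
      calc _ = ∑ k ∈ Finset.range j,
          tClamp (2 * (y z - ((k : ℝ) + 2)) + 1) * (V z (k + 1) - V z (k + 2)) := by
            refine Finset.sum_congr rfl fun k hk => ?_
            have hk' : (k : ℝ) + 1 ≤ j := by exact_mod_cast (by simpa using hk : k < j)
            rw [tClamp_eq_one (by linarith), one_mul]
        _ ≤ _ := Finset.sum_le_sum_of_subset_of_nonneg hsub
            fun k _ _ => mul_nonneg (tClamp_nonneg _) (hD k)
    rw [t_sum_D (V z) j] at this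
    linarith

/-- total population mass at level `m`, and total departure flow -/
noncomputable def tP [Fintype Z] (p : Z → ℕ → ℝ) (m : ℕ) : ℝ := ∑ x : Z, p x m
noncomputable def tR [Fintype Z] (lam γ : ℝ) (ξ p : Z → ℕ → ℝ) (m : ℕ) : ℝ :=
  ∑ x : Z, lam * m * (1 - γ * ξ x m) * p x m

lemma tQ_sum [Fintype Z] [DecidableEq Z] (μ : Z → Z → ℝ) (lam γ : ℝ) (N : ℕ)
    (κ : ℝ) (ξ p : Z → ℕ → ℝ) (m : ℕ) :
    ∑ x, tQ μ lam γ N κ ξ p x m = κ * ((if 1 ≤ m then tP p (m - 1) else 0)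
      - (if m < N then tP p m else 0)) + tR lam γ ξ p (m + 1) - tR lam γ ξ p m := by
  unfold tQ tP tR
  have hmu : ∑ x : Z, ((∑ z ∈ Finset.univ.filter (fun z => z ≠ x), p z m * μ z x)
    - p x m * (∑ y ∈ Finset.univ.filter (fun y => y ≠ x), μ x y)) = 0 := by
    rw [Finset.sum_sub_distrib, sub_eq_zero]
    simp only [Finset.sum_filter, Finset.mul_sum]
    rw [Finset.sum_comm]
    refine Finset.sum_congr rfl fun x _ => Finset.sum_congr rfl fun y _ => ?_
    by_cases h : x = y
    · simp [h]
    · simp [h, Ne.symm h]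
  rw [Finset.sum_sub_distrib, Finset.sum_add_distrib, Finset.sum_add_distrib, hmu, zero_add,
    ← Finset.mul_sum, Finset.sum_sub_distrib]
  push_cast
  split_ifs <;> simp

lemma tQ_sum_range [Fintype Z] [DecidableEq Z] (μ : Z → Z → ℝ) (lam γ : ℝ) (N : ℕ)
    (κ : ℝ) (ξ p : Z → ℕ → ℝ) (k : ℕ) (hk : k ≤ N) :
    ∑ m ∈ Finset.range (k + 1), ∑ x, tQ μ lam γ N κ ξ p x m
      = tR lam γ ξ p (k + 1) - κ * (if k < N then tP p k else 0) := by
  induction k with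
  | zero =>
    have h0 : tR lam γ ξ p 0 = 0 := by simp [tR]
    rw [zero_add, Finset.sum_range_one, tQ_sum, h0]
    rw [if_neg (show ¬ (1 ≤ 0) by omega)]
    ring
  | succ k ih =>
    rw [Finset.sum_range_succ, ih (by omega), tQ_sum, if_pos (show k < N by omega),
      if_pos (show 1 ≤ k + 1 by omega), Nat.add_sub_cancel]
    ring

lemma t_prob [Fintype Z] [DecidableEq Z] [Nonempty Z] (μ : Z → Z → ℝ)
    (hμ : ∀ z y : Z, z ≠ y → 0 < μ z y) (lam γ : ℝ) (hlam : 0 < lam)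
    (hγ0 : 0 < γ) (hγ1 : γ < 1) (N : ℕ) (κ : ℝ) (hκ : 0 ≤ κ)
    (ξ p : Z → ℕ → ℝ) (hξ : ∀ z n, 0 ≤ ξ z n ∧ ξ z n ≤ 1)
    (hp : ∀ z n, 0 ≤ p z n ∧ p z n ≤ 1) (hpN : ∀ z n, N < n → p z n = 0)
    (hvi : ∀ z n, n ≤ N →
        (p z n < 1 → tQ μ lam γ N κ ξ p z n + (max (1 - tTot N p) 0
          + min (1 - tTot N p) 0 * p z n) ≤ 0) ∧
        (0 < p z n → 0 ≤ tQ μ lam γ N κ ξ p z n + (max (1 - tTot N p) 0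
          + min (1 - tTot N p) 0 * p z n))) :
    tTot N p = 1 ∧ ∀ z n, n ≤ N → tQ μ lam γ N κ ξ p z n = 0 := by
  have hdr : ∀ z n, 0 ≤ 1 - γ * ξ z n := fun z n => by nlinarith [hξ z n]
  have hG : ∀ z n, n ≤ N → 0 ≤ tQ μ lam γ N κ ξ p z n + (max (1 - tTot N p) 0
          + min (1 - tTot N p) 0 * p z n) := by
    intro z n hn
    rcases (hp z n).1.lt_or_eq with h | h
    · exact (hvi z n hn).2 h
    · rw [← h, mul_zero, add_zero]
      refine add_nonneg ?_ (le_max_right _ _)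
      unfold tQ
      rw [← h]
      have t1 : 0 ≤ ∑ w ∈ Finset.univ.filter (fun w => w ≠ z), p w n * μ w z := by
        refine Finset.sum_nonneg fun w hw => ?_
        have hw' : w ≠ z := by simpa using hw
        exact mul_nonneg (hp w n).1 (hμ w z hw').le
      have t2 : 0 ≤ κ * ((if 1 ≤ n then p z (n - 1) else 0) - (if n < N then 0 else 0)) := by
        refine mul_nonneg hκ ?_
        rw [ite_self, sub_zero]
        split_ifs
        · exact (hp _ _).1
        · exact le_rfl
      have t3 : 0 ≤ lam * (n + 1) * (1 - γ * ξ z (n + 1)) * p z (n + 1) :=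
        mul_nonneg (mul_nonneg (by positivity) (hdr _ _)) (hp _ _).1
      linarith
  have hS : ∑ m ∈ Finset.range (N + 1), ∑ x, tQ μ lam γ N κ ξ p x m = 0 := by
    rw [tQ_sum_range μ lam γ N κ ξ p N le_rfl]
    have : tR lam γ ξ p (N + 1) = 0 :=
      Finset.sum_eq_zero fun x _ => by rw [hpN x (N + 1) (by omega), mul_zero]
    simp [this]
  have hsumG : ∑ m ∈ Finset.range (N + 1), ∑ x, (tQ μ lam γ N κ ξ p x m + (max (1 - tTot N p) 0
          + min (1 - tTot N p) 0 * p x m)) = ((N : ℝ) + 1) * (Fintype.card Z) * max (1 - tTot N p) 0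
          + min (1 - tTot N p) 0 * tTot N p := by
    simp_rw [Finset.sum_add_distrib]
    rw [hS, zero_add]
    congr 1
    · simp; ring
    · simp_rw [← Finset.mul_sum]; rfl
  have htot : tTot N p = 1 := by
    rcases lt_trichotomy (tTot N p) 1 with h | h | h
    · exfalso
      have hle : ∀ z n, n ≤ N → p z n ≤ tTot N p := by
        intro z n hn
        calc p z n ≤ ∑ x, p x n := Finset.single_le_sum (fun x _ => (hp x n).1) (Finset.mem_univ z)
          _ ≤ _ := Finset.single_le_sum (f := fun m => ∑ x, p x m)
              (fun m _ => Finset.sum_nonneg fun x _ => (hp x m).1)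
              (Finset.mem_range.2 (Nat.lt_succ_of_le hn))
      have h1 : ∑ m ∈ Finset.range (N + 1), ∑ x, (tQ μ lam γ N κ ξ p x m + (max (1 - tTot N p) 0
          + min (1 - tTot N p) 0 * p x m)) ≤ 0 := by
        refine Finset.sum_nonpos fun m hm => Finset.sum_nonpos fun x _ => ?_
        have hm' : m ≤ N := by have := Finset.mem_range.1 hm; omega
        exact (hvi x m hm').1 (lt_of_le_of_lt (hle x m hm') h)
      rw [hsumG, max_eq_left (by linarith), min_eq_right (by linarith), zero_mul, add_zero] at h1
      have hc : (0 : ℝ) < Fintype.card Z := by exact_mod_cast Fintype.card_pos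
      have : 0 < ((N : ℝ) + 1) * (Fintype.card Z) * (1 - tTot N p) :=
        mul_pos (by positivity) (by linarith)
      linarith
    · exact h
    · exfalso
      have h1 : 0 ≤ ∑ m ∈ Finset.range (N + 1), ∑ x, (tQ μ lam γ N κ ξ p x m
          + (max (1 - tTot N p) 0 + min (1 - tTot N p) 0 * p x m)) := by
        refine Finset.sum_nonneg fun m hm => Finset.sum_nonneg fun x _ => ?_
        have hm' : m ≤ N := by have := Finset.mem_range.1 hm; omega
        exact hG x m hm'
      rw [hsumG, max_eq_right (by linarith), min_eq_left (by linarith)] at h1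
      nlinarith
  refine ⟨htot, ?_⟩
  have hG' : ∀ z n, n ≤ N → 0 ≤ tQ μ lam γ N κ ξ p z n := by
    intro z n hn
    have := hG z n hn
    simpa [htot] using this
  intro z n hn
  have h1 := (Finset.sum_eq_zero_iff_of_nonneg (fun m hm => Finset.sum_nonneg fun x _ =>
    hG' x m (by have := Finset.mem_range.1 hm; omega))).1 hS n
    (Finset.mem_range.2 (Nat.lt_succ_of_le hn))
  exact (Finset.sum_eq_zero_iff_of_nonneg (fun x _ => hG' x n hn)).1 h1 z (Finset.mem_univ z)


lemma t_density [Fintype Z] [DecidableEq Z] (μ : Z → Z → ℝ) (lam γ β : ℝ) (hlam : 0 < lam)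
    (hγ0 : 0 < γ) (hγ1 : γ < 1) (hβ : 0 < β) (N : ℕ) (hN : 2 * β < N) (κ : ℝ)
    (hκ : lam * (1 - γ) * β ≤ κ ∧ κ ≤ 2 * lam * β)
    (ξ p : Z → ℕ → ℝ) (hξ : ∀ z n, 0 ≤ ξ z n ∧ ξ z n ≤ 1)
    (hp : ∀ z n, 0 ≤ p z n) (hpN : ∀ z n, N < n → p z n = 0)
    (htot : tTot N p = 1) (hQ : ∀ z n, n ≤ N → tQ μ lam γ N κ ξ p z n = 0)
    (hv1 : κ < 2 * lam * β → β - ∑ m ∈ Finset.range (N + 1), ∑ z : Z, (m : ℝ) * p z m ≤ 0)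
    (hv2 : lam * (1 - γ) * β < κ →
      0 ≤ β - ∑ m ∈ Finset.range (N + 1), ∑ z : Z, (m : ℝ) * p z m) :
    ∑ m ∈ Finset.range (N + 1), ∑ z : Z, (m : ℝ) * p z m = β ∧
    ∀ m, tP p m ≤ (2 * β / (1 - γ)) ^ m / (m.factorial : ℝ) := by
  have hγ' : 0 < 1 - γ := by linarith
  have hκ0 : 0 < κ := lt_of_lt_of_le (by positivity) hκ.1
  have hP0 : ∀ m, 0 ≤ tP p m := fun m => Finset.sum_nonneg fun x _ => hp x m
  have hcut : ∀ m, m < N → κ * tP p m = tR lam γ ξ p (m + 1) := by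
    intro m hm
    have h1 := tQ_sum_range μ lam γ N κ ξ p m hm.le
    rw [if_pos hm] at h1
    have h2 : ∑ m ∈ Finset.range (m + 1), ∑ x, tQ μ lam γ N κ ξ p x m = 0 :=
      Finset.sum_eq_zero fun k hk => Finset.sum_eq_zero fun x _ =>
        hQ x k (by have := Finset.mem_range.1 hk; omega)
    linarith
  have hRl : ∀ m : ℕ, lam * (1 - γ) * (m * tP p m) ≤ tR lam γ ξ p m := by
    intro m
    unfold tP tR
    rw [Finset.mul_sum, Finset.mul_sum]
    refine Finset.sum_le_sum fun x _ => ?_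
    have h1 : 1 - γ ≤ 1 - γ * ξ x m := by nlinarith [hξ x m]
    have h2 : 0 ≤ lam * m * p x m := mul_nonneg (by positivity) (hp x m)
    nlinarith [mul_le_mul_of_nonneg_left h1 h2]
  have hRu : ∀ m : ℕ, tR lam γ ξ p m ≤ lam * (m * tP p m) := by
    intro m
    unfold tP tR
    rw [Finset.mul_sum, Finset.mul_sum]
    refine Finset.sum_le_sum fun x _ => ?_
    have h1 : 1 - γ * ξ x m ≤ 1 := by nlinarith [hξ x m]
    have h2 : 0 ≤ lam * m * p x m := mul_nonneg (by positivity) (hp x m)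
    nlinarith [mul_le_mul_of_nonneg_left h1 h2]
  have hA : ∑ m ∈ Finset.range (N + 1), ∑ z : Z, (m : ℝ) * p z m
      = ∑ m ∈ Finset.range (N + 1), (m : ℝ) * tP p m := by
    simp only [tP, Finset.mul_sum]
  rw [hA] at hv1 hv2 ⊢
  set A := ∑ m ∈ Finset.range (N + 1), (m : ℝ) * tP p m with hAdef
  have hA' : A = ∑ m ∈ Finset.range N, ((m + 1 : ℕ) : ℝ) * tP p (m + 1) := by
    rw [hAdef, Finset.sum_range_succ']; simp
  have hsumP : ∑ m ∈ Finset.range N, tP p m = 1 - tP p N := by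
    have : tTot N p = ∑ m ∈ Finset.range (N + 1), tP p m := rfl
    rw [htot, Finset.sum_range_succ] at this
    linarith
  have hflow : κ * (1 - tP p N) = ∑ m ∈ Finset.range N, tR lam γ ξ p (m + 1) := by
    rw [← hsumP, Finset.mul_sum]
    exact Finset.sum_congr rfl fun m hm => hcut m (Finset.mem_range.1 hm)
  have hlo : lam * (1 - γ) * A ≤ κ * (1 - tP p N) := by
    rw [hflow, hA', Finset.mul_sum]
    exact Finset.sum_le_sum fun m _ => hRl (m + 1)
  have hup : κ * (1 - tP p N) ≤ lam * A := by
    rw [hflow, hA', Finset.mul_sum]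
    exact Finset.sum_le_sum fun m _ => hRu (m + 1)
  have hNP : (N : ℝ) * tP p N ≤ A :=
    Finset.single_le_sum (f := fun m : ℕ => (m : ℝ) * tP p m)
      (fun m _ => mul_nonneg (Nat.cast_nonneg m) (hP0 m)) (Finset.mem_range.2 (Nat.lt_succ_self N))
  constructor
  · rcases lt_trichotomy A β with h | h | h
    · exfalso
      have hk : κ = 2 * lam * β := by
        rcases hκ.2.lt_or_eq with h' | h'
        · have := hv1 h'; linarith
        · exact h'
      rw [hk] at hup
      have h3 : 2 * β * (1 - tP p N) ≤ A := by
        have : lam * (2 * β * (1 - tP p N)) ≤ lam * A := by linarith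
        exact le_of_mul_le_mul_left this hlam
      have h4 : 1 / 2 < tP p N := by
        by_contra! hc
        nlinarith
      nlinarith
    · exact h
    · exfalso
      have hk : κ = lam * (1 - γ) * β := by
        rcases hκ.1.lt_or_eq with h' | h'
        · have := hv2 h'; linarith
        · exact h'.symm
      have hc : 0 < lam * (1 - γ) := by positivity
      have h5 : κ * (1 - tP p N) ≤ κ := by nlinarith [hP0 N]
      have : lam * (1 - γ) * A ≤ lam * (1 - γ) * β := by linarith
      have := le_of_mul_le_mul_left this hc
      linarith
  · intro m
    induction m with
    | zero =>
      have : tP p 0 ≤ ∑ m ∈ Finset.range (N + 1), tP p m :=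
        Finset.single_le_sum (fun m _ => hP0 m) (Finset.mem_range.2 (Nat.succ_pos N))
      have h2 : tTot N p = ∑ m ∈ Finset.range (N + 1), tP p m := rfl
      simp; linarith
    | succ m ih =>
      by_cases hm : m < N
      · have h1 := hRl (m + 1)
        rw [← hcut m hm] at h1
        have h2 : κ * tP p m ≤ 2 * lam * β * tP p m := mul_le_mul_of_nonneg_right hκ.2 (hP0 m)
        have h3 : (1 - γ) * (((m + 1 : ℕ) : ℝ) * tP p (m + 1)) ≤ 2 * β * tP p m := by
          have : lam * ((1 - γ) * (((m + 1 : ℕ) : ℝ) * tP p (m + 1))) ≤ lam * (2 * β * tP p m) := by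
            linarith
          exact le_of_mul_le_mul_left this hlam
        have hm1 : (0 : ℝ) < ((m + 1 : ℕ) : ℝ) := by positivity
        have h4 : tP p (m + 1) ≤ (2 * β / (1 - γ)) / ((m + 1 : ℕ) : ℝ) * tP p m := by
          rw [div_div, div_mul_eq_mul_div, le_div_iff₀ (by positivity)]
          linarith
        refine h4.trans ((mul_le_mul_of_nonneg_left ih (by positivity)).trans (le_of_eq ?_))
        rw [Nat.factorial_succ, pow_succ]
        push_cast
        field_simp
      · have : tP p (m + 1) = 0 := Finset.sum_eq_zero fun x _ => hpN x _ (by omega)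
        rw [this]; positivity

lemma t_exists [Fintype Z] [DecidableEq Z] [Nonempty Z] (μ : Z → Z → ℝ)
    (hμ : ∀ z y : Z, z ≠ y → 0 < μ z y) (lam γ β : ℝ) (hlam : 0 < lam)
    (hγ0 : 0 < γ) (hγ1 : γ < 1) (hβ : 0 < β) (F : Z → ℕ → ℝ) (hF0 : ∀ z n, 0 ≤ F z n)
    (hdec : ∀ z : Z, ∀ n : ℕ, 1 ≤ n → F z (n + 1) ≤ F z n)
    (M : ℝ) (hM : 0 ≤ M) (hFM : ∀ z n, 1 ≤ n → F z n ≤ (1 - γ) * M)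
    (N : ℕ) (hN : 2 * β < N) :
    ∃ (ξ V p : Z → ℕ → ℝ) (κ W : ℝ),
      (∀ z n, 0 ≤ ξ z n ∧ ξ z n ≤ 1) ∧ (∀ z, ξ z 0 = 1) ∧ (∀ z n, ξ z (n + 1) ≤ ξ z n) ∧
      (∀ z n, (1 - ξ z n) * ξ z (n + 1) = 0) ∧
      (∀ z n, 0 ≤ V z n ∧ V z n ≤ M) ∧ (∀ z n, 1 ≤ n → V z (n + 1) ≤ V z n) ∧
      (∀ z n, 0 ≤ p z n ∧ p z n ≤ 1) ∧ (lam * (1 - γ) * β ≤ κ ∧ κ ≤ 2 * lam * β) ∧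
      (0 ≤ W ∧ W ≤ M) ∧
      (∀ z n, n < N → tQ μ lam γ (n + 1) κ ξ p z n = 0) ∧
      (∀ z n, 1 ≤ n → n ≤ N → tH μ lam γ F κ W ξ V z n = 0) ∧
      (∀ z n, 1 ≤ n → n ≤ N → (W < V z n → ξ z n = 1) ∧ (V z n < W → ξ z n = 0)) ∧
      (∀ z n, p z n ≤ (2 * β / (1 - γ)) ^ n / (n.factorial : ℝ)) ∧
      (∑' q : Z × ℕ, p q.1 q.2 = 1) ∧ (∑' q : Z × ℕ, (q.2 : ℝ) * p q.1 q.2 = β) ∧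
      (∑' q : Z × ℕ, p q.1 q.2 * V q.1 (q.2 + 1) = W) := by
  have hγ' : 0 < 1 - γ := by linarith
  obtain ⟨p, V, y, κ, W, hp, hpN, hV, -, hVN, hy, hκ, hW, vp, vV, vy, vκ, vW⟩ :=
    t_core μ lam γ β F N M (lam * (1 - γ) * β) (2 * lam * β) hM (by
      have := mul_pos hlam hβ
      nlinarith)
  have hκ0 : 0 < κ := lt_of_lt_of_le (by positivity) hκ.1
  have hξ : ∀ z n, 0 ≤ tXi y z n ∧ tXi y z n ≤ 1 := fun z n =>
    ⟨tClamp_nonneg _, tClamp_le_one _⟩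
  have hξa : ∀ z n, tXi y z (n + 1) ≤ tXi y z n := fun z n =>
    tClamp_mono (by push_cast; linarith)
  obtain ⟨htot, hQ⟩ := t_prob μ hμ lam γ hlam hγ0 hγ1 N κ hκ0.le (tXi y) p hξ hp hpN vp
  obtain ⟨hden, htail⟩ := t_density μ lam γ β hlam hγ0 hγ1 hβ N hN κ hκ (tXi y) p hξ
    (fun z n => (hp z n).1) hpN htot hQ vκ.1 vκ.2
  have hH : ∀ z n, 1 ≤ n → n ≤ N → tH μ lam γ F κ W (tXi y) V z n = 0 := fun z n h1 h2 =>
    tH_eq_zero μ hμ lam γ hlam hγ0 hγ1 F M κ W hκ0.le hW hF0 (tXi y) V hξ hV z n h1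
      (hFM z n h1) (vV z n h2).1 (vV z n h2).2
  have hVa := tV_antitone μ hμ lam γ hlam hγ0 hγ1 F N κ W hκ0.le hdec (tXi y) V hξ hξa hVN hH
  have htsum : ∀ f : Z → ℕ → ℝ, (∀ z n, N < n → f z n = 0) →
      ∑' q : Z × ℕ, f q.1 q.2 = ∑ m ∈ Finset.range (N + 1), ∑ z : Z, f z m := by
    intro f hf
    rw [tsum_eq_sum (s := (Finset.univ : Finset Z) ×ˢ Finset.range (N + 1))]
    · rw [Finset.sum_product_right]
    · rintro ⟨z, n⟩ hq
      apply hf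
      simpa using hq
  have hsumV : ∑ m ∈ Finset.range (N + 1), ∑ z : Z, p z m * V z (m + 1) = W := by
    have hle : ∑ m ∈ Finset.range (N + 1), ∑ z : Z, p z m * V z (m + 1) ≤ M := by
      calc _ ≤ ∑ m ∈ Finset.range (N + 1), ∑ z : Z, p z m * M :=
            Finset.sum_le_sum fun m _ => Finset.sum_le_sum fun z _ =>
              mul_le_mul_of_nonneg_left (hV z _).2 (hp z m).1
        _ = tTot N p * M := by simp only [tTot, Finset.sum_mul]
        _ = M := by rw [htot, one_mul]
    have hge : 0 ≤ ∑ m ∈ Finset.range (N + 1), ∑ z : Z, p z m * V z (m + 1) :=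
      Finset.sum_nonneg fun m _ => Finset.sum_nonneg fun z _ => mul_nonneg (hp z m).1 (hV z _).1
    apply le_antisymm
    · rcases hW.2.lt_or_eq with h | h
      · linarith [vW.1 h]
      · linarith
    · rcases hW.1.lt_or_eq with h | h
      · linarith [vW.2 h]
      · linarith
  refine ⟨tXi y, V, p, κ, W, hξ, ?_, hξa, ?_, hV, hVa, hp, hκ, hW, ?_, hH, ?_, ?_, ?_, ?_, ?_⟩
  · intro z
    exact tClamp_eq_one (by have := (hy z).1; push_cast; linarith)
  · intro z n
    rcases le_total (y z) ((n : ℝ) + 1) with h | h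
    · have : tXi y z (n + 1) = 0 := tClamp_eq_zero (by push_cast; linarith)
      rw [this, mul_zero]
    · have : tXi y z n = 1 := tClamp_eq_one (by linarith)
      rw [this]; ring
  · intro z n hn
    have := hQ z n hn.le
    unfold tQ at this ⊢
    rw [if_pos hn] at this
    rw [if_pos (Nat.lt_succ_self n)]
    exact this
  · intro z n h1 h2
    exact t_opt N W V y z (hVa z) (vy z).1 (vy z).2 n h1 h2
  · intro z n
    exact (Finset.single_le_sum (f := fun x => p x n) (fun x _ => (hp x n).1)
      (Finset.mem_univ z)).trans (htail n)
  · rw [htsum p hpN]; exact htot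
  · rw [htsum (fun z n => (n : ℝ) * p z n) (fun z n h => by simp [hpN z n h])]; exact hden
  · rw [htsum (fun z n => p z n * V z (n + 1)) (fun z n h => by simp [hpN z n h])]; exact hsumV

/-! ### The limit of the truncated models -/

lemma l_ultra (a : ℕ → ℝ) (c d : ℝ) (h : ∀ k, c ≤ a k ∧ a k ≤ d) :
    ∃ l, (c ≤ l ∧ l ≤ d) ∧ Tendsto a (hyperfilter ℕ : Filter ℕ) (𝓝 l) := by
  have hc : IsCompact (Icc c d) := isCompact_Icc
  have hle : ((hyperfilter ℕ).map a : Filter ℝ) ≤ 𝓟 (Icc c d) := by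
    rw [le_principal_iff]
    exact Filter.univ_mem' (f := (hyperfilter ℕ : Filter ℕ)) h
  obtain ⟨l, hl, hl'⟩ := hc.ultrafilter_le_nhds _ hle
  exact ⟨l, hl, hl'⟩

lemma l_exists [Fintype Z] [DecidableEq Z] [Nonempty Z] (μ : Z → Z → ℝ)
    (hμ : ∀ z y : Z, z ≠ y → 0 < μ z y) (lam γ β : ℝ) (hlam : 0 < lam)
    (hγ0 : 0 < γ) (hγ1 : γ < 1) (hβ : 0 < β) (F : Z → ℕ → ℝ) (hF0 : ∀ z n, 0 ≤ F z n)
    (hdec : ∀ z : Z, ∀ n : ℕ, 1 ≤ n → F z (n + 1) ≤ F z n)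
    (M : ℝ) (hM : 0 ≤ M) (hFM : ∀ z n, 1 ≤ n → F z n ≤ (1 - γ) * M) :
    ∃ (ξ V p : Z → ℕ → ℝ) (κ W : ℝ),
      (∀ z n, 0 ≤ ξ z n ∧ ξ z n ≤ 1) ∧ (∀ z, ξ z 0 = 1) ∧ (∀ z n, ξ z (n + 1) ≤ ξ z n) ∧
      (∀ z n, (1 - ξ z n) * ξ z (n + 1) = 0) ∧
      (∀ z n, 0 ≤ V z n ∧ V z n ≤ M) ∧ (∀ z n, 1 ≤ n → V z (n + 1) ≤ V z n) ∧
      (∀ z n, 0 ≤ p z n ∧ p z n ≤ 1) ∧ (lam * (1 - γ) * β ≤ κ ∧ κ ≤ 2 * lam * β) ∧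
      (0 ≤ W ∧ W ≤ M) ∧
      (∀ z n, tQ μ lam γ (n + 1) κ ξ p z n = 0) ∧
      (∀ z n, 1 ≤ n → tH μ lam γ F κ W ξ V z n = 0) ∧
      (∀ z n, 1 ≤ n → (W < V z n → ξ z n = 1) ∧ (V z n < W → ξ z n = 0)) ∧
      (Summable fun q : Z × ℕ => p q.1 q.2) ∧
      (Summable fun q : Z × ℕ => p q.1 q.2 * V q.1 (q.2 + 1)) ∧
      (∑' q : Z × ℕ, p q.1 q.2 = 1) ∧ (∑' q : Z × ℕ, (q.2 : ℝ) * p q.1 q.2 = β) ∧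
      (∑' q : Z × ℕ, p q.1 q.2 * V q.1 (q.2 + 1) = W) := by
  have hγ' : 0 < 1 - γ := by linarith
  obtain ⟨N0, hN0⟩ := exists_nat_gt (2 * β)
  have hN : ∀ k : ℕ, 2 * β < ((N0 + k : ℕ) : ℝ) := by
    intro k; push_cast
    have : (0:ℝ) ≤ k := Nat.cast_nonneg k
    linarith
  have hex := fun k : ℕ => t_exists μ hμ lam γ β hlam hγ0 hγ1 hβ F hF0 hdec M hM hFM
    (N0 + k) (hN k)
  choose ξs Vs ps κs Ws h1 h2 h3 h4 h5 h6 h7 h8 h9 h10 h11 h12 h13 h14 h15 h16 using hex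
  choose ξ hξ tξ using fun z n => l_ultra (fun k => ξs k z n) 0 1 (fun k => h1 k z n)
  choose V hV tV using fun z n => l_ultra (fun k => Vs k z n) 0 M (fun k => h5 k z n)
  choose p hp tp using fun z n => l_ultra (fun k => ps k z n) 0 1 (fun k => h7 k z n)
  obtain ⟨κ, hκ, tκ⟩ := l_ultra κs _ _ h8
  obtain ⟨W, hW, tW⟩ := l_ultra Ws _ _ h9
  set ℓ : Filter ℕ := (hyperfilter ℕ : Filter ℕ) with hℓ
  have hle : ℓ ≤ atTop := Nat.hyperfilter_le_atTop
  have hev : ∀ n : ℕ, ∀ᶠ k in ℓ, n ≤ k := fun n => hle (eventually_ge_atTop n)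
  set ρ : ℝ := 2 * β / (1 - γ) with hρ
  have hρ0 : 0 ≤ ρ := by positivity
  have hb1 : Summable fun n : ℕ => ρ ^ n / (n.factorial : ℝ) := Real.summable_pow_div_factorial ρ
  have hb2 : Summable fun n : ℕ => (n : ℝ) * (ρ ^ n / (n.factorial : ℝ)) := by
    rw [← summable_nat_add_iff 1]
    refine (hb1.mul_left ρ).congr fun n => ?_
    rw [Nat.factorial_succ]
    push_cast
    have : (n.factorial : ℝ) ≠ 0 := by exact_mod_cast n.factorial_ne_zero
    have : (n : ℝ) + 1 ≠ 0 := by positivity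
    field_simp
    ring
  have hlift : ∀ f : ℕ → ℝ, Summable f → (∀ n, 0 ≤ f n) → Summable fun q : Z × ℕ => f q.2 := by
    intro f hf hf0
    rw [summable_prod_of_nonneg (fun q => hf0 q.2)]
    exact ⟨fun _ => hf, (hasSum_fintype _).summable⟩
  have hB0 : ∀ n : ℕ, 0 ≤ ρ ^ n / (n.factorial : ℝ) := fun n => by positivity
  have hB1 := hlift _ hb1 hB0
  have hB2 := hlift _ hb2 (fun n => mul_nonneg (Nat.cast_nonneg n) (hB0 n))
  have hpB : ∀ z n, p z n ≤ ρ ^ n / (n.factorial : ℝ) := fun z n =>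
    le_of_tendsto (tp z n) (Eventually.of_forall fun k => h13 k z n)
  have hS1 : Summable fun q : Z × ℕ => p q.1 q.2 :=
    Summable.of_nonneg_of_le (fun q => (hp _ _).1) (fun q => hpB _ _) hB1
  have hS2 : Summable fun q : Z × ℕ => p q.1 q.2 * V q.1 (q.2 + 1) :=
    Summable.of_nonneg_of_le (fun q => mul_nonneg (hp _ _).1 (hV _ _).1)
      (fun q => mul_le_mul_of_nonneg_left (hV _ _).2 (hp _ _).1) (hS1.mul_right M)
  refine ⟨ξ, V, p, κ, W, hξ, ?_, ?_, ?_, hV, ?_, hp, hκ, hW, ?_, ?_, ?_, hS1, hS2, ?_, ?_, ?_⟩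
  · intro z
    refine tendsto_nhds_unique (tξ z 0) ?_
    simp only [h2]; exact tendsto_const_nhds
  · intro z n
    exact le_of_tendsto_of_tendsto' (tξ z (n + 1)) (tξ z n) (fun k => h3 k z n)
  · intro z n
    have := ((tendsto_const_nhds (x := (1:ℝ))).sub (tξ z n)).mul (tξ z (n + 1))
    refine tendsto_nhds_unique this ?_
    simp only [h4]; exact tendsto_const_nhds
  · intro z n hn
    exact le_of_tendsto_of_tendsto' (tV z (n + 1)) (tV z n) (fun k => h6 k z n hn)
  · intro z n
    have key : Tendsto (fun k => tQ μ lam γ (n + 1) (κs k) (ξs k) (ps k) z n) ℓ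
        (𝓝 (tQ μ lam γ (n + 1) κ ξ p z n)) := by
      unfold tQ
      rw [if_pos (Nat.lt_succ_self n)]
      have e1 : Tendsto (fun k => if 1 ≤ n then ps k z (n - 1) else 0) ℓ
          (𝓝 (if 1 ≤ n then p z (n - 1) else 0)) := by
        split_ifs
        · exact tp _ _
        · exact tendsto_const_nhds
      have c1 : ∀ c : ℝ, Tendsto (fun _ : ℕ => c) ℓ (𝓝 c) := fun c => tendsto_const_nhds
      have e2 : ∀ m, Tendsto (fun k => 1 - γ * ξs k z m) ℓ (𝓝 (1 - γ * ξ z m)) := fun m =>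
        (c1 1).sub ((c1 γ).mul (tξ z m))
      simp only [if_pos (Nat.lt_succ_self n)]
      exact ((((tendsto_finsetSum _ fun w _ => (tp w n).mul (c1 _)).sub
        ((tp z n).mul (c1 _))).add (tκ.mul (e1.sub (tp z n)))).add
        (((c1 _).mul (e2 _)).mul (tp z (n + 1)))).sub (((c1 _).mul (e2 _)).mul (tp z n))
    refine tendsto_nhds_unique key ((tendsto_const_nhds (x := (0:ℝ))).congr' ?_)
    filter_upwards [hev (n + 1)] with k hk
    exact (h10 k z n (by omega)).symm
  · intro z n hn
    have key : Tendsto (fun k => tH μ lam γ F (κs k) (Ws k) (ξs k) (Vs k) z n) ℓ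
        (𝓝 (tH μ lam γ F κ W ξ V z n)) := by
      unfold tH
      have c1 : ∀ c : ℝ, Tendsto (fun _ : ℕ => c) ℓ (𝓝 c) := fun c => tendsto_const_nhds
      have e2 : ∀ m, Tendsto (fun k => 1 - γ * ξs k z m) ℓ (𝓝 (1 - γ * ξ z m)) := fun m =>
        (c1 1).sub ((c1 γ).mul (tξ z m))
      exact ((((c1 lam).mul (((c1 _).add ((c1 γ).mul ((tV z n).max tW))).sub (tV z n))).add
        (tκ.mul ((tV _ _).sub (tV _ _)))).add
        (tendsto_finsetSum _ fun w _ => (c1 _).mul ((tV w n).sub (tV z n)))).add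
        (((c1 _).mul (e2 _)).mul ((tV _ _).sub (tV _ _)))
    refine tendsto_nhds_unique key ((tendsto_const_nhds (x := (0:ℝ))).congr' ?_)
    filter_upwards [hev n] with k hk
    exact (h11 k z n hn (by omega)).symm
  · intro z n hn
    constructor
    · intro h
      refine tendsto_nhds_unique (tξ z n) ((tendsto_const_nhds (x := (1:ℝ))).congr' ?_)
      filter_upwards [hev n, tW.eventually_lt (tV z n) h] with k hk hlt
      exact ((h12 k z n hn (by omega)).1 hlt).symm
    · intro h
      refine tendsto_nhds_unique (tξ z n) ((tendsto_const_nhds (x := (0:ℝ))).congr' ?_)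
      filter_upwards [hev n, (tV z n).eventually_lt tW h] with k hk hlt
      exact ((h12 k z n hn (by omega)).2 hlt).symm
  · have := tendsto_tsum_of_dominated_convergence (𝓕 := ℓ)
      (f := fun k (q : Z × ℕ) => ps k q.1 q.2) (g := fun q => p q.1 q.2)
      (bound := fun q => ρ ^ q.2 / (q.2.factorial : ℝ)) hB1 (fun q => tp _ _)
      (Eventually.of_forall fun k q => by
        rw [Real.norm_of_nonneg (h7 k _ _).1]; exact h13 k _ _)
    simp only [h14] at this
    exact tendsto_nhds_unique this tendsto_const_nhds
  · have := tendsto_tsum_of_dominated_convergence (𝓕 := ℓ)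
      (f := fun k (q : Z × ℕ) => (q.2 : ℝ) * ps k q.1 q.2)
      (g := fun q => (q.2 : ℝ) * p q.1 q.2)
      (bound := fun q => (q.2 : ℝ) * (ρ ^ q.2 / (q.2.factorial : ℝ))) hB2
      (fun q => (tp _ _).const_mul _)
      (Eventually.of_forall fun k q => by
        rw [Real.norm_of_nonneg (mul_nonneg (Nat.cast_nonneg _) (h7 k _ _).1)]
        exact mul_le_mul_of_nonneg_left (h13 k _ _) (Nat.cast_nonneg _))
    simp only [h15] at this
    exact tendsto_nhds_unique this tendsto_const_nhds
  · have := tendsto_tsum_of_dominated_convergence (𝓕 := ℓ)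
      (f := fun k (q : Z × ℕ) => ps k q.1 q.2 * Vs k q.1 (q.2 + 1))
      (g := fun q => p q.1 q.2 * V q.1 (q.2 + 1))
      (bound := fun q => ρ ^ q.2 / (q.2.factorial : ℝ) * M) (hB1.mul_right M)
      (fun q => (tp _ _).mul (tV _ _))
      (Eventually.of_forall fun k q => by
        rw [Real.norm_of_nonneg (mul_nonneg (h7 k _ _).1 (h5 k _ _).1)]
        exact mul_le_mul (h13 k _ _) (h5 k _ _).2 (h5 k _ _).1 (hB0 _))
    simp only [h16] at this
    exact tendsto_nhds_unique this tW

lemma l_zero [Fintype Z] [DecidableEq Z] (μ : Z → Z → ℝ)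
    (hμ : ∀ z y : Z, z ≠ y → 0 < μ z y) (lam γ κ : ℝ) (hκ : 0 ≤ κ) (hlam : 0 < lam)
    (hγ0 : 0 < γ) (hγ1 : γ < 1) (ξ p : Z → ℕ → ℝ)
    (hξ : ∀ z n, 0 ≤ ξ z n ∧ ξ z n ≤ 1) (hp : ∀ z n, 0 ≤ p z n)
    (hQ : ∀ z n, tQ μ lam γ (n + 1) κ ξ p z n = 0) (z0 : Z) (h0 : p z0 0 = 0) :
    ∀ n z, p z n = 0 := by
  have ha : ∀ z n, 0 < 1 - γ * ξ z n := fun z n => by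
    have := hξ z n
    nlinarith
  intro n
  induction n with
  | zero =>
    intro z
    by_cases hz : z = z0
    · rw [hz, h0]
    have h := hQ z0 0
    unfold tQ at h
    simp only [h0] at h
    have hs : 0 ≤ ∑ w ∈ Finset.univ.filter (fun w => w ≠ z0), p w 0 * μ w z0 :=
      Finset.sum_nonneg fun w hw => mul_nonneg (hp _ _) (hμ _ _ (by simpa using hw)).le
    have ht : p z 0 * μ z z0 ≤ ∑ w ∈ Finset.univ.filter (fun w => w ≠ z0), p w 0 * μ w z0 :=
      Finset.single_le_sum (f := fun w => p w 0 * μ w z0)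
        (fun w hw => mul_nonneg (hp _ _) (hμ _ _ (by simpa using hw)).le) (by simpa using hz)
    have hu : 0 ≤ lam * ((0:ℕ) + 1) * (1 - γ * ξ z0 (0 + 1)) * p z0 (0 + 1) :=
      mul_nonneg (mul_nonneg (by push_cast; linarith) (ha _ _).le) (hp _ _)
    have hle : p z 0 * μ z z0 ≤ 0 := by
      simp at h hu ⊢
      linarith
    have := hμ z z0 hz
    have := hp z 0
    nlinarith
  | succ n ih =>
    intro z
    have h := hQ z n
    unfold tQ at h
    have hprev : 0 ≤ κ * (if 1 ≤ n then p z (n - 1) else 0) := by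
      split_ifs
      · exact mul_nonneg hκ (hp _ _)
      · simp
    simp only [ih, zero_mul, Finset.sum_const_zero, mul_zero, sub_zero, zero_add, ite_self] at h
    have h1 : 0 < lam * ((n : ℝ) + 1) * (1 - γ * ξ z (n + 1)) :=
      mul_pos (by positivity) (ha _ _)
    have := hp z (n + 1)
    nlinarith

lemma l_stop [Fintype Z] [DecidableEq Z] (μ : Z → Z → ℝ)
    (hμ : ∀ z y : Z, z ≠ y → 0 < μ z y) (lam γ κ W M : ℝ) (hlam : 0 < lam)
    (hγ0 : 0 < γ) (hγ1 : γ < 1) (hW : 0 < W) (F ξ V : Z → ℕ → ℝ)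
    (hFl : ∀ z, Tendsto (fun n => F z n) atTop (𝓝 0))
    (hξ : ∀ z n, 0 ≤ ξ z n ∧ ξ z n ≤ 1) (hV : ∀ z n, 0 ≤ V z n ∧ V z n ≤ M)
    (hVa : ∀ z n, 1 ≤ n → V z (n + 1) ≤ V z n)
    (hH : ∀ z n, 1 ≤ n → tH μ lam γ F κ W ξ V z n = 0) (z1 : Z) :
    ∃ n, 1 ≤ n ∧ V z1 n < W := by
  by_contra hcon
  push Not at hcon
  have hlim : ∀ z, ∃ l, Tendsto (fun n => V z (n + 1)) atTop (𝓝 l) := fun z =>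
    ⟨_, tendsto_atTop_ciInf
      (antitone_nat_of_succ_le (f := fun n => V z (n + 1)) fun n => hVa z (n + 1) (by omega))
      ⟨0, by rintro _ ⟨n, rfl⟩; exact (hV _ _).1⟩⟩
  choose l hl using hlim
  obtain ⟨zs, -, hzs⟩ := Finset.exists_max_image Finset.univ l ⟨z1, Finset.mem_univ _⟩
  have hlW : W ≤ l zs := (ge_of_tendsto' (hl z1) fun n => hcon (n + 1) (by omega)).trans
    (hzs z1 (Finset.mem_univ _))
  have hl2 : ∀ z, Tendsto (fun n => V z (n + 2)) atTop (𝓝 (l z)) := fun z =>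
    (hl z).comp (tendsto_add_atTop_nat 1)
  have hl3 : ∀ z, Tendsto (fun n => V z (n + 3)) atTop (𝓝 (l z)) := fun z =>
    (hl z).comp (tendsto_add_atTop_nat 2)
  have hF2 : Tendsto (fun n => F zs (n + 2)) atTop (𝓝 0) :=
    (hFl zs).comp (tendsto_add_atTop_nat 2)
  have c1 : ∀ c : ℝ, Tendsto (fun _ : ℕ => c) atTop (𝓝 c) := fun c => tendsto_const_nhds
  have key : Tendsto (fun n : ℕ => lam * (V zs (n + 2) - F zs (n + 2)
        - γ * max (V zs (n + 2)) W) + κ * (V zs (n + 2) - V zs (n + 3))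
        + ∑ w ∈ Finset.univ.filter (fun w => w ≠ zs), μ zs w * (V zs (n + 2) - V w (n + 2)))
      atTop (𝓝 (lam * (l zs - 0 - γ * max (l zs) W) + κ * (l zs - l zs)
        + ∑ w ∈ Finset.univ.filter (fun w => w ≠ zs), μ zs w * (l zs - l w))) :=
    (((c1 lam).mul (((hl2 zs).sub hF2).sub ((c1 γ).mul ((hl2 zs).max (c1 W))))).add
      ((c1 κ).mul ((hl2 zs).sub (hl3 zs)))).add
      (tendsto_finsetSum _ fun w _ => (c1 _).mul ((hl2 zs).sub (hl2 w)))
  set c : ℝ := lam * (1 - γ) * W / 2 with hc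
  have hc0 : 0 < c := by
    have : 0 < 1 - γ := by linarith
    positivity
  have hgt : c < lam * (l zs - 0 - γ * max (l zs) W) + κ * (l zs - l zs)
        + ∑ w ∈ Finset.univ.filter (fun w => w ≠ zs), μ zs w * (l zs - l w) := by
    rw [max_eq_left hlW]
    have : 0 ≤ ∑ w ∈ Finset.univ.filter (fun w => w ≠ zs), μ zs w * (l zs - l w) :=
      Finset.sum_nonneg fun w hw => mul_nonneg
        (hμ _ _ (Ne.symm (by simpa using hw))).le (sub_nonneg.2 (hzs w (Finset.mem_univ _)))
    have h2 : lam * (1 - γ) * W ≤ lam * (1 - γ) * l zs :=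
      mul_le_mul_of_nonneg_left hlW (by have : 0 < 1 - γ := by linarith
                                        positivity)
    linarith
  have hD : ∀ᶠ n : ℕ in atTop, c / lam * (1 / ((n : ℝ) + 1)) ≤ V zs (n + 1) - V zs (n + 2) := by
    filter_upwards [key.eventually_const_lt hgt] with n hn
    have h := hH zs (n + 2) (by omega)
    unfold tH at h
    have e : n + 2 - 1 = n + 1 := by omega
    rw [e] at h
    push_cast at h
    have hs : ∑ w ∈ Finset.univ.filter (fun w => w ≠ zs), μ zs w * (V zs (n + 2) - V w (n + 2))
        = - ∑ w ∈ Finset.univ.filter (fun w => w ≠ zs), μ zs w * (V w (n + 2) - V zs (n + 2)) := by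
      rw [← Finset.sum_neg_distrib]
      exact Finset.sum_congr rfl fun w _ => by ring
    rw [hs] at hn
    have hd : 0 ≤ V zs (n + 1) - V zs (n + 2) := sub_nonneg.2 (hVa zs (n + 1) (by omega))
    have hn0 : (0:ℝ) < (n : ℝ) + 1 := by positivity
    have h3 : 0 ≤ ((n : ℝ) + 1) * lam * (γ * ξ zs (n + 2)) * (V zs (n + 1) - V zs (n + 2)) := by
      have := (hξ zs (n + 2)).1
      positivity
    have h4 : c ≤ ((n : ℝ) + 1) * lam * (V zs (n + 1) - V zs (n + 2)) := by
      have e3 : n + 2 + 1 = n + 3 := rfl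
      rw [e3] at h
      nlinarith
    rw [div_mul_div_comm, mul_one, div_le_iff₀ (by positivity)]
    linarith
  have hsum : Summable fun n : ℕ => V zs (n + 1) - V zs (n + 2) := by
    refine summable_of_sum_range_le (c := M) (fun n => sub_nonneg.2 (hVa zs (n + 1) (by omega)))
      fun n => ?_
    have := Finset.sum_range_sub' (fun n => V zs (n + 1)) n
    rw [this]
    have := (hV zs (n + 1)).1
    have := (hV zs (0 + 1)).2
    linarith
  have hs2 : Summable fun n : ℕ => c / lam * (1 / ((n : ℝ) + 1)) := by
    refine Summable.of_norm_bounded_eventually_nat hsum ?_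
    filter_upwards [hD] with n hn
    rwa [Real.norm_of_nonneg (by positivity)]
  rw [summable_mul_left_iff (by positivity)] at hs2
  apply Real.not_summable_one_div_natCast
  rw [← summable_nat_add_iff 1]
  simpa using hs2

lemma l_threshold (ξ : Z → ℕ → ℝ) (h01 : ∀ z n, 0 ≤ ξ z n ∧ ξ z n ≤ 1)
    (ha : ∀ z n, ξ z (n + 1) ≤ ξ z n) (hm : ∀ z n, (1 - ξ z n) * ξ z (n + 1) = 0)
    (hex : ∀ z, ∃ n, ξ z n < 1) :
    ∃ x : Z → ℝ, (∀ z, 0 ≤ x z) ∧ thresholdStrategy x = ξ := by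
  classical
  refine ⟨fun z => (Nat.find (hex z) : ℝ) + ξ z (Nat.find (hex z)), fun z =>
    add_nonneg (Nat.cast_nonneg _) (h01 _ _).1, ?_⟩
  funext z n
  have hk := Nat.find_spec (hex z)
  have hlt : ∀ m, m < Nat.find (hex z) → ξ z m = 1 := fun m hm' =>
    le_antisymm (h01 _ _).2 (not_lt.1 (Nat.find_min (hex z) hm'))
  unfold thresholdStrategy
  simp only
  set k := Nat.find (hex z) with hkdef
  have hfl : ⌊(k : ℝ) + ξ z k⌋ = (k : ℤ) := by
    rw [Int.floor_eq_iff]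
    have := (h01 z k).1
    constructor
    · push_cast; linarith
    · push_cast; linarith
  rw [hfl]
  rcases lt_trichotomy n k with h | h | h
  · rw [if_pos (by exact_mod_cast h), hlt n h]
  · subst h
    simp
  · rw [if_neg (by exact_mod_cast h.le.not_gt), if_neg (by exact_mod_cast h.ne')]
    have h1 : ξ z (k + 1) = 0 := by
      rcases mul_eq_zero.1 (hm z k) with h2 | h2
      · linarith
      · exact h2
    have h2 : ξ z n ≤ ξ z (k + 1) := antitone_nat_of_succ_le (ha z) (by omega)
    linarith [(h01 z n).1]

lemma l_main [Fintype Z] [DecidableEq Z] [Nonempty Z] (μ : Z → Z → ℝ)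
    (hμ : ∀ z y : Z, z ≠ y → 0 < μ z y) (lam γ β : ℝ) (hlam : 0 < lam)
    (hγ0 : 0 < γ) (hγ1 : γ < 1) (hβ : 0 < β) (F : Z → ℕ → ℝ) (hF : IsResourceSharing F)
    (hdec : ∀ z : Z, ∀ n : ℕ, 1 ≤ n → F z (n + 1) ≤ F z n) :
    ∃ (x : Z → ℝ) (κ V_sw : ℝ) (π V V_st : Z → ℕ → ℝ),
      (∀ z, 0 ≤ x z) ∧
      IsMFE μ lam γ β F (thresholdStrategy x) κ V_sw π V V_st := by
  obtain ⟨hF0, ⟨z0, n0, hn0, hFpos⟩, hFl⟩ := hF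
  have hγ' : 0 < 1 - γ := by linarith
  have hF1 : ∀ z n, 1 ≤ n → F z n ≤ F z 1 := by
    intro z n hn
    induction n, hn using Nat.le_induction with
    | base => exact le_rfl
    | succ n hn ih => exact (hdec z n hn).trans ih
  set M0 : ℝ := ∑ z, F z 1 with hM0
  have hM00 : 0 ≤ M0 := Finset.sum_nonneg fun z _ => hF0 z 1
  have hle : ∀ z, F z 1 ≤ M0 := fun z =>
    Finset.single_le_sum (f := fun z => F z 1) (fun z _ => hF0 z 1) (Finset.mem_univ z)
  set M : ℝ := M0 / (1 - γ) with hM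
  have hMM : (1 - γ) * M = M0 := by rw [hM]; field_simp
  have hMp : 0 ≤ M := div_nonneg hM00 hγ'.le
  obtain ⟨ξ, V, p, κ, W, hξ, hξ0, hξa, hξm, hV, hVa, hp, hκ, hW, hQ, hH, hopt, hS1, hS2, hT, hD,
    hC⟩ := l_exists μ hμ lam γ β hlam hγ0 hγ1 hβ F hF0 hdec M hMp
      (fun z n hn => by rw [hMM]; exact (hF1 z n hn).trans (hle z))
  have hκ0 : 0 < κ := lt_of_lt_of_le (by positivity) hκ.1
  have hF01 : 0 < F z0 1 := lt_of_lt_of_le hFpos (hF1 z0 n0 hn0)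
  have hW0 : 0 < W := by
    rcases hW.1.lt_or_eq with h | h
    · exact h
    exfalso
    have hz : ∀ z n, p z n * V z (n + 1) = 0 := by
      have h0 : HasSum (fun q : Z × ℕ => p q.1 q.2 * V q.1 (q.2 + 1)) 0 := by
        have := hS2.hasSum
        rwa [hC, ← h] at this
      have := (hasSum_zero_iff_of_nonneg
        (fun q : Z × ℕ => mul_nonneg (hp q.1 q.2).1 (hV q.1 (q.2 + 1)).1)).1 h0
      intro z n
      exact congrFun this (z, n)
    have hV1 : V z0 1 = 0 := by
      rcases mul_eq_zero.1 (hz z0 0) with h1 | h1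
      · exfalso
        have hall := l_zero μ hμ lam γ κ hκ0.le hlam hγ0 hγ1 ξ p hξ (fun z n => (hp z n).1) hQ z0 h1
        simp only [hall, tsum_zero] at hT
        exact zero_ne_one hT
      · exact h1
    have h1 := hH z0 1 le_rfl
    unfold tH at h1
    rw [← h, hV1] at h1
    have hs : 0 ≤ ∑ w ∈ Finset.univ.filter (fun w => w ≠ z0), μ z0 w * (V w 1 - 0) :=
      Finset.sum_nonneg fun w hw => mul_nonneg (hμ _ _ (Ne.symm (by simpa using hw))).le
        (by rw [sub_zero]; exact (hV _ _).1)
    have h2 : 0 ≤ κ * (V z0 (1 + 1) - 0) := mul_nonneg hκ0.le (by rw [sub_zero]; exact (hV _ _).1)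
    have h3 : 0 < lam * F z0 1 := mul_pos hlam hF01
    simp only [Nat.cast_one, sub_self, zero_mul, max_self, mul_zero, add_zero, sub_zero] at h1 hs h2
    linarith
  have hex : ∀ z, ∃ n, ξ z n < 1 := by
    intro z
    obtain ⟨n, hn, hlt⟩ := l_stop μ hμ lam γ κ W M hlam hγ0 hγ1 hW0 F ξ V hFl hξ hV hVa hH z
    exact ⟨n, by rw [(hopt z n hn).2 hlt]; exact one_pos⟩
  obtain ⟨x, hx, hxξ⟩ := l_threshold ξ hξ hξa hξm hex
  refine ⟨x, κ, W, p, fun z n => F z n + γ * max (V z n) W, V, hx, ?_⟩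
  rw [hxξ]
  refine ⟨hξ, hκ0, hW0, ⟨fun z n => (hp z n).1, hS1, hT, ?_⟩, ⟨?_, ?_, ?_⟩, hopt, hC.symm, hD⟩
  · intro z m
    have h := hQ z m
    unfold tQ at h
    rw [if_pos (Nat.lt_succ_self m)] at h
    linarith
  · refine ⟨(∑ z, F z 0) + M0 + γ * M, fun z n => ?_⟩
    have h0 : F z 0 ≤ ∑ z, F z 0 :=
      Finset.single_le_sum (f := fun z => F z 0) (fun z _ => hF0 z 0) (Finset.mem_univ z)
    have h00 : 0 ≤ ∑ z, F z 0 := Finset.sum_nonneg fun z _ => hF0 z 0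
    have hFn : F z n ≤ (∑ z, F z 0) + M0 := by
      rcases Nat.eq_zero_or_pos n with h | h
      · subst h; linarith
      · linarith [hF1 z n h, hle z]
    have hmx : max (V z n) W ≤ M := max_le (hV z n).2 hW.2
    have hmx0 : 0 ≤ max (V z n) W := le_max_of_le_right hW.1
    have := hF0 z n
    rw [abs_of_nonneg (by positivity)]
    have := mul_le_mul_of_nonneg_left hmx hγ0.le
    linarith
  · exact ⟨M, fun z n => by rw [abs_of_nonneg (hV z n).1]; exact (hV z n).2⟩
  · intro z n hn
    refine ⟨rfl, ?_⟩
    have h := hH z n hn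
    unfold tH at h
    have hs : ∑ w ∈ Finset.univ.filter (fun w => w ≠ z), μ z w * (V w n - V z n)
        = (∑ w ∈ Finset.univ.filter (fun w => w ≠ z), μ z w * V w n)
          - (∑ w ∈ Finset.univ.filter (fun w => w ≠ z), μ z w) * V z n := by
      rw [Finset.sum_mul, ← Finset.sum_sub_distrib]
      exact Finset.sum_congr rfl fun w _ => by ring
    rw [hs] at h
    simp only
    linarith


end

/-- **Existence of a threshold mean field equilibrium** (Theorem 2 of the paper):
if the resource-sharing function is decreasing in the number of agents, then there is
a mean field equilibrium whose strategy is a threshold strategy. -/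
theorem mfe_threshold_existence (Z : Type) [Fintype Z] [DecidableEq Z] [Nonempty Z]
    (μ : Z → Z → ℝ) (hμ : ∀ z y : Z, z ≠ y → 0 < μ z y)
    (lam γ β : ℝ) (hlam : 0 < lam) (hγ : γ ∈ Set.Ioo (0 : ℝ) 1) (hβ : 0 < β)
    (F : Z → ℕ → ℝ) (hF : IsResourceSharing F)
    (hdec : ∀ z : Z, ∀ n : ℕ, 1 ≤ n → F z (n + 1) ≤ F z n) :
    ∃ (x : Z → ℝ) (κ V_sw : ℝ) (π V V_st : Z → ℕ → ℝ),
      (∀ z, 0 ≤ x z) ∧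
      IsMFE μ lam γ β F (thresholdStrategy x) κ V_sw π V V_st := by
  exact l_main μ hμ lam γ β hlam hγ.1 hγ.2 hβ F hF hdec
end

section
/- Let S = Z × ℕ where Z is a nonempty finite set, equipped with the discrete (⊤) measurable structure, and let P be a Markov (probability) kernel from S to S that preserves monotonicity in the second coordinate: for every bounded measurable f : S → ℝ such that f(z,·) is antitone on ℕ for each z ∈ Z, the function (z,n) ↦ ∫ f dP(z,n) is antitone in n for each z. Let F : S → ℝ be bounded with F(z,·) antitone for each z, let γ ∈ (0,1) and V_sw ∈ ℝ. Then there is a unique bounded V : S → ℝ satisfying V(s) = F(s) + γ·max(∫ V dP(s), V_sw) for all s ∈ S, and the continuation value V_st(z,n) := ∫ V dP(z,n) is antitone in n for each z ∈ Z. -/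
open MeasureTheory ProbabilityTheory

/-- The state space `S = Z × ℕ` of the single-location model, carrying the
discrete (`⊤`) σ-algebra. -/
abbrev ModelState (Z : Type) : Type := Z × ℕ

instance (Z : Type) : MeasurableSpace (ModelState Z) := ⊤

/-- **Monotone continuation values for decreasing payoffs** (Lemma 3 /
Lemma `value-decreasing` of the paper, in an abstract one-epoch form): if the
transition kernel `P` of one decision epoch preserves antitonicity in the number
of agents, and the payoff `F(z,·)` is antitone, then the Bellman equation
`V(s) = F(s) + γ·max(∫ V dP(s), V_sw)` has a unique bounded solution `V`, and
its continuation value `V_st(z,n) = ∫ V dP(z,n)` is antitone in `n` for each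
resource level `z`. -/
theorem continuation_value_antitone (Z : Type) [Fintype Z] [Nonempty Z]
    (P : Kernel (ModelState Z) (ModelState Z)) [IsMarkovKernel P]
    (hP : ∀ f : ModelState Z → ℝ, Measurable f → (∃ M, ∀ s, |f s| ≤ M) →
      (∀ z : Z, Antitone fun n : ℕ => f (z, n)) →
      ∀ z : Z, Antitone fun n : ℕ => ∫ t, f t ∂(P (z, n)))
    (F : ModelState Z → ℝ) (hFb : ∃ M, ∀ s, |F s| ≤ M)
    (hFa : ∀ z : Z, Antitone fun n : ℕ => F (z, n))
    (γ : ℝ) (hγ : γ ∈ Set.Ioo (0 : ℝ) 1) (Vsw : ℝ) :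
    (∃! V : ModelState Z → ℝ,
      (∃ M, ∀ s, |V s| ≤ M) ∧
      ∀ s, V s = F s + γ * max (∫ t, V t ∂(P s)) Vsw) ∧
    ∀ V : ModelState Z → ℝ,
      (∃ M, ∀ s, |V s| ≤ M) →
      (∀ s, V s = F s + γ * max (∫ t, V t ∂(P s)) Vsw) →
      ∀ z : Z, Antitone fun n : ℕ => ∫ t, V t ∂(P (z, n)) := by
  classical
  letI : TopologicalSpace Z := ⊥
  haveI : DiscreteTopology Z := ⟨rfl⟩
  obtain ⟨hγ0, hγ1⟩ := hγ
  obtain ⟨MF, hMF⟩ := hFb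
  have hmeas : ∀ f : ModelState Z → ℝ, Measurable f := fun f => measurable_from_top
  have hint : ∀ (f : ModelState Z → ℝ) (M : ℝ), (∀ s, |f s| ≤ M) → ∀ s, Integrable f (P s) := by
    intro f M hM s
    exact Integrable.of_bound (hmeas f).aestronglyMeasurable M
      (Filter.Eventually.of_forall fun t => by simpa using hM t)
  have hbd : ∀ (f : ModelState Z → ℝ) (M : ℝ), (∀ s, |f s| ≤ M) → ∀ s, |∫ t, f t ∂(P s)| ≤ M := by
    intro f M hM s
    have := norm_integral_le_of_norm_le_const (μ := P s) (f := f) (C := M)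
      (Filter.Eventually.of_forall fun t => by simpa using hM t)
    simpa using this
  let T : (ModelState Z → ℝ) → ModelState Z → ℝ :=
    fun V s => F s + γ * max (∫ t, V t ∂(P s)) Vsw
  have hTb : ∀ (f : ModelState Z → ℝ) (M : ℝ), (∀ s, |f s| ≤ M) →
      ∀ s, ‖T f s‖ ≤ MF + γ * max M |Vsw| := by
    intro f M hM s
    have h1 : |max (∫ t, f t ∂(P s)) Vsw| ≤ max M |Vsw| :=
      abs_max_le_max_abs_abs.trans (max_le_max (hbd f M hM s) le_rfl)
    calc ‖T f s‖ ≤ |F s| + |γ * max (∫ t, f t ∂(P s)) Vsw| := abs_add_le _ _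
      _ ≤ _ := by
        rw [abs_mul, abs_of_pos hγ0]
        exact add_le_add (hMF s) (mul_le_mul_of_nonneg_left h1 hγ0.le)
  have hB : ∀ (g : BoundedContinuousFunction (ModelState Z) ℝ) s, |g s| ≤ ‖g‖ :=
    fun g s => g.norm_coe_le_norm s
  let Φ : BoundedContinuousFunction (ModelState Z) ℝ → BoundedContinuousFunction (ModelState Z) ℝ :=
    fun g => BoundedContinuousFunction.ofNormedAddCommGroupDiscrete (T g) _ (hTb g ‖g‖ (hB g))
  have hΦ : ∀ g s, Φ g s = T g s := fun g s => rfl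
  have hc : ContractingWith ⟨γ, hγ0.le⟩ Φ := by
    refine ⟨by exact_mod_cast hγ1, LipschitzWith.of_dist_le_mul fun f g => ?_⟩
    rw [BoundedContinuousFunction.dist_le (by positivity)]
    intro s
    have h0 : |∫ t, f t ∂(P s) - ∫ t, g t ∂(P s)| ≤ dist f g := by
      rw [← integral_sub (hint f _ (hB f) s) (hint g _ (hB g) s)]
      exact hbd (fun t => f t - g t) _
        (fun t => BoundedContinuousFunction.dist_coe_le_dist (f := f) (g := g) t) s
    have h1 : |max (∫ t, f t ∂(P s)) Vsw - max (∫ t, g t ∂(P s)) Vsw| ≤ dist f g :=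
      (abs_max_sub_max_le_abs _ _ _).trans h0
    rw [hΦ, hΦ, Real.dist_eq]
    have : T f s - T g s = γ * (max (∫ t, f t ∂(P s)) Vsw - max (∫ t, g t ∂(P s)) Vsw) := by
      simp only [T]; ring
    rw [this, abs_mul, abs_of_pos hγ0]
    exact mul_le_mul_of_nonneg_left h1 hγ0.le
  set W := ContractingWith.fixedPoint Φ hc with hW
  have hfix : Φ W = W := hc.fixedPoint_isFixedPt
  have huniq : ∀ V : ModelState Z → ℝ, (∃ M, ∀ s, |V s| ≤ M) →
      (∀ s, V s = F s + γ * max (∫ t, V t ∂(P s)) Vsw) → V = W := by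
    rintro V ⟨M, hM⟩ hV
    let v : BoundedContinuousFunction (ModelState Z) ℝ :=
      BoundedContinuousFunction.ofNormedAddCommGroupDiscrete V M hM
    have hv : Φ v = v := by
      ext s
      exact (hV s).symm
    have : v = W := hc.fixedPoint_unique hv
    rw [← this]
    rfl
  refine ⟨⟨W, ⟨⟨‖W‖, hB W⟩, fun s => ?_⟩, fun V hV => huniq V hV.1 hV.2⟩, ?_⟩
  · exact (DFunLike.congr_fun hfix s).symm
  · intro V hVb hV
    rw [huniq V hVb hV]
    refine hP W (hmeas _) ⟨‖W‖, hB W⟩ ?_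
    have hit : ∀ k : ℕ, ∀ z : Z, Antitone fun n : ℕ => (Φ^[k] 0) (z, n) := by
      intro k
      induction k with
      | zero => intro z m n _; exact le_rfl
      | succ k ih =>
        intro z m n hmn
        simp only [Function.iterate_succ_apply', hΦ]
        have := hP (Φ^[k] 0) (hmeas _) ⟨_, hB _⟩ ih z hmn
        exact add_le_add (hFa z hmn)
          (mul_le_mul_of_nonneg_left (max_le_max this le_rfl) hγ0.le)
    have hlim : ∀ s, Filter.Tendsto (fun k : ℕ => (Φ^[k] 0) s) Filter.atTop (nhds (W s)) := by
      intro s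
      exact ((continuous_eval_const (F := BoundedContinuousFunction (ModelState Z) ℝ) s).tendsto W).comp
        (hc.tendsto_iterate_fixedPoint 0)
    intro z m n hmn
    exact le_of_tendsto_of_tendsto' (hlim (z, n)) (hlim (z, m)) fun k => hit k z hmn
end
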